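/- Let d = 2^r · 3^s with integers r ≥ 1 and s ≥ 1, let c be a nonzero integer, and let f(z) = z^d + 1/c ∈ ℚ[z]. If f is irreducible over ℚ, then f is stable over ℚ, i.e., every iterate fⁿ (n ≥ 1) is irreducible over ℚ. -/

import Mathlib

section
theorem pow_gap_aux (U n : ℕ) : (n + 1) * U ^ n + U ^ (n + 1) ≤ (U + 1) ^ (n + 1) := by
  induction n with
  | zero => simp; omega
  | succ k ih =>
    calc (k + 1 + 1) * U ^ (k + 1) + U ^ (k + 1 + 1)
        ≤ ((k + 1) * U ^ k + U ^ (k + 1)) * (U + 1) := by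
          have : 0 ≤ (k + 1) * U ^ k := Nat.zero_le _
          ring_nf
          nlinarith [Nat.zero_le (k * U ^ k), Nat.zero_le (U ^ k)]
      _ ≤ (U + 1) ^ (k + 1) * (U + 1) := Nat.mul_le_mul_right _ ih
      _ = _ := by ring

theorem pow_gap_nat (U V n : ℕ) (h : U < V) : (n + 1) * U ^ n + U ^ (n + 1) ≤ V ^ (n + 1) :=
  (pow_gap_aux U n).trans (Nat.pow_le_pow_left h _)

/-- nat version -/
theorem close_nat (U V D : ℕ) (N ε : ℝ) (hD : 1 ≤ D) (hN : 0 < N) (hU : 1 ≤ U) (hUV : U ≠ V)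
    (hε : ε ≤ 4 / 5) (h : |N * (U:ℝ) ^ D - N * (V:ℝ) ^ D| ≤ ε * (N * (U:ℝ) ^ D)) :
    (D:ℝ) ≤ 5 * ε * U := by
  obtain ⟨n, rfl⟩ : ∃ n, D = n + 1 := ⟨D - 1, by omega⟩
  have hUr : (1:ℝ) ≤ U := by exact_mod_cast hU
  rcases lt_or_gt_of_ne hUV with hlt | hlt
  · have g := pow_gap_nat U V n hlt
    have g' : ((n:ℝ) + 1) * (U:ℝ) ^ n + (U:ℝ) ^ (n + 1) ≤ (V:ℝ) ^ (n + 1) := by exact_mod_cast g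
    have h2 := (abs_le.1 h).1
    have hp : (0:ℝ) < N * (U:ℝ) ^ n := by positivity
    have h3 : ((n:ℝ) + 1) * (N * (U:ℝ) ^ n) ≤ (ε * U) * (N * (U:ℝ) ^ n) := by
      have := mul_le_mul_of_nonneg_left g' hN.le
      rw [pow_succ (U:ℝ)] at this h2
      nlinarith
    have h4 := le_of_mul_le_mul_right h3 hp
    push_cast
    have : (0:ℝ) ≤ n := Nat.cast_nonneg n
    nlinarith
  · have g := pow_gap_nat V U n hlt
    have g' : ((n:ℝ) + 1) * (V:ℝ) ^ n + (V:ℝ) ^ (n + 1) ≤ (U:ℝ) ^ (n + 1) := by exact_mod_cast g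
    have h2 := (abs_le.1 h).2
    have hVU : (V:ℝ) ≤ U := by exact_mod_cast hlt.le
    have hUp : (0:ℝ) < (U:ℝ) ^ (n + 1) := by positivity
    have hNU : 0 < N * (U:ℝ) ^ (n + 1) := by positivity
    have h5 : (U:ℝ) ^ (n + 1) ≤ 5 * (V:ℝ) ^ (n + 1) := by
      have : N * (U:ℝ) ^ (n + 1) ≤ N * (5 * (V:ℝ) ^ (n + 1)) := by nlinarith
      exact le_of_mul_le_mul_left this hN
    have hVp : (0:ℝ) < (V:ℝ) ^ (n + 1) := by linarith
    have hV : 0 < V := by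
      rcases Nat.eq_zero_or_pos V with h0 | h0
      · rw [h0] at hVp; simp at hVp
      · exact h0
    have hVr : (0:ℝ) < V := by exact_mod_cast hV
    have hε0 : 0 ≤ ε := by
      by_contra hneg
      push Not at hneg
      have := (abs_nonneg _).trans h
      nlinarith
    have h6 : ((n:ℝ) + 1) * (V:ℝ) ^ n ≤ ε * (U:ℝ) ^ (n + 1) := by
      have h7 : (U:ℝ) ^ (n + 1) - (V:ℝ) ^ (n + 1) ≤ ε * (U:ℝ) ^ (n + 1) := by
        have : N * ((U:ℝ) ^ (n + 1) - (V:ℝ) ^ (n + 1)) ≤ N * (ε * (U:ℝ) ^ (n + 1)) := by nlinarith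
        exact le_of_mul_le_mul_left this hN
      linarith
    have h8 : ((n:ℝ) + 1) * (V:ℝ) ^ n ≤ (5 * ε * V) * (V:ℝ) ^ n := by
      have : ε * (U:ℝ) ^ (n + 1) ≤ ε * (5 * (V:ℝ) ^ (n + 1)) := mul_le_mul_of_nonneg_left h5 hε0
      rw [pow_succ (V:ℝ)] at this
      nlinarith
    have h9 := le_of_mul_le_mul_right h8 (by positivity)
    push_cast
    nlinarith

/-- The closing lemma (signed version): two D-th powers cannot be too close. -/
theorem close_int (U V : ℤ) (D : ℕ) (N ε : ℝ) (hD : Odd D) (hN : 0 < N) (hU : U ≠ 0)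
    (hUV : U ≠ V) (hε : ε ≤ 4 / 5)
    (h : |N * (U:ℝ) ^ D - N * (V:ℝ) ^ D| ≤ ε * |N * (U:ℝ) ^ D|) :
    (D:ℝ) ≤ 5 * ε * |(U:ℝ)| := by
  have key : ∀ U V : ℤ, 0 < U → U ≠ V → 
      |N * (U:ℝ) ^ D - N * (V:ℝ) ^ D| ≤ ε * |N * (U:ℝ) ^ D| → (D:ℝ) ≤ 5 * ε * |(U:ℝ)| := by
    intro U V hU hUV h
    have hUr : (0:ℝ) < U := by exact_mod_cast hU
    have hNU : 0 < N * (U:ℝ) ^ D := by positivity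
    rw [abs_of_pos hNU] at h
    have hV : 0 < V := by
      by_contra hneg
      have hV' : (V:ℝ) ≤ 0 := by exact_mod_cast (not_lt.1 hneg)
      have : (V:ℝ) ^ D ≤ 0 := hD.pow_nonpos hV'
      have h2 := (abs_le.1 h).2
      nlinarith
    lift U to ℕ using hU.le
    lift V to ℕ using hV.le
    rw [abs_of_pos hUr]
    simp only [Int.cast_natCast] at h ⊢
    exact close_nat U V D N ε hD.pos hN (by exact_mod_cast hU) (by exact_mod_cast hUV) hε h
  rcases lt_or_gt_of_ne hU with h0 | h0
  · have := key (-U) (-V) (by omega) (by omega) (by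
      push_cast
      rw [hD.neg_pow, hD.neg_pow, mul_neg, mul_neg, abs_neg,
        show -(N * (U:ℝ) ^ D) - -(N * (V:ℝ) ^ D) = -(N * (U:ℝ) ^ D - N * (V:ℝ) ^ D) by ring, abs_neg]
      exact h)
    push_cast at this
    rwa [abs_neg] at this
  · exact key U V h0 hUV h

theorem gap_simple (U V n : ℕ) (h : U < V) : V ^ n + U ^ (n + 1) ≤ V ^ (n + 1) := by
  have h1 : U ^ n ≤ V ^ n := Nat.pow_le_pow_left h.le n
  have h2 : U ^ n * U ≤ V ^ n * U := Nat.mul_le_mul_right _ h1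
  have h3 : V ^ n * (U + 1) ≤ V ^ n * V := Nat.mul_le_mul_left _ h
  rw [pow_succ, pow_succ]; linarith

/-- the simple gap for odd powers of integers -/
theorem gap_int (U V : ℤ) (n : ℕ) (hn : Even n) (hn0 : n ≠ 0) (h : U ≠ V) :
    |U| ^ n ≤ |U ^ (n + 1) - V ^ (n + 1)| := by
  have hodd : Odd (n + 1) := hn.add_one
  have key : ∀ U V : ℤ, 0 < U → U ≠ V → |U| ^ n ≤ |U ^ (n + 1) - V ^ (n + 1)| := by
    intro U V hU h
    rw [abs_of_pos hU]
    rcases le_or_gt V 0 with hV | hV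
    · have : V ^ (n + 1) ≤ 0 := hodd.pow_nonpos hV
      have h2 : U ^ n ≤ U ^ (n + 1) := pow_le_pow_right₀ hU (by omega)
      exact le_trans (by linarith) (le_abs_self _)
    · lift U to ℕ using hU.le
      lift V to ℕ using hV.le
      have hne : U ≠ V := by exact_mod_cast h
      rcases lt_or_gt_of_ne hne with hl | hl
      · have g : (V:ℤ) ^ n + (U:ℤ) ^ (n + 1) ≤ (V:ℤ) ^ (n + 1) := by
          exact_mod_cast gap_simple U V n hl
        have g2 : (U:ℤ) ^ n ≤ (V:ℤ) ^ n := pow_le_pow_left₀ (by positivity) (by exact_mod_cast hl.le) n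
        rw [abs_sub_comm]
        exact le_trans (by linarith) (le_abs_self _)
      · have g : (U:ℤ) ^ n + (V:ℤ) ^ (n + 1) ≤ (U:ℤ) ^ (n + 1) := by
          exact_mod_cast gap_simple V U n hl
        exact le_trans (by linarith) (le_abs_self _)
  rcases lt_trichotomy U 0 with h0 | h0 | h0
  · have := key (-U) (-V) (by omega) (by omega)
    rw [hodd.neg_pow, hodd.neg_pow, abs_neg, show -U ^ (n+1) - -V ^ (n+1) = -(U ^ (n+1) - V ^ (n+1)) by ring,
      abs_neg] at this
    exact this
  · subst h0
    simp [hn0]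
  · exact key U V h0 h

theorem dth_of_pow (a w : ℤ) (i D : ℕ) (hD : Odd D) (hij : Nat.Coprime i D) (h : a ^ i = w ^ D) :
    ∃ v, a = v ^ D := by
  have h1 : a.natAbs ^ i = w.natAbs ^ D := by
    rw [← Int.natAbs_pow, ← Int.natAbs_pow, h]
  obtain ⟨v, hv, -⟩ := Nat.exists_eq_pow_of_exponent_coprime_of_pow_eq_pow hij h1
  rcases Int.natAbs_eq a with ha | ha
  · exact ⟨v, by rw [ha, hv]; push_cast; rfl⟩
  · exact ⟨-v, by rw [ha, hv, hD.neg_pow]; push_cast; rfl⟩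

theorem dth2 (a b c : ℤ) (i D : ℕ) (hD : Odd D) (hij : Nat.Coprime i D) (hab : IsCoprime a b)
    (h : a ^ i * b = c ^ D) : ∃ v, a = v ^ D := by
  obtain ⟨w, hw⟩ := Int.eq_pow_of_mul_eq_pow_odd_left (hab.pow_left (m := i)) hD h
  exact dth_of_pow a w i D hD hij hw

theorem odd_pow_inj (a b : ℤ) (D : ℕ) (hD : Odd D) (h : a ^ D = b ^ D) : a = b :=
  hD.strictMono_pow.injective h

/-- bounding a base from its D-th power -/
theorem root_bound (D : ℕ) (hD : 35 ≤ D) (W K C : ℝ) (hK : K ≤ 2 ^ 35) 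
    (hC : 0 ≤ C) (h : W ^ D ≤ K * C ^ D) : W ≤ 2 * C := by
  by_contra hlt
  push Not at hlt
  rcases hC.eq_or_lt with h0 | h0
  · subst h0
    have : (0:ℝ) < W ^ D := by apply pow_pos; linarith
    rw [zero_pow (by omega)] at h
    linarith
  have h1 : (2 * C) ^ D < W ^ D := pow_lt_pow_left₀ hlt (by positivity) (by omega)
  have h2 : (2:ℝ) ^ 35 ≤ 2 ^ D := pow_le_pow_right₀ (by norm_num) hD
  rw [mul_pow] at h1
  have h3 : 0 < C ^ D := by positivity
  nlinarith
end

section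
theorem arith2_odd (c R y : ℤ) (D : ℕ) (hD : Odd D) (hD5 : 5 ≤ D) (hc : 3 ≤ c) (hco : Odd c)
    (hR : R ≠ 0) (hcop : IsCoprime R c) (hb : R ^ 6 * c ^ 5 ≤ 2 * c ^ D)
    (h1 : y ^ 2 = R ^ 6 + c ^ D) : False := by
  have hfac : (y - R ^ 3) * (y + R ^ 3) = c ^ D := by linear_combination h1
  have hcD : 0 < c ^ D := by positivity
  have hcp : IsCoprime (y - R ^ 3) (y + R ^ 3) := by
    apply isCoprime_of_prime_dvd
    · rintro ⟨h, -⟩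
      rw [h, zero_mul] at hfac
      omega
    · intro p hp ha hb'
      have hpc : p ∣ c := by
        apply hp.dvd_of_dvd_pow (n := D)
        rw [← hfac]; exact ha.mul_right _
      have h2 : p ∣ 2 * R ^ 3 := by
        have := dvd_sub hb' ha
        rwa [show y + R ^ 3 - (y - R ^ 3) = 2 * R ^ 3 by ring] at this
      rcases hp.dvd_or_dvd h2 with h3 | h3
      · have h4 : IsCoprime (2:ℤ) c := by
          obtain ⟨k, hk⟩ := hco
          exact ⟨-k, 1, by rw [hk]; ring⟩
        exact hp.not_unit (h4.isUnit_of_dvd' h3 hpc)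
      · exact hp.not_unit (hcop.isUnit_of_dvd' (hp.dvd_of_dvd_pow h3) hpc)
  obtain ⟨u, hu⟩ := dth2 _ _ c 1 D hD (by simp) hcp (by rw [pow_one]; exact hfac)
  obtain ⟨v, hv⟩ := dth2 _ _ c 1 D hD (by simp) hcp.symm (by rw [pow_one, mul_comm]; exact hfac)
  have huv : u * v = c := by
    apply odd_pow_inj _ _ D hD
    rw [mul_pow, ← hu, ← hv, hfac]
  obtain ⟨n, rfl⟩ : ∃ n, D = n + 1 := ⟨D - 1, by omega⟩
  have hn : Even n := by
    rcases Nat.even_or_odd n with h | h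
    · exact h
    · exact absurd hD (by rw [Nat.not_odd_iff_even]; exact h.add_one)
  have hR3 : 2 * R ^ 3 ≠ 0 := by positivity
  have hne : u ≠ v := by
    rintro rfl
    apply hR3; rw [← hv] at hu; linarith
  have g1 := gap_int u v n hn (by omega) hne
  have g2 := gap_int v u n hn (by omega) hne.symm
  rw [← hu, ← hv] at g1 g2
  rw [show y - R ^ 3 - (y + R ^ 3) = -(2 * R ^ 3) by ring, abs_neg] at g1
  rw [show y + R ^ 3 - (y - R ^ 3) = 2 * R ^ 3 by ring] at g2
  have g3 : c ^ n ≤ (2 * R ^ 3) ^ 2 := by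
    calc c ^ n = |c| ^ n := by rw [abs_of_pos (by omega)]
      _ = |u| ^ n * |v| ^ n := by rw [← mul_pow, ← abs_mul, huv]
      _ ≤ |2 * R ^ 3| * |2 * R ^ 3| := mul_le_mul g1 g2 (by positivity) (by positivity)
      _ = _ := by rw [← sq, sq_abs]
  have hcn : 0 < c ^ n := by positivity
  have h5 : c ^ n * c ^ 5 ≤ 8 * (c ^ n * c) := by
    have : c ^ n * c ^ 5 ≤ (2 * R ^ 3) ^ 2 * c ^ 5 := mul_le_mul_of_nonneg_right g3 (by positivity)
    rw [pow_succ c n] at hb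
    nlinarith
  have h6 : c ^ 4 ≤ 8 := by
    have : (c ^ n * c) * c ^ 4 ≤ (c ^ n * c) * 8 := by nlinarith
    exact le_of_mul_le_mul_left this (by positivity)
  have : (3:ℤ) ^ 4 ≤ c ^ 4 := pow_le_pow_left₀ (by norm_num) hc 4
  omega
end

section
/-- closing lemma in normalised form -/
theorem close_norm (U V : ℤ) (D : ℕ) (N ε q a b : ℝ) (hD : Odd D) (hN : 0 < N) (hq : q ≠ 0)
    (hA : N * (U:ℝ) ^ D = q * a) (hB : N * (V:ℝ) ^ D = q * b)
    (hU : U ≠ 0) (hUV : U ≠ V) (hε : ε ≤ 4 / 5) (h : |a - b| ≤ ε * |a|) :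
    (D:ℝ) ≤ 5 * ε * |(U:ℝ)| := by
  apply close_int U V D N ε hD hN hU hUV hε
  rw [hA, hB, ← mul_sub, abs_mul, abs_mul]
  have : 0 < |q| := abs_pos.2 hq
  nlinarith

theorem abs_le_of_pow_le (x k : ℝ) (n : ℕ) (hk : 0 ≤ k) (hn : n ≠ 0) (h : |x| ^ n ≤ k ^ n) : |x| ≤ k :=
  (pow_le_pow_iff_left₀ (abs_nonneg x) hk hn).1 h

theorem a2_Pdom (P Q c h1 h4 : ℤ) (D : ℕ) (hD : Odd D) (hD35 : 35 ≤ D)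
    (hf1 : P - 3 * Q = 2 * h1 ^ D) (hf4 : P + Q = 2 * h4 ^ D) (hQ : Q ≠ 0) (hc : 6 ≤ c)
    (hdom : 32 * c ^ 5 * Q ^ 6 ≤ P ^ 6)
    (heq : (P ^ 2 - 9 * Q ^ 2) * (P ^ 2 - Q ^ 2) ^ 3 = 64 * c ^ D ∨
      (P ^ 2 - 9 * Q ^ 2) ^ 3 * (P ^ 2 - Q ^ 2) = 64 * c ^ D) : False := by
  have hcr : (6:ℝ) ≤ c := by exact_mod_cast hc
  have hc0 : (0:ℝ) < c := by linarith
  have hc5 : (6:ℝ) ^ 5 ≤ (c:ℝ) ^ 5 := pow_le_pow_left₀ (by norm_num) hcr 5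
  have hP : P ≠ 0 := by
    rintro rfl
    have : 0 < Q ^ 6 := by positivity
    have : 0 < 32 * c ^ 5 * Q ^ 6 := by positivity
    norm_num at hdom; omega
  have hPr : (P:ℝ) ≠ 0 := by exact_mod_cast hP
  set x : ℝ := Q / P with hx
  have hQx : (Q:ℝ) = P * x := by rw [hx]; field_simp
  have hP6 : (0:ℝ) < (P:ℝ) ^ 6 := by positivity
  have hd : 32 * (c:ℝ) ^ 5 * x ^ 6 ≤ 1 := by
    have h : 32 * (c:ℝ) ^ 5 * (Q:ℝ) ^ 6 ≤ (P:ℝ) ^ 6 := by exact_mod_cast hdom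
    rw [hQx, mul_pow] at h
    have : (P:ℝ) ^ 6 * (32 * (c:ℝ) ^ 5 * x ^ 6) ≤ (P:ℝ) ^ 6 * 1 := by linarith
    exact le_of_mul_le_mul_left this hP6
  have hx6 : 0 ≤ x ^ 6 := by positivity
  have hxs : |x| ≤ 1 / 7 := by
    apply abs_le_of_pow_le _ _ 6 (by norm_num) (by norm_num)
    rw [(by decide : Even 6).pow_abs]
    nlinarith
  have hx1 := abs_le.1 hxs
  have hxsq : x ^ 2 ≤ 1 / 49 := by nlinarith
  have hP8 : (P:ℝ) ^ 8 ≤ 128 * (c:ℝ) ^ D := by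
    have hP8' : (0:ℝ) < (P:ℝ) ^ 8 := by positivity
    have key : (1:ℝ) / 2 ≤ (1 - 9 * x ^ 2) * (1 - x ^ 2) ^ 3 ∧ (1:ℝ) / 2 ≤ (1 - 9 * x ^ 2) ^ 3 * (1 - x ^ 2) := by
      have a1 : (4:ℝ) / 5 ≤ 1 - 9 * x ^ 2 := by linarith
      have a2 : (48:ℝ) / 49 ≤ 1 - x ^ 2 := by linarith
      constructor
      · calc (1:ℝ) / 2 ≤ 4 / 5 * (48 / 49) ^ 3 := by norm_num
          _ ≤ _ := by gcongr
      · calc (1:ℝ) / 2 ≤ (4 / 5) ^ 3 * (48 / 49) := by norm_num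
          _ ≤ _ := by gcongr
    rcases heq with h | h
    · have h' : ((P:ℝ) ^ 2 - 9 * (Q:ℝ) ^ 2) * ((P:ℝ) ^ 2 - (Q:ℝ) ^ 2) ^ 3 = 64 * (c:ℝ) ^ D := by exact_mod_cast h
      rw [hQx] at h'
      have : (P:ℝ) ^ 8 * ((1 - 9 * x ^ 2) * (1 - x ^ 2) ^ 3) = 64 * (c:ℝ) ^ D := by rw [← h']; ring
      nlinarith [key.1]
    · have h' : ((P:ℝ) ^ 2 - 9 * (Q:ℝ) ^ 2) ^ 3 * ((P:ℝ) ^ 2 - (Q:ℝ) ^ 2) = 64 * (c:ℝ) ^ D := by exact_mod_cast h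
      rw [hQx] at h'
      have : (P:ℝ) ^ 8 * ((1 - 9 * x ^ 2) ^ 3 * (1 - x ^ 2)) = 64 * (c:ℝ) ^ D := by rw [← h']; ring
      nlinarith [key.2]
  have hf1' : (2:ℝ) * (h1:ℝ) ^ D = P * (1 - 3 * x) := by
    have : (P:ℝ) - 3 * Q = 2 * (h1:ℝ) ^ D := by exact_mod_cast hf1
    rw [← this, hQx]; ring
  have hf4' : (2:ℝ) * (h4:ℝ) ^ D = P * (1 + x) := by
    have : (P:ℝ) + Q = 2 * (h4:ℝ) ^ D := by exact_mod_cast hf4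
    rw [← this, hQx]; ring
  have hne : h4 ≠ h1 := by
    rintro rfl; apply hQ; linarith
  have hh4 : h4 ≠ 0 := by
    rintro rfl
    rw [Int.cast_zero, zero_pow (by omega), mul_zero] at hf4'
    rcases mul_eq_zero.1 hf4'.symm with h | h
    · exact hPr h
    · linarith
  have g := close_norm h4 h1 D 2 (5 * |x|) P (1 + x) (1 - 3 * x) hD (by norm_num) hPr hf4' hf1' hh4 hne
    (by linarith) (by
      rw [show 1 + x - (1 - 3 * x) = 4 * x by ring, abs_mul, abs_of_pos (by linarith : 0 < 1 + x)]
      norm_num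
      nlinarith [abs_nonneg x])
  have hDr : (35:ℝ) ≤ D := by exact_mod_cast hD35
  have g1 : 1 ≤ |x| * |(h4:ℝ)| := by nlinarith
  have hW : (h4:ℝ) ^ 8 ≤ 2 * c := by
    apply root_bound D hD35 _ 128 _ (by norm_num) hc0.le
    have e : ((h4:ℝ) ^ 8) ^ D = ((h4:ℝ) ^ D) ^ 8 := by rw [← pow_mul, ← pow_mul, mul_comm]
    have e2 : (h4:ℝ) ^ D = P * ((1 + x) / 2) := by linarith
    rw [e, e2, mul_pow]
    have : ((1 + x) / 2) ^ 8 ≤ 1 := pow_le_one₀ (by linarith) (by linarith)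
    have : (0:ℝ) < (P:ℝ) ^ 8 := by positivity
    nlinarith
  have g2 : 1 ≤ (|x| * |(h4:ℝ)|) ^ 24 := one_le_pow₀ g1
  have g3 : (|x| * |(h4:ℝ)|) ^ 24 = (x ^ 6) ^ 4 * ((h4:ℝ) ^ 8) ^ 3 := by
    rw [mul_pow, (by decide : Even 24).pow_abs, (by decide : Even 24).pow_abs]; ring
  have g4 : (32 * (c:ℝ) ^ 5 * x ^ 6) ^ 4 ≤ 1 := pow_le_one₀ (by positivity) hd
  have g5 : ((h4:ℝ) ^ 8) ^ 3 ≤ (2 * c) ^ 3 := pow_le_pow_left₀ (by positivity) hW 3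
  have g6 : (32 * (c:ℝ) ^ 5) ^ 4 ≤ (2 * c) ^ 3 := by
    calc (32 * (c:ℝ) ^ 5) ^ 4 ≤ (32 * (c:ℝ) ^ 5) ^ 4 * ((x ^ 6) ^ 4 * ((h4:ℝ) ^ 8) ^ 3) := by
          rw [← g3]; exact le_mul_of_one_le_right (by positivity) g2
      _ = (32 * (c:ℝ) ^ 5 * x ^ 6) ^ 4 * ((h4:ℝ) ^ 8) ^ 3 := by ring
      _ ≤ 1 * (2 * c) ^ 3 := by gcongr
      _ = _ := one_mul _
  have g7 : (c:ℝ) ^ 3 * (32 ^ 4 * c ^ 17) ≤ c ^ 3 * 8 := by linarith [g6, show (32 * (c:ℝ) ^ 5) ^ 4 = (c:ℝ) ^ 3 * (32 ^ 4 * c ^ 17) by ring, show (2 * (c:ℝ)) ^ 3 = c ^ 3 * 8 by ring]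
  have g8 := le_of_mul_le_mul_left g7 (by positivity)
  have g9 : (1:ℝ) ≤ (c:ℝ) ^ 17 := one_le_pow₀ (by linarith)
  linarith
end

section
theorem a2_Q11 (P Q c U V : ℤ) (D : ℕ) (hD : Odd D) (hD35 : 35 ≤ D)
    (hfU : (P - 3 * Q) * (P + Q) = 4 * U ^ D) (hfV : (P + 3 * Q) * (P - Q) = 4 * V ^ D)
    (hUV : U ≠ V) (hQ : Q ≠ 0) (hc : 6 ≤ c)
    (hdom : 32 * c ^ 5 * P ^ 6 ≤ 729 * Q ^ 6)
    (heq : (P ^ 2 - 9 * Q ^ 2) * (P ^ 2 - Q ^ 2) ^ 3 = 64 * c ^ D ∨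
      (P ^ 2 - 9 * Q ^ 2) ^ 3 * (P ^ 2 - Q ^ 2) = 64 * c ^ D) : False := by
  have hcr : (6:ℝ) ≤ c := by exact_mod_cast hc
  have hc0 : (0:ℝ) < c := by linarith
  have hc5 : (6:ℝ) ^ 5 ≤ (c:ℝ) ^ 5 := pow_le_pow_left₀ (by norm_num) hcr 5
  have hPr : (Q:ℝ) ≠ 0 := by exact_mod_cast hQ
  set x : ℝ := P / Q with hx
  have hQx : (P:ℝ) = Q * x := by rw [hx]; field_simp
  have hP6 : (0:ℝ) < (Q:ℝ) ^ 6 := by positivity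
  have hd : 32 * (c:ℝ) ^ 5 * x ^ 6 ≤ 729 := by
    have h : 32 * (c:ℝ) ^ 5 * (P:ℝ) ^ 6 ≤ 729 * (Q:ℝ) ^ 6 := by exact_mod_cast hdom
    rw [hQx, mul_pow] at h
    have : (Q:ℝ) ^ 6 * (32 * (c:ℝ) ^ 5 * x ^ 6) ≤ (Q:ℝ) ^ 6 * 729 := by linarith
    exact le_of_mul_le_mul_left this hP6
  have hx6 : 0 ≤ x ^ 6 := by positivity
  have hxs : |x| ≤ 2 / 5 := by
    apply abs_le_of_pow_le _ _ 6 (by norm_num) (by norm_num)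
    rw [(by decide : Even 6).pow_abs]
    nlinarith
  have hx1 := abs_le.1 hxs
  have hxsq : x ^ 2 ≤ 4 / 25 := by nlinarith
  have hP8 : (Q:ℝ) ^ 8 ≤ 64 * (c:ℝ) ^ D := by
    have hP8' : (0:ℝ) < (Q:ℝ) ^ 8 := by positivity
    have key : (1:ℝ) ≤ (9 - x ^ 2) * (1 - x ^ 2) ^ 3 ∧ (1:ℝ) ≤ (9 - x ^ 2) ^ 3 * (1 - x ^ 2) := by
      have a1 : (8:ℝ) ≤ 9 - x ^ 2 := by linarith
      have a2 : (4:ℝ) / 5 ≤ 1 - x ^ 2 := by linarith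
      constructor
      · calc (1:ℝ) ≤ 8 * (4 / 5) ^ 3 := by norm_num
          _ ≤ _ := by gcongr
      · calc (1:ℝ) ≤ 8 ^ 3 * (4 / 5) := by norm_num
          _ ≤ _ := by gcongr
    rcases heq with h | h
    · have h' : ((P:ℝ) ^ 2 - 9 * (Q:ℝ) ^ 2) * ((P:ℝ) ^ 2 - (Q:ℝ) ^ 2) ^ 3 = 64 * (c:ℝ) ^ D := by exact_mod_cast h
      rw [hQx] at h'
      have : (Q:ℝ) ^ 8 * ((9 - x ^ 2) * (1 - x ^ 2) ^ 3) = 64 * (c:ℝ) ^ D := by rw [← h']; ring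
      nlinarith [key.1]
    · have h' : ((P:ℝ) ^ 2 - 9 * (Q:ℝ) ^ 2) ^ 3 * ((P:ℝ) ^ 2 - (Q:ℝ) ^ 2) = 64 * (c:ℝ) ^ D := by exact_mod_cast h
      rw [hQx] at h'
      have : (Q:ℝ) ^ 8 * ((9 - x ^ 2) ^ 3 * (1 - x ^ 2)) = 64 * (c:ℝ) ^ D := by rw [← h']; ring
      nlinarith [key.2]
  have hf1' : (4:ℝ) * (U:ℝ) ^ D = (Q:ℝ) ^ 2 * ((x - 3) * (x + 1)) := by
    have : ((P:ℝ) - 3 * Q) * (P + Q) = 4 * (U:ℝ) ^ D := by exact_mod_cast hfU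
    rw [← this, hQx]; ring
  have hf4' : (4:ℝ) * (V:ℝ) ^ D = (Q:ℝ) ^ 2 * ((x + 3) * (x - 1)) := by
    have : ((P:ℝ) + 3 * Q) * (P - Q) = 4 * (V:ℝ) ^ D := by exact_mod_cast hfV
    rw [← this, hQx]; ring
  have hax : (x - 3) * (x + 1) ≤ -2 := by nlinarith
  have hax' : -4 ≤ (x - 3) * (x + 1) := by nlinarith [sq_nonneg (x - 1)]
  have hQ2 : 0 < (Q:ℝ) ^ 2 := by positivity
  have hU : U ≠ 0 := by
    rintro rfl
    rw [Int.cast_zero, zero_pow (by omega), mul_zero] at hf1'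
    nlinarith
  have g := close_norm U V D 4 (2 * |x|) _ _ _ hD (by norm_num) hQ2.ne' hf1' hf4' hU hUV
    (by linarith) (by
      rw [show (x - 3) * (x + 1) - (x + 3) * (x - 1) = -(4 * x) by ring, abs_neg, abs_mul, abs_of_neg (by linarith : (x - 3) * (x + 1) < 0)]
      norm_num
      nlinarith [abs_nonneg x])
  have hDr : (35:ℝ) ≤ D := by exact_mod_cast hD35
  have g1 : 2 ≤ |x| * |(U:ℝ)| := by nlinarith
  have hW : (U:ℝ) ^ 4 ≤ 2 * c := by
    apply root_bound D hD35 _ 64 _ (by norm_num) hc0.le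
    have e : ((U:ℝ) ^ 4) ^ D = ((U:ℝ) ^ D) ^ 4 := by rw [← pow_mul, ← pow_mul, mul_comm]
    have e2 : (U:ℝ) ^ D = Q ^ 2 * ((x - 3) * (x + 1) / 4) := by linarith
    rw [e, e2, mul_pow]
    have : ((x - 3) * (x + 1) / 4) ^ 4 ≤ 1 := by
      rw [← (by decide : Even 4).pow_abs]
      apply pow_le_one₀ (abs_nonneg _)
      rw [abs_le]; constructor <;> linarith
    have : (0:ℝ) < (Q:ℝ) ^ 8 := by positivity
    rw [← pow_mul]; norm_num
    nlinarith
  have g2 : 2 ^ 12 ≤ (|x| * |(U:ℝ)|) ^ 12 := pow_le_pow_left₀ (by norm_num) g1 12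
  have g3 : (|x| * |(U:ℝ)|) ^ 12 = (x ^ 6) ^ 2 * ((U:ℝ) ^ 4) ^ 3 := by
    rw [mul_pow, (by decide : Even 12).pow_abs, (by decide : Even 12).pow_abs]; ring
  have g4 : (32 * (c:ℝ) ^ 5 * x ^ 6) ^ 2 ≤ 729 ^ 2 := pow_le_pow_left₀ (by positivity) hd 2
  have g5 : ((U:ℝ) ^ 4) ^ 3 ≤ (2 * c) ^ 3 := pow_le_pow_left₀ (by positivity) hW 3
  have g6 : (32 * (c:ℝ) ^ 5) ^ 2 * 2 ^ 12 ≤ 729 ^ 2 * (2 * c) ^ 3 := by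
    calc (32 * (c:ℝ) ^ 5) ^ 2 * 2 ^ 12 ≤ (32 * (c:ℝ) ^ 5) ^ 2 * ((x ^ 6) ^ 2 * ((U:ℝ) ^ 4) ^ 3) := by
          rw [← g3]; gcongr
      _ = (32 * (c:ℝ) ^ 5 * x ^ 6) ^ 2 * ((U:ℝ) ^ 4) ^ 3 := by ring
      _ ≤ _ := by gcongr
  have g7 : (c:ℝ) ^ 3 * (32 ^ 2 * 2 ^ 12 * c ^ 7) ≤ c ^ 3 * (729 ^ 2 * 8) := by linarith [g6, show (32 * (c:ℝ) ^ 5) ^ 2 * 2 ^ 12 = (c:ℝ) ^ 3 * (32 ^ 2 * 2 ^ 12 * c ^ 7) by ring, show 729 ^ 2 * (2 * (c:ℝ)) ^ 3 = c ^ 3 * (729 ^ 2 * 8) by ring]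
  have g8 := le_of_mul_le_mul_left g7 (by positivity)
  have g9 : (6:ℝ) ^ 7 ≤ (c:ℝ) ^ 7 := pow_le_pow_left₀ (by norm_num) hcr 7
  linarith

theorem a2_Q15 (P Q c U V : ℤ) (D : ℕ) (hD : Odd D) (hD35 : 35 ≤ D)
    (hfU : (P - 3 * Q) * (P + Q) ^ 5 = 64 * U ^ D) (hfV : (P + 3 * Q) * (P - Q) ^ 5 = 64 * V ^ D)
    (hUV : U ≠ V) (hQ : Q ≠ 0) (hc : 6 ≤ c)
    (hdom : 32 * c ^ 5 * P ^ 2 ≤ 9 * Q ^ 2)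
    (heq : (P ^ 2 - 9 * Q ^ 2) * (P ^ 2 - Q ^ 2) ^ 3 = 64 * c ^ D) : False := by
  have hcr : (6:ℝ) ≤ c := by exact_mod_cast hc
  have hc0 : (0:ℝ) < c := by linarith
  have hc5 : (6:ℝ) ^ 5 ≤ (c:ℝ) ^ 5 := pow_le_pow_left₀ (by norm_num) hcr 5
  have hPr : (Q:ℝ) ≠ 0 := by exact_mod_cast hQ
  set x : ℝ := P / Q with hx
  have hQx : (P:ℝ) = Q * x := by rw [hx]; field_simp
  have hQ2 : 0 < (Q:ℝ) ^ 2 := by positivity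
  have hd : 32 * (c:ℝ) ^ 5 * x ^ 2 ≤ 9 := by
    have h : 32 * (c:ℝ) ^ 5 * (P:ℝ) ^ 2 ≤ 9 * (Q:ℝ) ^ 2 := by exact_mod_cast hdom
    rw [hQx, mul_pow] at h
    have : (Q:ℝ) ^ 2 * (32 * (c:ℝ) ^ 5 * x ^ 2) ≤ (Q:ℝ) ^ 2 * 9 := by linarith
    exact le_of_mul_le_mul_left this hQ2
  have hx6 : 0 ≤ x ^ 2 := by positivity
  have hxs : |x| ≤ 1 / 100 := by
    apply abs_le_of_pow_le _ _ 2 (by norm_num) (by norm_num)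
    rw [(by decide : Even 2).pow_abs]
    nlinarith
  have hx1 := abs_le.1 hxs
  have hxsq : x ^ 2 ≤ 1 / 10000 := by nlinarith
  have hP8 : (Q:ℝ) ^ 8 ≤ 64 * (c:ℝ) ^ D := by
    have hP8' : (0:ℝ) < (Q:ℝ) ^ 8 := by positivity
    have key : (1:ℝ) ≤ (9 - x ^ 2) * (1 - x ^ 2) ^ 3 := by
      have a1 : (8:ℝ) ≤ 9 - x ^ 2 := by linarith
      have a2 : (4:ℝ) / 5 ≤ 1 - x ^ 2 := by linarith
      calc (1:ℝ) ≤ 8 * (4 / 5) ^ 3 := by norm_num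
          _ ≤ _ := by gcongr
    have h' : ((P:ℝ) ^ 2 - 9 * (Q:ℝ) ^ 2) * ((P:ℝ) ^ 2 - (Q:ℝ) ^ 2) ^ 3 = 64 * (c:ℝ) ^ D := by exact_mod_cast heq
    rw [hQx] at h'
    have : (Q:ℝ) ^ 8 * ((9 - x ^ 2) * (1 - x ^ 2) ^ 3) = 64 * (c:ℝ) ^ D := by rw [← h']; ring
    nlinarith [key]
  have hf1' : (64:ℝ) * (U:ℝ) ^ D = (Q:ℝ) ^ 6 * ((x - 3) * (x + 1) ^ 5) := by
    have : ((P:ℝ) - 3 * Q) * (P + Q) ^ 5 = 64 * (U:ℝ) ^ D := by exact_mod_cast hfU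
    rw [← this, hQx]; ring
  have hf4' : (64:ℝ) * (V:ℝ) ^ D = (Q:ℝ) ^ 6 * ((x + 3) * (x - 1) ^ 5) := by
    have : ((P:ℝ) + 3 * Q) * (P - Q) ^ 5 = 64 * (V:ℝ) ^ D := by exact_mod_cast hfV
    rw [← this, hQx]; ring
  have hb1 : (9:ℝ) / 10 ≤ (x + 1) ^ 5 := by
    calc (9:ℝ) / 10 ≤ (99 / 100) ^ 5 := by norm_num
      _ ≤ _ := by gcongr; linarith
  have hb2 : (x + 1) ^ 5 ≤ 11 / 10 := by
    calc (x + 1) ^ 5 ≤ (101 / 100) ^ 5 := by gcongr <;> linarith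
      _ ≤ _ := by norm_num
  have hax : (x - 3) * (x + 1) ^ 5 ≤ -2 := by nlinarith
  have hax' : -4 ≤ (x - 3) * (x + 1) ^ 5 := by nlinarith
  have hQ6 : 0 < (Q:ℝ) ^ 6 := by positivity
  have hU : U ≠ 0 := by
    rintro rfl
    rw [Int.cast_zero, zero_pow (by omega), mul_zero] at hf1'
    nlinarith
  have g := close_norm U V D 64 (20 * |x|) _ _ _ hD (by norm_num) hQ6.ne' hf1' hf4' hU hUV
    (by linarith) (by
      rw [show (x - 3) * (x + 1) ^ 5 - (x + 3) * (x - 1) ^ 5 = x * (-28 - 40 * x ^ 2 + 4 * (x ^ 2) ^ 2) by ring, abs_mul, abs_of_neg (by linarith : (x - 3) * (x + 1) ^ 5 < 0)]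
      have : |(-28 - 40 * x ^ 2 + 4 * (x ^ 2) ^ 2)| ≤ 40 := by
        rw [abs_le]; constructor <;> nlinarith
      nlinarith [abs_nonneg x])
  have hDr : (35:ℝ) ≤ D := by exact_mod_cast hD35
  have g1 : 1 ≤ (4 * |x|) * |(U:ℝ)| := by nlinarith
  have hW : (U:ℝ) ^ 4 ≤ 2 * c ^ 3 := by
    apply root_bound D hD35 _ (64 ^ 3) _ (by norm_num) (by positivity)
    have e : ((U:ℝ) ^ 4) ^ D = ((U:ℝ) ^ D) ^ 4 := by rw [← pow_mul, ← pow_mul, mul_comm]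
    have e2 : (U:ℝ) ^ D = Q ^ 6 * ((x - 3) * (x + 1) ^ 5 / 64) := by linarith
    have e3 : ((c:ℝ) ^ 3) ^ D = ((c:ℝ) ^ D) ^ 3 := by rw [← pow_mul, ← pow_mul, mul_comm]
    rw [e, e2, mul_pow, e3, ← mul_pow (64:ℝ)]
    have h1 : ((x - 3) * (x + 1) ^ 5 / 64) ^ 4 ≤ 1 := by
      rw [← (by decide : Even 4).pow_abs]
      apply pow_le_one₀ (abs_nonneg _)
      rw [abs_le]; constructor <;> linarith
    have h2 : ((Q:ℝ) ^ 8) ^ 3 ≤ (64 * (c:ℝ) ^ D) ^ 3 := pow_le_pow_left₀ (by positivity) hP8 3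
    have h3 : (0:ℝ) < ((Q:ℝ) ^ 8) ^ 3 := by positivity
    rw [show ((Q:ℝ) ^ 6) ^ 4 = ((Q:ℝ) ^ 8) ^ 3 by ring, ← mul_one ((64 * (c:ℝ) ^ D) ^ 3)]
    exact mul_le_mul h2 h1 (by positivity) (by positivity)
  have g2 : 1 ≤ (4 * |x| * |(U:ℝ)|) ^ 4 := one_le_pow₀ g1
  have g3 : (4 * |x| * |(U:ℝ)|) ^ 4 = 256 * (x ^ 2) ^ 2 * ((U:ℝ) ^ 4) := by
    rw [mul_pow, mul_pow, (by decide : Even 4).pow_abs, (by decide : Even 4).pow_abs]; ring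
  have g4 : (32 * (c:ℝ) ^ 5 * x ^ 2) ^ 2 ≤ 9 ^ 2 := pow_le_pow_left₀ (by positivity) hd 2
  have g6 : (32 * (c:ℝ) ^ 5) ^ 2 ≤ 9 ^ 2 * (256 * (2 * c ^ 3)) := by
    calc (32 * (c:ℝ) ^ 5) ^ 2 ≤ (32 * (c:ℝ) ^ 5) ^ 2 * (256 * (x ^ 2) ^ 2 * ((U:ℝ) ^ 4)) := by
          rw [← g3]; exact le_mul_of_one_le_right (by positivity) g2
      _ = (32 * (c:ℝ) ^ 5 * x ^ 2) ^ 2 * (256 * ((U:ℝ) ^ 4)) := by ring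
      _ ≤ _ := by gcongr
  have g7 : (c:ℝ) ^ 3 * (32 ^ 2 * c ^ 7) ≤ c ^ 3 * (9 ^ 2 * 512) := by linarith [g6, show (32 * (c:ℝ) ^ 5) ^ 2 = (c:ℝ) ^ 3 * (32 ^ 2 * c ^ 7) by ring, show 9 ^ 2 * (256 * (2 * (c:ℝ) ^ 3)) = c ^ 3 * (9 ^ 2 * 512) by ring]
  have g8 := le_of_mul_le_mul_left g7 (by positivity)
  have g9 : (6:ℝ) ^ 7 ≤ (c:ℝ) ^ 7 := pow_le_pow_left₀ (by norm_num) hcr 7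
  linarith

set_option maxHeartbeats 800000 in
theorem a2_Q51 (P Q c U V : ℤ) (D : ℕ) (hD : Odd D) (hD35 : 35 ≤ D)
    (hfU : (P - 3 * Q) ^ 5 * (P + Q) = 64 * U ^ D) (hfV : (P + 3 * Q) ^ 5 * (P - Q) = 64 * V ^ D)
    (hUV : U ≠ V) (hQ : Q ≠ 0) (hc : 54 ≤ c)
    (hdom : 32 * c ^ 5 * P ^ 6 ≤ 729 * Q ^ 6)
    (heq : (P ^ 2 - 9 * Q ^ 2) ^ 3 * (P ^ 2 - Q ^ 2) = 64 * c ^ D) : False := by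
  have hcr : (54:ℝ) ≤ c := by exact_mod_cast hc
  have hc0 : (0:ℝ) < c := by linarith
  have hc5 : (54:ℝ) ^ 5 ≤ (c:ℝ) ^ 5 := pow_le_pow_left₀ (by norm_num) hcr 5
  have hPr : (Q:ℝ) ≠ 0 := by exact_mod_cast hQ
  set x : ℝ := P / Q with hx
  have hQx : (P:ℝ) = Q * x := by rw [hx]; field_simp
  have hP6 : (0:ℝ) < (Q:ℝ) ^ 6 := by positivity
  have hd : 32 * (c:ℝ) ^ 5 * x ^ 6 ≤ 729 := by
    have h : 32 * (c:ℝ) ^ 5 * (P:ℝ) ^ 6 ≤ 729 * (Q:ℝ) ^ 6 := by exact_mod_cast hdom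
    rw [hQx, mul_pow] at h
    have : (Q:ℝ) ^ 6 * (32 * (c:ℝ) ^ 5 * x ^ 6) ≤ (Q:ℝ) ^ 6 * 729 := by linarith
    exact le_of_mul_le_mul_left this hP6
  have hx6 : 0 ≤ x ^ 6 := by positivity
  have hxs : |x| ≤ 1 / 16 := by
    apply abs_le_of_pow_le _ _ 6 (by norm_num) (by norm_num)
    rw [(by decide : Even 6).pow_abs]
    nlinarith
  have hx1 := abs_le.1 hxs
  have hxsq : x ^ 2 ≤ 1 / 256 := by nlinarith
  have hP8 : (Q:ℝ) ^ 8 ≤ 1 * (c:ℝ) ^ D := by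
    have hP8' : (0:ℝ) < (Q:ℝ) ^ 8 := by positivity
    have key : (64:ℝ) ≤ (9 - x ^ 2) ^ 3 * (1 - x ^ 2) := by
      have a1 : (8:ℝ) ≤ 9 - x ^ 2 := by linarith
      have a2 : (4:ℝ) / 5 ≤ 1 - x ^ 2 := by linarith
      calc (64:ℝ) ≤ 8 ^ 3 * (4 / 5) := by norm_num
          _ ≤ _ := by gcongr
    have h' : ((P:ℝ) ^ 2 - 9 * (Q:ℝ) ^ 2) ^ 3 * ((P:ℝ) ^ 2 - (Q:ℝ) ^ 2) = 64 * (c:ℝ) ^ D := by exact_mod_cast heq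
    rw [hQx] at h'
    have : (Q:ℝ) ^ 8 * ((9 - x ^ 2) ^ 3 * (1 - x ^ 2)) = 64 * (c:ℝ) ^ D := by rw [← h']; ring
    nlinarith [key]
  have hf1' : (64:ℝ) * (U:ℝ) ^ D = (Q:ℝ) ^ 6 * ((x - 3) ^ 5 * (x + 1)) := by
    have : ((P:ℝ) - 3 * Q) ^ 5 * (P + Q) = 64 * (U:ℝ) ^ D := by exact_mod_cast hfU
    rw [← this, hQx]; ring
  have hf4' : (64:ℝ) * (V:ℝ) ^ D = (Q:ℝ) ^ 6 * ((x + 3) ^ 5 * (x - 1)) := by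
    have : ((P:ℝ) + 3 * Q) ^ 5 * (P - Q) = 64 * (V:ℝ) ^ D := by exact_mod_cast hfV
    rw [← this, hQx]; ring
  have hb1 : (215:ℝ) ≤ (3 - x) ^ 5 := by
    calc (215:ℝ) ≤ (47 / 16) ^ 5 := by norm_num
      _ ≤ _ := by gcongr; linarith
  have hb2 : (3 - x) ^ 5 ≤ 270 := by
    calc (3 - x) ^ 5 ≤ (49 / 16) ^ 5 := by gcongr <;> linarith
      _ ≤ _ := by norm_num
  have hneg : (x - 3) ^ 5 * (x + 1) = - ((3 - x) ^ 5 * (x + 1)) := by ring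
  have hax : (x - 3) ^ 5 * (x + 1) ≤ -200 := by rw [hneg]; nlinarith
  have hax' : -320 ≤ (x - 3) ^ 5 * (x + 1) := by rw [hneg]; nlinarith
  have hU : U ≠ 0 := by
    rintro rfl
    rw [Int.cast_zero, zero_pow (by omega), mul_zero] at hf1'
    nlinarith
  have g := close_norm U V D 64 (2 * |x|) _ _ _ hD (by norm_num) hP6.ne' hf1' hf4' hU hUV
    (by linarith) (by
      rw [show (x - 3) ^ 5 * (x + 1) - (x + 3) ^ 5 * (x - 1) = x * (324 - 360 * x ^ 2 - 28 * (x ^ 2) ^ 2) by ring, abs_mul, abs_of_neg (by linarith : (x - 3) ^ 5 * (x + 1) < 0)]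
      have : |(324 - 360 * x ^ 2 - 28 * (x ^ 2) ^ 2)| ≤ 400 := by
        rw [abs_le]; constructor <;> nlinarith
      nlinarith [abs_nonneg x])
  have hDr : (35:ℝ) ≤ D := by exact_mod_cast hD35
  have g1 : 7 / 2 ≤ |x| * |(U:ℝ)| := by nlinarith
  have hW : (U:ℝ) ^ 4 ≤ 2 * c ^ 3 := by
    apply root_bound D hD35 _ (5 ^ 4) _ (by norm_num) (by positivity)
    have e : ((U:ℝ) ^ 4) ^ D = ((U:ℝ) ^ D) ^ 4 := by rw [← pow_mul, ← pow_mul, mul_comm]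
    have e2 : (U:ℝ) ^ D = Q ^ 6 * ((x - 3) ^ 5 * (x + 1) / 64) := by linarith
    have e3 : ((c:ℝ) ^ 3) ^ D = ((c:ℝ) ^ D) ^ 3 := by rw [← pow_mul, ← pow_mul, mul_comm]
    rw [e, e2, mul_pow, e3]
    have h1 : ((x - 3) ^ 5 * (x + 1) / 64) ^ 4 ≤ 5 ^ 4 := by
      rw [← (by decide : Even 4).pow_abs]
      apply pow_le_pow_left₀ (abs_nonneg _)
      rw [abs_le]; constructor <;> linarith
    have h2 : ((Q:ℝ) ^ 8) ^ 3 ≤ (1 * (c:ℝ) ^ D) ^ 3 := pow_le_pow_left₀ (by positivity) hP8 3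
    have h3 : (0:ℝ) < ((Q:ℝ) ^ 8) ^ 3 := by positivity
    rw [show ((Q:ℝ) ^ 6) ^ 4 = ((Q:ℝ) ^ 8) ^ 3 by ring]
    rw [one_mul] at h2
    rw [mul_comm (5 ^ 4 : ℝ)]
    exact mul_le_mul h2 h1 (by positivity) (by positivity)
  have g2 : (7 / 2) ^ 12 ≤ (|x| * |(U:ℝ)|) ^ 12 := pow_le_pow_left₀ (by norm_num) g1 12
  have g3 : (|x| * |(U:ℝ)|) ^ 12 = (x ^ 6) ^ 2 * ((U:ℝ) ^ 4) ^ 3 := by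
    rw [mul_pow, (by decide : Even 12).pow_abs, (by decide : Even 12).pow_abs]; ring
  have g4 : (32 * (c:ℝ) ^ 5 * x ^ 6) ^ 2 ≤ 729 ^ 2 := pow_le_pow_left₀ (by positivity) hd 2
  have g5 : ((U:ℝ) ^ 4) ^ 3 ≤ (2 * c ^ 3) ^ 3 := pow_le_pow_left₀ (by positivity) hW 3
  have g6 : (32 * (c:ℝ) ^ 5) ^ 2 * (7 / 2) ^ 12 ≤ 729 ^ 2 * (2 * c ^ 3) ^ 3 := by
    calc (32 * (c:ℝ) ^ 5) ^ 2 * (7 / 2) ^ 12 ≤ (32 * (c:ℝ) ^ 5) ^ 2 * ((x ^ 6) ^ 2 * ((U:ℝ) ^ 4) ^ 3) := by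
          rw [← g3]; gcongr
      _ = (32 * (c:ℝ) ^ 5 * x ^ 6) ^ 2 * ((U:ℝ) ^ 4) ^ 3 := by ring
      _ ≤ _ := by gcongr
  have g7 : (c:ℝ) ^ 9 * (32 ^ 2 * (7 / 2) ^ 12 * c) ≤ c ^ 9 * (729 ^ 2 * 8) := by linarith [g6, show (32 * (c:ℝ) ^ 5) ^ 2 * (7 / 2) ^ 12 = (c:ℝ) ^ 9 * (32 ^ 2 * (7 / 2) ^ 12 * c) by ring, show 729 ^ 2 * (2 * (c:ℝ) ^ 3) ^ 3 = c ^ 9 * (729 ^ 2 * 8) by ring]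
  have g8 := le_of_mul_le_mul_left g7 (by positivity)
  nlinarith
end

section
theorem dth4 (a b e g c : ℤ) (i j k l D : ℕ) (hD : Odd D)
    (hi : Nat.Coprime i D) (hj : Nat.Coprime j D) (hk : Nat.Coprime k D) (hl : Nat.Coprime l D)
    (hab : IsCoprime a b) (hae : IsCoprime a e) (hag : IsCoprime a g) (hbe : IsCoprime b e)
    (hbg : IsCoprime b g) (heg : IsCoprime e g) (h : a ^ i * b ^ j * e ^ k * g ^ l = c ^ D) :
    ∃ h1 h2 h3 h4 : ℤ, a = h1 ^ D ∧ b = h2 ^ D ∧ e = h3 ^ D ∧ g = h4 ^ D ∧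
      c = h1 ^ i * h2 ^ j * h3 ^ k * h4 ^ l := by
  obtain ⟨h1, e1⟩ := dth2 a (b ^ j * e ^ k * g ^ l) c i D hD hi
    ((hab.pow_right.mul_right hae.pow_right).mul_right hag.pow_right) (by rw [← h]; ring)
  obtain ⟨h2, e2⟩ := dth2 b (a ^ i * e ^ k * g ^ l) c j D hD hj
    ((hab.symm.pow_right.mul_right hbe.pow_right).mul_right hbg.pow_right) (by rw [← h]; ring)
  obtain ⟨h3, e3⟩ := dth2 e (a ^ i * b ^ j * g ^ l) c k D hD hk
    ((hae.symm.pow_right.mul_right hbe.symm.pow_right).mul_right heg.pow_right) (by rw [← h]; ring)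
  obtain ⟨h4, e4⟩ := dth2 g (a ^ i * b ^ j * e ^ k) c l D hD hl
    ((hag.symm.pow_right.mul_right hbg.symm.pow_right).mul_right heg.symm.pow_right) (by rw [← h]; ring)
  refine ⟨h1, h2, h3, h4, e1, e2, e3, e4, ?_⟩
  apply odd_pow_inj _ _ D hD
  rw [← h, e1, e2, e3, e4]
  simp only [mul_pow, ← pow_mul]
  rw [mul_comm i, mul_comm j, mul_comm k, mul_comm l]

theorem cop_help (P Q a b f g α β γ δ : ℤ) (hPQ : IsCoprime P Q) (h3 : ¬ (3:ℤ) ∣ P) (ha : Odd a)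
    (haf : a ∣ f) (hbg : b ∣ g) (h4P : 4 * P = α * f + β * g) (h12Q : 12 * Q = γ * f + δ * g) :
    IsCoprime a b := by
  apply isCoprime_of_prime_dvd
  · rintro ⟨rfl, -⟩; simp at ha
  · intro p hp hpa hpb
    have hp2 : ¬ p ∣ 2 := by
      intro h
      obtain ⟨k, hk⟩ := ha
      apply hp.not_isUnit
      apply isUnit_of_dvd_one
      rw [show (1:ℤ) = a - 2 * k by linarith]
      exact dvd_sub hpa (h.mul_right _)
    have hp4 : ¬ p ∣ 4 := by
      intro h; rw [show (4:ℤ) = 2 * 2 by norm_num] at h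
      rcases hp.dvd_or_dvd h with h | h <;> exact hp2 h
    have hpf := hpa.trans haf
    have hpg := hpb.trans hbg
    have k1 : p ∣ 4 * P := by rw [h4P]; exact dvd_add (hpf.mul_left _) (hpg.mul_left _)
    have k2 : p ∣ 4 * (3 * Q) := by
      rw [show 4 * (3 * Q) = 12 * Q by ring, h12Q]; exact dvd_add (hpf.mul_left _) (hpg.mul_left _)
    have k3 := (hp.dvd_or_dvd k1).resolve_left hp4
    rcases hp.dvd_or_dvd ((hp.dvd_or_dvd k2).resolve_left hp4) with h | h
    · have : Associated p 3 := hp.associated_of_dvd Int.prime_three h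
      exact h3 (this.symm.dvd.trans k3)
    · exact hp.not_isUnit (hPQ.isUnit_of_dvd' k3 h)

theorem odd_of_odd_pow (h : ℤ) (D : ℕ) (hh : Odd (h ^ D)) (hD : D ≠ 0) : Odd h := by
  rcases Int.even_or_odd h with h0 | h0
  · exact absurd hh (by rw [Int.not_odd_iff_even]; exact h0.pow_of_ne_zero hD)
  · exact h0

theorem even_of_even_pow (h : ℤ) (D : ℕ) (hh : Even (h ^ D)) : Even h := by
  rcases Int.even_or_odd h with h0 | h0
  · exact h0
  · exact absurd hh (by rw [Int.not_even_iff_odd]; exact h0.pow)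

theorem two_mul_dvd_of (h c : ℤ) (hh : Odd h) (hc : Even c) (hdv : h ∣ c) : 2 * h ∣ c := by
  have : IsCoprime 2 h := by
    obtain ⟨k, hk⟩ := hh
    exact ⟨-k, 1, by rw [hk]; ring⟩
  exact this.mul_dvd hc.two_dvd hdv

theorem a2_six_le (c P Q h1 h4 : ℤ) (D : ℕ) (hD : Odd D) (hc : 2 ≤ c) (hce : Even c)
    (hQo : Odd Q) (h3 : ¬ (3:ℤ) ∣ P)
    (o1 : Odd h1) (o4 : Odd h4) (d1 : h1 ∣ c) (d4 : h4 ∣ c)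
    (hf1 : P - 3 * Q = 2 * h1 ^ D) (hf4 : P + Q = 2 * h4 ^ D) (hne : P ^ 2 - Q ^ 2 ≠ 0) : 6 ≤ c := by
  have key : ∀ h : ℤ, Odd h → h ∣ c → 6 ≤ c ∨ h = 1 ∨ h = -1 := by
    intro h ho hd
    have h2 := Int.le_of_dvd (by omega) ((abs_dvd _ _).2 (two_mul_dvd_of h c ho hce hd))
    by_cases h0 : 6 ≤ c
    · exact Or.inl h0
    · right
      rw [abs_mul] at h2
      norm_num at h2
      have := abs_lt.1 (show |h| < 3 by omega)
      obtain ⟨k, hk⟩ := ho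
      omega
  rcases key h1 o1 d1 with h | h
  · exact h
  rcases key h4 o4 d4 with h' | h'
  · exact h'
  exfalso
  obtain ⟨q, hq⟩ := hQo
  have e1 : P - 3 * Q = 2 ∨ P - 3 * Q = -2 := by
    rcases h with rfl | rfl
    · left; simpa using hf1
    · right; rw [hD.neg_one_pow] at hf1; simpa using hf1
  have e4 : P + Q = 2 ∨ P + Q = -2 := by
    rcases h' with rfl | rfl
    · left; simpa using hf4
    · right; rw [hD.neg_one_pow] at hf4; simpa using hf4
  have : (P = -1 ∧ Q = -1) ∨ (P = 1 ∧ Q = 1) := by omega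
  rcases this with ⟨rfl, rfl⟩ | ⟨rfl, rfl⟩ <;> simp at hne

set_option maxHeartbeats 1000000 in
theorem a2_core4 (P Q c : ℤ) (D : ℕ) (hD : Odd D) (hD35 : 35 ≤ D) (hD3 : Nat.Coprime 3 D)
    (hc : 2 ≤ c) (hce : Even c) (hPo : Odd P) (hQo : Odd Q) (hPQ : IsCoprime P Q)
    (h3 : ¬ (3:ℤ) ∣ P) (h4 : (P + Q) % 4 = 2)
    (h : ((P ^ 2 - 9 * Q ^ 2) * (P ^ 2 - Q ^ 2) ^ 3 = 64 * c ^ D ∧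
        (32 * c ^ 5 * Q ^ 6 ≤ P ^ 6 ∨ 32 * c ^ 5 * P ^ 2 ≤ 9 * Q ^ 2)) ∨
      ((P ^ 2 - 9 * Q ^ 2) ^ 3 * (P ^ 2 - Q ^ 2) = 64 * c ^ D ∧
        (32 * c ^ 5 * Q ^ 2 ≤ P ^ 2 ∨ 32 * c ^ 5 * P ^ 6 ≤ 729 * Q ^ 6))) : False := by
  have hD0 : D ≠ 0 := by omega
  have hQ0 : Q ≠ 0 := by rintro rfl; simp at hQo
  have hcD : 0 < c ^ D := by positivity
  obtain ⟨q, hq⟩ := hQo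
  obtain ⟨f1, hf1⟩ : ∃ f, P - 3 * Q = 2 * f := ⟨(P - 3 * Q) / 2, by omega⟩
  obtain ⟨f4, hf4⟩ : ∃ f, P + Q = 2 * f := ⟨(P + Q) / 2, by omega⟩
  have o1 : Odd f1 := by rw [Int.odd_iff]; omega
  have o4 : Odd f4 := by rw [Int.odd_iff]; omega
  have hne : P ^ 2 - Q ^ 2 ≠ 0 := by
    intro h0
    rw [h0] at h
    rcases h with ⟨h, -⟩ | ⟨h, -⟩
    · norm_num at h; omega
    · norm_num at h; omega
  have hc5 : 1 ≤ c ^ 5 := one_le_pow₀ (by omega)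
  have weak1 : 32 * c ^ 5 * P ^ 2 ≤ 9 * Q ^ 2 → 32 * c ^ 5 * P ^ 6 ≤ 729 * Q ^ 6 := by
    intro h
    have h1 : (32 * c ^ 5 * P ^ 2) ^ 3 ≤ (9 * Q ^ 2) ^ 3 := pow_le_pow_left₀ (by positivity) h 3
    have h2 : (32 * c ^ 5) * P ^ 6 ≤ (32 * c ^ 5) ^ 3 * P ^ 6 :=
      mul_le_mul_of_nonneg_right (le_self_pow₀ (by linarith) (by norm_num)) (by positivity)
    calc _ ≤ _ := h2
      _ = (32 * c ^ 5 * P ^ 2) ^ 3 := by ring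
      _ ≤ _ := h1
      _ = _ := by ring
  have weak2 : 32 * c ^ 5 * Q ^ 2 ≤ P ^ 2 → 32 * c ^ 5 * Q ^ 6 ≤ P ^ 6 := by
    intro h
    have h1 : (32 * c ^ 5 * Q ^ 2) ^ 3 ≤ (P ^ 2) ^ 3 := pow_le_pow_left₀ (by positivity) h 3
    have h2 : (32 * c ^ 5) * Q ^ 6 ≤ (32 * c ^ 5) ^ 3 * Q ^ 6 :=
      mul_le_mul_of_nonneg_right (le_self_pow₀ (by linarith) (by norm_num)) (by positivity)
    calc _ ≤ _ := h2
      _ = (32 * c ^ 5 * Q ^ 2) ^ 3 := by ring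
      _ ≤ _ := h1
      _ = _ := by ring
  have hfac : (P ^ 2 - 9 * Q ^ 2) = (P - 3 * Q) * (P + 3 * Q) ∧ (P ^ 2 - Q ^ 2) = (P - Q) * (P + Q) := by
    constructor <;> ring
  have c1 : Nat.Coprime 1 D := by simp
  have d1 : f1 ∣ P - 3 * Q := ⟨2, by linarith⟩
  have d4 : f4 ∣ P + Q := ⟨2, by linarith⟩
  have k14 : IsCoprime f1 f4 := cop_help P Q f1 f4 _ _ 1 3 (-3) 3 hPQ h3 o1 d1 d4 (by ring) (by ring)
  have o16 : ∀ z : ℤ, Odd z → IsCoprime z 16 := by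
    rintro z ⟨k, hk⟩
    have : IsCoprime z 2 := ⟨1, -k, by rw [hk]; ring⟩
    have := this.pow_right (n := 4)
    norm_num at this; exact this
  -- final steps shared by the cases
  have hcase : (P + 3 * Q) % 8 = 4 ∨ (P - Q) % 8 = 4 := by omega
  rcases hcase with hA | hB
  · obtain ⟨f2, hf2⟩ : ∃ f, P + 3 * Q = 4 * f := ⟨(P + 3 * Q) / 4, by omega⟩
    have o2 : Odd f2 := by rw [Int.odd_iff]; omega
    have d2 : f2 ∣ P + 3 * Q := ⟨4, by linarith⟩
    have e3 : Even (P - Q) := by rw [Int.even_iff]; omega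
    have k12 : IsCoprime f1 f2 := cop_help P Q f1 f2 _ _ 2 2 (-2) 2 hPQ h3 o1 d1 d2 (by ring) (by ring)
    have k13 : IsCoprime f1 (P - Q) := cop_help P Q f1 (P - Q) _ _ (-2) 6 (-6) 6 hPQ h3 o1 d1 dvd_rfl (by ring) (by ring)
    have k23 : IsCoprime f2 (P - Q) := cop_help P Q f2 (P - Q) _ _ 1 3 3 (-3) hPQ h3 o2 d2 dvd_rfl (by ring) (by ring)
    have k24 : IsCoprime f2 f4 := cop_help P Q f2 f4 _ _ (-2) 6 6 (-6) hPQ h3 o2 d2 d4 (by ring) (by ring)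
    have k43 : IsCoprime f4 (P - Q) := cop_help P Q f4 (P - Q) _ _ 2 2 (6) (-6) hPQ h3 o4 d4 dvd_rfl (by ring) (by ring)
    rcases h with ⟨heq, hdom⟩ | ⟨heq, hdom⟩
    · obtain ⟨h1, h2, h3', h4', E1, E2, E3, E4, Ec⟩ := dth4 f1 f2 (P - Q) f4 c 1 1 3 3 D hD c1 c1 hD3 hD3
        k12 k13 k14 k23 k24 k43.symm (by
          have := heq
          rw [hfac.1, hfac.2, hf1, hf2, hf4] at this
          linarith)
      have O1 : Odd h1 := odd_of_odd_pow _ D (E1 ▸ o1) hD0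
      have O4 : Odd h4' := odd_of_odd_pow _ D (E4 ▸ o4) hD0
      have O3 : Even h3' := even_of_even_pow _ D (E3 ▸ e3)
      have hc6 : 6 ≤ c := a2_six_le c P Q h1 h4' D hD hc hce ⟨q, hq⟩ h3 O1 O4
        ⟨h2 ^ 1 * h3' ^ 3 * h4' ^ 3, by rw [Ec]; ring⟩ ⟨h1 ^ 1 * h2 ^ 1 * h3' ^ 3 * h4' ^ 2, by rw [Ec]; ring⟩
        (by rw [hf1, E1]) (by rw [hf4, E4]) hne
      rcases hdom with hdom | hdom
      · exact a2_Pdom P Q c h1 h4' D hD hD35 (by rw [hf1, E1]) (by rw [hf4, E4]) hQ0 hc6 hdom (Or.inl heq)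
      · refine a2_Q11 P Q c (h1 * h4') (h2 * h3') D hD hD35 ?_ ?_ ?_ hQ0 hc6 (weak1 hdom) (Or.inl heq)
        · rw [hf1, hf4, E1, E4]; ring
        · rw [hf2, E2, E3]; ring
        · intro hh
          have := O1.mul O4
          rw [hh, ← Int.not_even_iff_odd] at this
          exact this (O3.mul_left _)
    · obtain ⟨h1, h2, h3', h4', E1, E2, E3, E4, Ec⟩ := dth4 f1 f2 (16 * (P - Q)) f4 c 3 3 1 1 D hD hD3 hD3 c1 c1
        k12 ((o16 f1 o1).mul_right k13) k14 ((o16 f2 o2).mul_right k23) k24 ((o16 f4 o4).mul_right k43).symm (by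
          have := heq
          rw [hfac.1, hfac.2, hf1, hf2, hf4] at this
          linarith)
      have O1 : Odd h1 := odd_of_odd_pow _ D (E1 ▸ o1) hD0
      have O2 : Odd h2 := odd_of_odd_pow _ D (E2 ▸ o2) hD0
      have O4 : Odd h4' := odd_of_odd_pow _ D (E4 ▸ o4) hD0
      have O3 : Even h3' := even_of_even_pow _ D (E3 ▸ (e3.mul_left _))
      have hc6 : 6 ≤ c := a2_six_le c P Q h1 h4' D hD hc hce ⟨q, hq⟩ h3 O1 O4
        ⟨h1 ^ 2 * h2 ^ 3 * h3' ^ 1 * h4' ^ 1, by rw [Ec]; ring⟩ ⟨h1 ^ 3 * h2 ^ 3 * h3' ^ 1, by rw [Ec]; ring⟩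
        (by rw [hf1, E1]) (by rw [hf4, E4]) hne
      rcases hdom with hdom | hdom
      · exact a2_Pdom P Q c h1 h4' D hD hD35 (by rw [hf1, E1]) (by rw [hf4, E4]) hQ0 hc6 (weak2 hdom) (Or.inr heq)
      · have hc54 : 54 ≤ c := by
          have hh1 : 3 ≤ |h1| := by
            by_contra hlt
            have hl := abs_lt.1 (show |h1| < 3 by omega)
            have hpm : h1 = 1 ∨ h1 = -1 := by
              obtain ⟨k, hk⟩ := O1; omega
            have e1 : P - 3 * Q = 2 ∨ P - 3 * Q = -2 := by
              rcases hpm with rfl | rfl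
              · left; rw [hf1, E1]; simp
              · right; rw [hf1, E1, hD.neg_one_pow]; norm_num
            have hPQ2 : P ^ 6 < Q ^ 6 := by
              have h6 : (6:ℤ) ^ 5 ≤ c ^ 5 := pow_le_pow_left₀ (by norm_num) hc6 5
              have hP6 : 0 < P ^ 6 := by
                have : P ≠ 0 := by rintro rfl; simp at hPo
                positivity
              nlinarith
            have hab : |P| < |Q| := by
              by_contra hge
              have := pow_le_pow_left₀ (abs_nonneg Q) (not_lt.1 hge) 6
              rw [(by decide : Even 6).pow_abs, (by decide : Even 6).pow_abs] at this
              omega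
            have hQ1 : |Q| = 1 := by
              rcases abs_cases P with ⟨a1, a2⟩ | ⟨a1, a2⟩ <;> rcases abs_cases Q with ⟨b1, b2⟩ | ⟨b1, b2⟩ <;> omega
            have : P = 0 := by
              have : |P| < 1 := by omega
              exact Int.abs_lt_one_iff.1 this
            rw [this] at hPo; simp at hPo
          have hd2 : 2 * h1 ^ 3 ∣ c := two_mul_dvd_of _ _ O1.pow hce ⟨h2 ^ 3 * h3' ^ 1 * h4' ^ 1, by rw [Ec]; ring⟩
          have := Int.le_of_dvd (by omega) ((abs_dvd _ _).2 hd2)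
          rw [abs_mul, abs_pow] at this
          have h27 : (3:ℤ) ^ 3 ≤ |h1| ^ 3 := pow_le_pow_left₀ (by norm_num) hh1 3
          norm_num at this h27
          omega
        refine a2_Q51 P Q c (h1 ^ 5 * h4') (h2 ^ 5 * h3') D hD hD35 ?_ ?_ ?_ hQ0 hc54 hdom heq
        · rw [hf1, hf4, E1, E4]; ring
        · rw [hf2, E2]
          have : 16 * ((4 * h2 ^ D) ^ 5 * (P - Q)) = 16 * (64 * (h2 ^ 5 * h3') ^ D) := by
            rw [show 16 * ((4 * h2 ^ D) ^ 5 * (P - Q)) = (4 * h2 ^ D) ^ 5 * (16 * (P - Q)) by ring, E3]; ring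
          linarith
        · intro hh
          have := (O1.pow (n := 5)).mul O4
          rw [hh, ← Int.not_even_iff_odd] at this
          exact this (O3.mul_left _)
  · obtain ⟨f3, hf3⟩ : ∃ f, P - Q = 4 * f := ⟨(P - Q) / 4, by omega⟩
    have o3 : Odd f3 := by rw [Int.odd_iff]; omega
    have d3 : f3 ∣ P - Q := ⟨4, by linarith⟩
    have e2 : Even (P + 3 * Q) := by rw [Int.even_iff]; omega
    have k12 : IsCoprime f1 (P + 3 * Q) := cop_help P Q f1 _ _ _ 2 2 (-2) 2 hPQ h3 o1 d1 dvd_rfl (by ring) (by ring)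
    have k13 : IsCoprime f1 f3 := cop_help P Q f1 f3 _ _ (-2) 6 (-6) 6 hPQ h3 o1 d1 d3 (by ring) (by ring)
    have k32 : IsCoprime f3 (P + 3 * Q) := cop_help P Q f3 _ _ _ 3 1 (-3) 3 hPQ h3 o3 d3 dvd_rfl (by ring) (by ring)
    have k42 : IsCoprime f4 (P + 3 * Q) := cop_help P Q f4 _ _ _ 6 (-2) (-6) 6 hPQ h3 o4 d4 dvd_rfl (by ring) (by ring)
    have k34 : IsCoprime f3 f4 := cop_help P Q f3 f4 _ _ 2 2 (-6) 6 hPQ h3 o3 d3 d4 (by ring) (by ring)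
    rcases h with ⟨heq, hdom⟩ | ⟨heq, hdom⟩
    · obtain ⟨h1, h2, h3', h4', E1, E2, E3, E4, Ec⟩ := dth4 f1 (16 * (P + 3 * Q)) f3 f4 c 1 1 3 3 D hD c1 c1 hD3 hD3
        ((o16 f1 o1).mul_right k12) k13 k14 ((o16 f3 o3).mul_right k32).symm ((o16 f4 o4).mul_right k42).symm k34 (by
          have := heq
          rw [hfac.1, hfac.2, hf1, hf3, hf4] at this
          linarith)
      have O1 : Odd h1 := odd_of_odd_pow _ D (E1 ▸ o1) hD0
      have O4 : Odd h4' := odd_of_odd_pow _ D (E4 ▸ o4) hD0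
      have O2 : Even h2 := even_of_even_pow _ D (E2 ▸ (e2.mul_left _))
      have hc6 : 6 ≤ c := a2_six_le c P Q h1 h4' D hD hc hce ⟨q, hq⟩ h3 O1 O4
        ⟨h2 ^ 1 * h3' ^ 3 * h4' ^ 3, by rw [Ec]; ring⟩ ⟨h1 ^ 1 * h2 ^ 1 * h3' ^ 3 * h4' ^ 2, by rw [Ec]; ring⟩
        (by rw [hf1, E1]) (by rw [hf4, E4]) hne
      rcases hdom with hdom | hdom
      · exact a2_Pdom P Q c h1 h4' D hD hD35 (by rw [hf1, E1]) (by rw [hf4, E4]) hQ0 hc6 hdom (Or.inl heq)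
      · refine a2_Q15 P Q c (h1 * h4' ^ 5) (h2 * h3' ^ 5) D hD hD35 ?_ ?_ ?_ hQ0 hc6 hdom heq
        · rw [hf1, hf4, E1, E4]; ring
        · rw [hf3, E3]
          have : 16 * ((P + 3 * Q) * (4 * h3' ^ D) ^ 5) = 16 * (64 * (h2 * h3' ^ 5) ^ D) := by
            rw [show 16 * ((P + 3 * Q) * (4 * h3' ^ D) ^ 5) = (4 * h3' ^ D) ^ 5 * (16 * (P + 3 * Q)) by ring, E2]; ring
          linarith
        · intro hh
          have := O1.mul (O4.pow (n := 5))
          rw [hh, ← Int.not_even_iff_odd] at this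
          exact this (O2.mul_right _)
    · obtain ⟨h1, h2, h3', h4', E1, E2, E3, E4, Ec⟩ := dth4 f1 (P + 3 * Q) f3 f4 c 3 3 1 1 D hD hD3 hD3 c1 c1
        k12 k13 k14 k32.symm k42.symm k34 (by
          have := heq
          rw [hfac.1, hfac.2, hf1, hf3, hf4] at this
          linarith)
      have O1 : Odd h1 := odd_of_odd_pow _ D (E1 ▸ o1) hD0
      have O4 : Odd h4' := odd_of_odd_pow _ D (E4 ▸ o4) hD0
      have O2 : Even h2 := even_of_even_pow _ D (E2 ▸ e2)
      have hc6 : 6 ≤ c := a2_six_le c P Q h1 h4' D hD hc hce ⟨q, hq⟩ h3 O1 O4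
        ⟨h1 ^ 2 * h2 ^ 3 * h3' ^ 1 * h4' ^ 1, by rw [Ec]; ring⟩ ⟨h1 ^ 3 * h2 ^ 3 * h3' ^ 1, by rw [Ec]; ring⟩
        (by rw [hf1, E1]) (by rw [hf4, E4]) hne
      rcases hdom with hdom | hdom
      · exact a2_Pdom P Q c h1 h4' D hD hD35 (by rw [hf1, E1]) (by rw [hf4, E4]) hQ0 hc6 (weak2 hdom) (Or.inr heq)
      · refine a2_Q11 P Q c (h1 * h4') (h2 * h3') D hD hD35 ?_ ?_ ?_ hQ0 hc6 hdom (Or.inr heq)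
        · rw [hf1, hf4, E1, E4]; ring
        · rw [hf3, E2, E3]; ring
        · intro hh
          have := O1.mul O4
          rw [hh, ← Int.not_even_iff_odd] at this
          exact this (O2.mul_right _)

theorem a2_core (P Q c : ℤ) (D : ℕ) (hD : Odd D) (hD35 : 35 ≤ D) (hD3 : Nat.Coprime 3 D)
    (hc : 2 ≤ c) (hce : Even c) (hPo : Odd P) (hQo : Odd Q) (hPQ : IsCoprime P Q)
    (h3 : ¬ (3:ℤ) ∣ P)
    (h : ((P ^ 2 - 9 * Q ^ 2) * (P ^ 2 - Q ^ 2) ^ 3 = 64 * c ^ D ∧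
        (32 * c ^ 5 * Q ^ 6 ≤ P ^ 6 ∨ 32 * c ^ 5 * P ^ 2 ≤ 9 * Q ^ 2)) ∨
      ((P ^ 2 - 9 * Q ^ 2) ^ 3 * (P ^ 2 - Q ^ 2) = 64 * c ^ D ∧
        (32 * c ^ 5 * Q ^ 2 ≤ P ^ 2 ∨ 32 * c ^ 5 * P ^ 6 ≤ 729 * Q ^ 6))) : False := by
  have hm : (P + Q) % 4 = 2 ∨ (P + -Q) % 4 = 2 := by
    obtain ⟨k, hk⟩ := hPo
    obtain ⟨l, hl⟩ := hQo
    omega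
  rcases hm with hm | hm
  · exact a2_core4 P Q c D hD hD35 hD3 hc hce hPo hQo hPQ h3 hm h
  · refine a2_core4 P (-Q) c D hD hD35 hD3 hc hce hPo hQo.neg hPQ.neg_right h3 hm ?_
    rw [(by decide : Even 6).neg_pow, (by decide : Even 2).neg_pow]
    exact h

/-- The arithmetic statement for squares. -/
theorem arith2_even (c R X y : ℤ) (D : ℕ) (hD : Odd D) (hD3 : Nat.Coprime 3 D)
    (hc : 2 ≤ c) (hce : Even c)
    (hR : R ≠ 0) (hcop : IsCoprime R c) (hb : R ^ 6 * c ^ 5 ≤ 2 * c ^ D)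
    (hN : R = 1 ∨ 35 ≤ D)
    (h1 : y ^ 2 = R ^ 6 + c ^ D) (h2 : X ^ 4 - 6 * R ^ 2 * X ^ 2 - 3 * R ^ 4 = 8 * X * y) : False := by
  have hcD : 0 < c ^ D := by positivity
  have E : (X ^ 2 - 9 * R ^ 2) * (X ^ 2 - R ^ 2) ^ 3 = 64 * X ^ 2 * c ^ D := by
    have : (X ^ 4 - 6 * R ^ 2 * X ^ 2 - 3 * R ^ 4) ^ 2 = 64 * X ^ 2 * (R ^ 6 + c ^ D) := by
      rw [h2, ← h1]; ring
    linear_combination this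
  have hRo : Odd R := by
    rcases Int.even_or_odd R with h | h
    · exfalso
      have := hcop.isUnit_of_dvd' h.two_dvd hce.two_dvd
      exact Int.prime_two.not_isUnit this
    · exact h
  have hXo : Odd X := by
    rcases Int.even_or_odd X with h | h
    · exfalso
      have e1 : Even (X ^ 4 - 6 * R ^ 2 * X ^ 2 - 8 * X * y) := by
        obtain ⟨k, rfl⟩ := h
        exact ⟨8 * k ^ 4 - 12 * R ^ 2 * k ^ 2 - 8 * k * y, by ring⟩
      have e2 : Odd (3 * R ^ 4) := (by decide : Odd (3:ℤ)).mul hRo.pow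
      rw [show X ^ 4 - 6 * R ^ 2 * X ^ 2 - 8 * X * y = 3 * R ^ 4 by linarith, ← Int.not_odd_iff_even] at e1
      exact e1 e2
    · exact h
  have hX0 : X ≠ 0 := by rintro rfl; simp at hXo
  rcases hN with rfl | hD35
  · have hdv : X ∣ 3 := ⟨X ^ 3 - 6 * X - 8 * y, by linarith⟩
    have hle := Int.le_of_dvd (by norm_num) ((abs_dvd _ _).2 hdv)
    have hab := abs_le.1 hle
    have : 0 < 64 * X ^ 2 * c ^ D := by positivity
    rw [← E] at this
    obtain ⟨k, hk⟩ := hXo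
    have : X = 1 ∨ X = -1 ∨ X = 3 ∨ X = -3 := by omega
    rcases this with rfl | rfl | rfl | rfl <;> norm_num at *
  -- dominance
  have hx0 : 0 < X ^ 2 := by positivity
  have hq0 : 0 < R ^ 2 := by positivity
  have hlow : 32 * X ^ 2 * (R ^ 2) ^ 3 * c ^ 5 ≤ (X ^ 2 - 9 * R ^ 2) * (X ^ 2 - R ^ 2) ^ 3 := by
    rw [E, show 32 * X ^ 2 * (R ^ 2) ^ 3 * c ^ 5 = 32 * X ^ 2 * (R ^ 6 * c ^ 5) by ring]
    nlinarith
  have hdom : 32 * c ^ 5 * R ^ 6 ≤ X ^ 6 ∨ 32 * c ^ 5 * X ^ 2 ≤ 9 * R ^ 2 := by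
    have hc5 : 0 < c ^ 5 := by positivity
    set x := X ^ 2
    set q := R ^ 2
    have hpos : 0 < 32 * x * q ^ 3 * c ^ 5 := by positivity
    have hpos' : 0 < (x - 9 * q) * (x - q) ^ 3 := lt_of_lt_of_le hpos hlow
    rcases le_or_gt x (9 * q) with hle | hgt
    · rcases le_or_gt q x with hle2 | hgt2
      · exfalso
        have : 0 ≤ (x - q) ^ 3 := pow_nonneg (by linarith) 3
        nlinarith
      · right
        have a1 : (x - 9 * q) * (x - q) ^ 3 = (9 * q - x) * (q - x) ^ 3 := by ring
        have a2 : (q - x) ^ 3 ≤ q ^ 3 := pow_le_pow_left₀ (by linarith) (by linarith) 3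
        have a3 : (9 * q - x) * (q - x) ^ 3 ≤ 9 * q * q ^ 3 :=
          mul_le_mul (by linarith) a2 (pow_nonneg (by linarith) 3) (by linarith)
        have a4 : q ^ 3 * (32 * c ^ 5 * x) ≤ q ^ 3 * (9 * q) := by nlinarith
        exact le_of_mul_le_mul_left a4 (by positivity)
    · left
      have a2 : (x - q) ^ 3 ≤ x ^ 3 := pow_le_pow_left₀ (by linarith) (by linarith) 3
      have a3 : (x - 9 * q) * (x - q) ^ 3 ≤ x * x ^ 3 :=
          mul_le_mul (by linarith) a2 (pow_nonneg (by linarith) 3) (by linarith)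
      have a4 : x * (32 * c ^ 5 * q ^ 3) ≤ x * x ^ 3 := by nlinarith
      have a5 := le_of_mul_le_mul_left a4 hx0
      rw [show R ^ 6 = q ^ 3 by simp only [q]; ring, show X ^ 6 = x ^ 3 by simp only [x]; ring]
      exact a5
  -- remove the gcd
  obtain ⟨G, P, Q, hG0, hPQ, hXG, hRG⟩ : ∃ G P Q : ℤ, G ≠ 0 ∧ IsCoprime P Q ∧ X = G * P ∧ R = G * Q := by
    have hg : Int.gcd X R ≠ 0 := by
      rw [Ne, Int.gcd_eq_zero_iff]; tauto
    obtain ⟨P, hP⟩ := Int.gcd_dvd_left X R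
    obtain ⟨Q, hQ⟩ := Int.gcd_dvd_right X R
    have hg' : (Int.gcd X R : ℤ) ≠ 0 := by exact_mod_cast hg
    refine ⟨Int.gcd X R, P, Q, hg', ?_, hP, hQ⟩
    have := Int.gcd_eq_gcd_ab X R
    refine ⟨X.gcdA R, X.gcdB R, ?_⟩
    apply mul_left_cancel₀ hg'
    rw [mul_one, mul_add]
    linear_combination -this - X.gcdA R * hP - X.gcdB R * hQ
  have hGo : Odd G := by rw [hXG] at hXo; exact (Int.odd_mul.1 hXo).1
  have hPo : Odd P := by rw [hXG] at hXo; exact (Int.odd_mul.1 hXo).2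
  have hQo : Odd Q := by rw [hRG] at hRo; exact (Int.odd_mul.1 hRo).2
  have hP0 : P ≠ 0 := by rintro rfl; simp at hPo
  have hQ0 : Q ≠ 0 := by rintro rfl; simp at hQo
  have hGc : IsCoprime G c := hcop.of_isCoprime_of_dvd_left ⟨Q, hRG⟩
  have E2 : G ^ 6 * ((P ^ 2 - 9 * Q ^ 2) * (P ^ 2 - Q ^ 2) ^ 3) = 64 * P ^ 2 * c ^ D := by
    have : G ^ 2 * (G ^ 6 * ((P ^ 2 - 9 * Q ^ 2) * (P ^ 2 - Q ^ 2) ^ 3)) = G ^ 2 * (64 * P ^ 2 * c ^ D) := by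
      rw [hXG, hRG] at E; linear_combination E
    exact mul_left_cancel₀ (by positivity) this
  have hG2 : IsCoprime G 2 := by
    obtain ⟨k, hk⟩ := hGo
    exact ⟨1, -k, by rw [hk]; ring⟩
  have hG3P : G ^ 3 ∣ P := by
    have : (G ^ 3) ^ 2 ∣ P ^ 2 := by
      have k1 : G ^ 6 ∣ (2 ^ 6 * c ^ D) * P ^ 2 := ⟨(P ^ 2 - 9 * Q ^ 2) * (P ^ 2 - Q ^ 2) ^ 3, by rw [E2]; ring⟩
      have k2 : IsCoprime (G ^ 6) (2 ^ 6 * c ^ D) := (hG2.pow).mul_right hGc.pow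
      have := k2.dvd_of_dvd_mul_left k1
      rwa [← pow_mul]
    exact (Int.pow_dvd_pow_iff (by norm_num)).1 this
  obtain ⟨κ, hκ⟩ := hG3P
  have hκ0 : κ ≠ 0 := by rintro rfl; simp at hκ; exact hP0 hκ
  have E3 : (P ^ 2 - 9 * Q ^ 2) * (P ^ 2 - Q ^ 2) ^ 3 = 64 * κ ^ 2 * c ^ D := by
    have : G ^ 6 * ((P ^ 2 - 9 * Q ^ 2) * (P ^ 2 - Q ^ 2) ^ 3) = G ^ 6 * (64 * κ ^ 2 * c ^ D) := by
      rw [E2]; conv_lhs => rw [hκ]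
      ring
    exact mul_left_cancel₀ (by positivity) this
  have hκ9 : κ ∣ 3 := by
    have hκP : κ ∣ P := ⟨G ^ 3, by rw [hκ]; ring⟩
    have hκQ : IsCoprime κ Q := hPQ.of_isCoprime_of_dvd_left hκP
    have k1 : κ ^ 2 ∣ 9 * (Q ^ 2) ^ 4 := by
      obtain ⟨t, ht⟩ : κ ^ 2 ∣ P ^ 2 := pow_dvd_pow_of_dvd hκP 2
      refine ⟨64 * c ^ D - t * (P ^ 6 - 12 * P ^ 4 * Q ^ 2 + 30 * P ^ 2 * Q ^ 4 - 28 * Q ^ 6), ?_⟩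
      linear_combination E3 - (P ^ 6 - 12 * P ^ 4 * Q ^ 2 + 30 * P ^ 2 * Q ^ 4 - 28 * Q ^ 6) * ht 
    have k2 : κ ^ 2 ∣ 9 := by
      have : IsCoprime (κ ^ 2) ((Q ^ 2) ^ 4) := by rw [← pow_mul]; exact hκQ.pow
      exact this.dvd_of_dvd_mul_right k1
    have : κ ^ 2 ∣ 3 ^ 2 := by norm_num; exact k2
    exact (Int.pow_dvd_pow_iff (by norm_num)).1 this
  have hκc : κ = 1 ∨ κ = -1 ∨ κ = 3 ∨ κ = -3 := by
    have hle := Int.le_of_dvd (by norm_num) ((abs_dvd _ _).2 hκ9)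
    have hab := abs_le.1 hle
    have hκo : Odd κ := by rw [hκ] at hPo; exact (Int.odd_mul.1 hPo).2
    obtain ⟨k, hk⟩ := hκo
    omega
  have hdomP : 32 * c ^ 5 * Q ^ 6 ≤ P ^ 6 ∨ 32 * c ^ 5 * P ^ 2 ≤ 9 * Q ^ 2 := by
    rcases hdom with h | h
    · left
      rw [hXG, hRG] at h
      have : G ^ 6 * (32 * c ^ 5 * Q ^ 6) ≤ G ^ 6 * P ^ 6 := by linarith [mul_pow G P 6, mul_pow G Q 6, show 32 * c ^ 5 * (G * Q) ^ 6 = G ^ 6 * (32 * c ^ 5 * Q ^ 6) by ring]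
      exact le_of_mul_le_mul_left this (by positivity)
    · right
      rw [hXG, hRG] at h
      have : G ^ 2 * (32 * c ^ 5 * P ^ 2) ≤ G ^ 2 * (9 * Q ^ 2) := by linarith [show 32 * c ^ 5 * (G * P) ^ 2 = G ^ 2 * (32 * c ^ 5 * P ^ 2) by ring, show 9 * (G * Q) ^ 2 = G ^ 2 * (9 * Q ^ 2) by ring]
      exact le_of_mul_le_mul_left this (by positivity)
  have caseA : κ = 1 ∨ κ = -1 → False := by
    intro hκ1
    have hκs : κ ^ 2 = 1 := by rcases hκ1 with rfl | rfl <;> norm_num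
    rw [hκs, mul_one] at E3
    have h3P : ¬ (3:ℤ) ∣ P := by
      intro h
      have h3G : (3:ℤ) ∣ G := by
        have : (3:ℤ) ∣ G ^ 3 := by
          rcases hκ1 with rfl | rfl
          · rw [mul_one] at hκ; rwa [← hκ]
          · rw [mul_neg_one] at hκ; rwa [← neg_eq_iff_eq_neg.2 hκ, dvd_neg]
        exact Int.prime_three.dvd_of_dvd_pow this
      have h3c : (3:ℤ) ∣ c := by
        have : (3:ℤ) ∣ 64 * c ^ D := by
          rw [← E3]
          apply Dvd.dvd.mul_right
          exact dvd_sub (h.pow (by norm_num)) ⟨3 * Q ^ 2, by ring⟩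
        rcases Int.prime_three.dvd_or_dvd this with h | h
        · norm_num at h
        · exact Int.prime_three.dvd_of_dvd_pow h
      exact Int.prime_three.not_isUnit (hGc.isUnit_of_dvd' h3G h3c)
    exact a2_core P Q c D hD hD35 hD3 hc hce hPo hQo hPQ h3P (Or.inl ⟨E3, hdomP⟩)
  have caseB : (∃ p, P = 3 * p) → κ ^ 2 = 9 → False := by
    rintro ⟨p, rfl⟩ hκs
    have hpo : Odd p := (Int.odd_mul.1 hPo).2
    have h3Q : ¬ (3:ℤ) ∣ Q := by
      intro h
      exact Int.prime_three.not_isUnit (hPQ.isUnit_of_dvd' ⟨p, rfl⟩ h)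
    refine a2_core Q p c D hD hD35 hD3 hc hce hQo hpo ?_ h3Q (Or.inr ⟨?_, ?_⟩)
    · exact (hPQ.of_isCoprime_of_dvd_left ⟨3, by ring⟩).symm
    · rw [hκs] at E3
      have : 9 * ((Q ^ 2 - 9 * p ^ 2) ^ 3 * (Q ^ 2 - p ^ 2)) = 9 * (64 * c ^ D) := by
        linear_combination E3
      linarith
    · rcases hdomP with h | h
      · right; linarith [show (3 * p) ^ 6 = 729 * p ^ 6 by ring]
      · left; nlinarith [show (3 * p) ^ 2 = 9 * p ^ 2 by ring]
  rcases hκc with h | h | h | h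
  · exact caseA (Or.inl h)
  · exact caseA (Or.inr h)
  · exact caseB ⟨G ^ 3, by rw [hκ, h]; ring⟩ (by rw [h]; norm_num)
  · exact caseB ⟨-G ^ 3, by rw [hκ, h]; ring⟩ (by rw [h]; norm_num)
end

section
theorem arith2 (c R X y : ℤ) (D : ℕ) (hD : Odd D) (hD3 : Nat.Coprime 3 D) (hD5 : 5 ≤ D)
    (hc : 2 ≤ |c|)
    (hR : R ≠ 0) (hcop : IsCoprime R c) (hb : R ^ 6 * |c| ^ 5 ≤ 2 * |c| ^ D)
    (hN : R = 1 ∨ 35 ≤ D)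
    (h1 : y ^ 2 = R ^ 6 + c ^ D) (h2 : X ^ 4 - 6 * R ^ 2 * X ^ 2 - 3 * R ^ 4 = 8 * X * y) : False := by
  rcases le_or_gt 0 c with h0 | h0
  · rw [abs_of_nonneg h0] at hc hb
    rcases Int.even_or_odd c with he | ho
    · exact arith2_even c R X y D hD hD3 hc he hR hcop hb hN h1 h2
    · refine arith2_odd c R y D hD hD5 ?_ ho hR hcop hb h1
      obtain ⟨k, hk⟩ := ho
      omega
  · have e : c ^ D = - |c| ^ D := by rw [abs_of_neg h0, hD.neg_pow, neg_neg]
    rw [e] at h1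
    have h5 : (2:ℤ) ^ 5 ≤ |c| ^ 5 := pow_le_pow_left₀ (by norm_num) hc 5
    have h6 : 0 < R ^ 6 := by positivity
    nlinarith [sq_nonneg y]

theorem arith3_no3 (c R y : ℤ) (D : ℕ) (hD : Odd D) (hD5 : 5 ≤ D) (hc : 2 ≤ |c|)
    (hc3 : ¬ (3:ℤ) ∣ c)
    (hR : R ≠ 0) (hcop : IsCoprime R c) (hb : R ^ 6 * |c| ^ 5 ≤ 2 * |c| ^ D)
    (h1 : y ^ 3 = R ^ 6 + c ^ D) : False := by
  have hc0 : c ≠ 0 := by rintro rfl; simp at hc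
  have hcD : c ^ D ≠ 0 := pow_ne_zero _ hc0
  set C := |c| with hC
  have hCD : 0 < C ^ D := by positivity
  have h5 : (2:ℤ) ^ 5 ≤ C ^ 5 := pow_le_pow_left₀ (by norm_num) hc 5
  have h6 : 0 < R ^ 6 := by positivity
  have hR16 : 16 * R ^ 6 ≤ C ^ D := by nlinarith
  have hab : |c ^ D| = C ^ D := abs_pow _ _
  have hy0 : y ≠ 0 := by
    rintro rfl
    have : |c ^ D| = R ^ 6 := by
      rw [show c ^ D = - R ^ 6 by linarith, abs_neg, abs_of_pos h6]
    omega
  have hy3 : 16 * |y| ^ 3 ≤ 17 * C ^ D := by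
    rw [← abs_pow, h1]
    have := abs_add_le (R ^ 6) (c ^ D)
    rw [abs_of_pos h6] at this
    omega
  have hfac : (y - R ^ 2) * (y ^ 2 + y * R ^ 2 + R ^ 4) = c ^ D := by linear_combination h1
  have hcp : IsCoprime (y - R ^ 2) (y ^ 2 + y * R ^ 2 + R ^ 4) := by
    apply isCoprime_of_prime_dvd
    · rintro ⟨h, -⟩
      rw [h, zero_mul] at hfac
      exact hcD hfac.symm
    · intro p hp ha hb'
      have hpc : p ∣ c := by
        apply hp.dvd_of_dvd_pow (n := D)
        rw [← hfac]; exact ha.mul_right _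
      have h2 : p ∣ 3 * R ^ 4 := by
        have := dvd_sub hb' (ha.mul_right (y + 2 * R ^ 2))
        rwa [show y ^ 2 + y * R ^ 2 + R ^ 4 - (y - R ^ 2) * (y + 2 * R ^ 2) = 3 * R ^ 4 by ring] at this
      rcases hp.dvd_or_dvd h2 with h3 | h3
      · have : Associated p 3 := hp.associated_of_dvd Int.prime_three h3
        exact hc3 (this.symm.dvd.trans hpc)
      · exact hp.not_isUnit (hcop.isUnit_of_dvd' (hp.dvd_of_dvd_pow h3) hpc)
  obtain ⟨u, hu⟩ := dth2 _ _ c 1 D hD (by simp) hcp (by rw [pow_one]; exact hfac)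
  obtain ⟨v, hv⟩ := dth2 _ _ c 1 D hD (by simp) hcp.symm (by rw [pow_one, mul_comm]; exact hfac)
  have huv : u * v = c := by
    apply odd_pow_inj _ _ D hD
    rw [mul_pow, ← hu, ← hv, hfac]
  obtain ⟨n, rfl⟩ : ∃ n, D = n + 1 := ⟨D - 1, by omega⟩
  have hn : Even n := by
    rcases Nat.even_or_odd n with h | h
    · exact h
    · exact absurd hD (by rw [Nat.not_odd_iff_even]; exact h.add_one)
  have hdiff : v ^ (n + 1) - (u ^ 2) ^ (n + 1) = 3 * y * R ^ 2 := by
    rw [← pow_mul, mul_comm 2, pow_mul, ← hu, ← hv]; ring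
  have hne : v ≠ u ^ 2 := by
    intro h
    rw [h, sub_self] at hdiff
    have : 3 * y * R ^ 2 ≠ 0 := by positivity
    exact this hdiff.symm
  have g1 := gap_int v (u ^ 2) n hn (by omega) hne
  have g2 := gap_int (u ^ 2) v n hn (by omega) hne.symm
  rw [abs_sub_comm] at g2
  rw [hdiff] at g1 g2
  set B := |3 * y * R ^ 2| with hB
  have hB3 : B ^ 3 = 27 * |y| ^ 3 * R ^ 6 := by
    rw [hB, abs_mul, abs_mul, abs_of_pos (by positivity : 0 < R ^ 2)]
    norm_num; ring
  have hBb : 16 * (B ^ 3 * C ^ 5) ≤ 918 * (C ^ (n + 1)) ^ 2 := by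
    rw [hB3]
    calc 16 * (27 * |y| ^ 3 * R ^ 6 * C ^ 5) = 27 * ((16 * |y| ^ 3) * (R ^ 6 * C ^ 5)) := by ring
      _ ≤ 27 * ((17 * C ^ (n + 1)) * (2 * C ^ (n + 1))) := by gcongr
      _ = _ := by ring
  have hCn : 0 < C ^ n := by positivity
  rcases lt_or_ge C 4 with hlt | hge
  · have hC2 : C = 2 := by
      have : C ≠ 3 := by
        intro h
        apply hc3
        rw [← dvd_abs, ← hC, h]
      omega
    have hB2 : 2 ^ n ≤ B := by
      by_cases h2 : 2 ≤ |v|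
      · exact (pow_le_pow_left₀ (by norm_num) h2 n).trans g1
      · refine (pow_le_pow_left₀ (by norm_num) ?_ n).trans g2
        have e : |u| * |v| = 2 := by rw [← abs_mul, huv, ← hC, hC2]
        have hv1 : |v| = 1 := by
          have := abs_nonneg v
          have : |v| ≠ 0 := by intro h; rw [h] at e; simp at e
          omega
        rw [hv1, mul_one] at e
        rw [abs_pow, e]; norm_num
    have hB8 : (2 ^ n) ^ 3 ≤ B ^ 3 := pow_le_pow_left₀ (by positivity) hB2 3
    rw [hC2] at hBb
    have h16 : (2:ℤ) ^ 4 ≤ 2 ^ n := pow_le_pow_right₀ (by norm_num) (by omega)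
    have : (16:ℤ) * 2 ^ 5 * (2 ^ n) ^ 3 ≤ 918 * 4 * (2 ^ n) ^ 2 := by
      rw [pow_succ (2:ℤ) n] at hBb
      nlinarith
    have h2n : (0:ℤ) < 2 ^ n := by positivity
    nlinarith [mul_pos h2n h2n]
  · have g3 : (C ^ n) ^ 2 ≤ B ^ 3 := by
      calc (C ^ n) ^ 2 = |v| ^ n * |v| ^ n * |u ^ 2| ^ n := by
            rw [hC, ← huv, abs_mul, abs_pow]; ring
        _ ≤ B * B * B := by gcongr
        _ = _ := by ring
    have h7 : (C ^ n) ^ 2 * (16 * C ^ 5) ≤ (C ^ n) ^ 2 * (918 * C ^ 2) := by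
      calc (C ^ n) ^ 2 * (16 * C ^ 5) = 16 * ((C ^ n) ^ 2 * C ^ 5) := by ring
        _ ≤ 16 * (B ^ 3 * C ^ 5) := by gcongr
        _ ≤ _ := hBb
        _ = _ := by ring
    have h8 := le_of_mul_le_mul_left h7 (by positivity)
    have h9 : 4 ^ 3 ≤ C ^ 3 := pow_le_pow_left₀ (by norm_num) hge 3
    have h10 : 0 < C ^ 2 := by positivity
    nlinarith
end

section
/-- nat version, strong form -/
theorem close_nat_strong (U V D : ℕ) (N ε : ℝ) (hD : 1 ≤ D) (hN : 0 < N) (hU : 1 ≤ U) (hUV : U ≠ V)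
    (hε : ε < 1) (h : |N * (U:ℝ) ^ D - N * (V:ℝ) ^ D| ≤ ε * (N * (U:ℝ) ^ D)) :
    (D:ℝ) * (1 - ε) ≤ ε * U := by
  obtain ⟨n, rfl⟩ : ∃ n, D = n + 1 := ⟨D - 1, by omega⟩
  have hUr : (1:ℝ) ≤ U := by exact_mod_cast hU
  have hNU : 0 < N * (U:ℝ) ^ (n + 1) := by positivity
  have hε0 : 0 ≤ ε := by
    by_contra hneg
    push Not at hneg
    have := (abs_nonneg _).trans h
    nlinarith
  have hn0 : (0:ℝ) ≤ n := Nat.cast_nonneg n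
  rcases lt_or_gt_of_ne hUV with hlt | hlt
  · have g := pow_gap_nat U V n hlt
    have g' : ((n:ℝ) + 1) * (U:ℝ) ^ n + (U:ℝ) ^ (n + 1) ≤ (V:ℝ) ^ (n + 1) := by exact_mod_cast g
    have h2 := (abs_le.1 h).1
    have hp : (0:ℝ) < N * (U:ℝ) ^ n := by positivity
    have h3 : ((n:ℝ) + 1) * (N * (U:ℝ) ^ n) ≤ (ε * U) * (N * (U:ℝ) ^ n) := by
      have := mul_le_mul_of_nonneg_left g' hN.le
      rw [pow_succ (U:ℝ)] at this h2
      nlinarith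
    have h4 := le_of_mul_le_mul_right h3 hp
    push_cast
    nlinarith
  · have g := pow_gap_nat V U n hlt
    have g' : ((n:ℝ) + 1) * (V:ℝ) ^ n + (V:ℝ) ^ (n + 1) ≤ (U:ℝ) ^ (n + 1) := by exact_mod_cast g
    have h2 := (abs_le.1 h).2
    have hVU : (V:ℝ) ≤ U := by exact_mod_cast hlt.le
    have hUp : (0:ℝ) < (U:ℝ) ^ (n + 1) := by positivity
    have h7 : (U:ℝ) ^ (n + 1) - (V:ℝ) ^ (n + 1) ≤ ε * (U:ℝ) ^ (n + 1) := by
      have : N * ((U:ℝ) ^ (n + 1) - (V:ℝ) ^ (n + 1)) ≤ N * (ε * (U:ℝ) ^ (n + 1)) := by nlinarith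
      exact le_of_mul_le_mul_left this hN
    have h5 : (1 - ε) * (U:ℝ) ^ (n + 1) ≤ (V:ℝ) ^ (n + 1) := by linarith
    have hVp : (0:ℝ) < (V:ℝ) ^ (n + 1) := lt_of_lt_of_le (mul_pos (by linarith) hUp) h5
    have hV : 0 < V := by
      rcases Nat.eq_zero_or_pos V with h0 | h0
      · rw [h0] at hVp; simp at hVp
      · exact h0
    have hVr : (0:ℝ) < V := by exact_mod_cast hV
    have h6 : ((n:ℝ) + 1) * (V:ℝ) ^ n ≤ ε * (U:ℝ) ^ (n + 1) := by linarith
    have h8 : (((n:ℝ) + 1) * (1 - ε)) * (V:ℝ) ^ n ≤ (ε * V) * (V:ℝ) ^ n := by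
      calc (((n:ℝ) + 1) * (1 - ε)) * (V:ℝ) ^ n = (1 - ε) * (((n:ℝ) + 1) * (V:ℝ) ^ n) := by ring
        _ ≤ (1 - ε) * (ε * (U:ℝ) ^ (n + 1)) := mul_le_mul_of_nonneg_left h6 (by linarith)
        _ = ε * ((1 - ε) * (U:ℝ) ^ (n + 1)) := by ring
        _ ≤ ε * (V:ℝ) ^ (n + 1) := mul_le_mul_of_nonneg_left h5 hε0
        _ = _ := by ring
    have h9 := le_of_mul_le_mul_right h8 (by positivity)
    push_cast
    nlinarith

/-- The closing lemma (signed version, strong form). -/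
theorem close_strong (U V : ℤ) (D : ℕ) (N ε q a b : ℝ) (hD : Odd D) (hN : 0 < N) (hq : q ≠ 0)
    (hA : N * (U:ℝ) ^ D = q * a) (hB : N * (V:ℝ) ^ D = q * b)
    (hU : U ≠ 0) (hUV : U ≠ V) (hε : ε < 1) (h : |a - b| ≤ ε * |a|) :
    (D:ℝ) * (1 - ε) ≤ ε * |(U:ℝ)| := by
  have h : |N * (U:ℝ) ^ D - N * (V:ℝ) ^ D| ≤ ε * |N * (U:ℝ) ^ D| := by
    rw [hA, hB, ← mul_sub, abs_mul, abs_mul]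
    have : 0 < |q| := abs_pos.2 hq
    nlinarith
  have key : ∀ U V : ℤ, 0 < U → U ≠ V → 
      |N * (U:ℝ) ^ D - N * (V:ℝ) ^ D| ≤ ε * |N * (U:ℝ) ^ D| → (D:ℝ) * (1 - ε) ≤ ε * |(U:ℝ)| := by
    intro U V hU hUV h
    have hUr : (0:ℝ) < U := by exact_mod_cast hU
    have hNU : 0 < N * (U:ℝ) ^ D := by positivity
    rw [abs_of_pos hNU] at h
    have hV : 0 < V := by
      by_contra hneg
      have hV' : (V:ℝ) ≤ 0 := by exact_mod_cast (not_lt.1 hneg)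
      have : (V:ℝ) ^ D ≤ 0 := hD.pow_nonpos hV'
      have h2 := (abs_le.1 h).2
      nlinarith
    lift U to ℕ using hU.le
    lift V to ℕ using hV.le
    rw [abs_of_pos hUr]
    simp only [Int.cast_natCast] at h ⊢
    exact close_nat_strong U V D N ε hD.pos hN (by exact_mod_cast hU) (by exact_mod_cast hUV) hε h
  rcases lt_or_gt_of_ne hU with h0 | h0
  · have := key (-U) (-V) (by omega) (by omega) (by
      push_cast
      rw [hD.neg_pow, hD.neg_pow, mul_neg, mul_neg, abs_neg,
        show -(N * (U:ℝ) ^ D) - -(N * (V:ℝ) ^ D) = -(N * (U:ℝ) ^ D - N * (V:ℝ) ^ D) by ring, abs_neg]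
      exact h)
    push_cast at this
    rwa [abs_neg] at this
  · exact key U V h0 hUV h
end

section
/-- (both types) P dominant -/
theorem a3_Pdom (P Q c g2 g4 : ℤ) (C : ℝ) (D : ℕ) (hD : Odd D) (hD35 : 35 ≤ D)
    (hC : C = |(c:ℝ)|) (hC15 : 15 ≤ C)
    (hf2 : P ^ 2 + 2 * P * Q + 4 * Q ^ 2 = 3 * g2 ^ D) (hf4 : P ^ 2 - P * Q + Q ^ 2 = 3 * g4 ^ D)
    (hQ : Q ≠ 0) (hPQ : P + Q ≠ 0)
    (hdom : 3 * C ^ 5 * (Q:ℝ) ^ 6 ≤ 8 * (P:ℝ) ^ 6)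
    (heq : (P ^ 3 - 8 * Q ^ 3) * (P ^ 3 + Q ^ 3) ^ 2 = 27 * c ^ D ∨
      (P ^ 3 - 8 * Q ^ 3) ^ 2 * (P ^ 3 + Q ^ 3) = 27 * c ^ D) : False := by
  have hc0 : (0:ℝ) < C := by linarith
  have hc5 : (15:ℝ) ^ 5 ≤ C ^ 5 := pow_le_pow_left₀ (by norm_num) hC15 5
  have hP : P ≠ 0 := by
    rintro rfl
    have h1 : (0:ℝ) < (Q:ℝ) ^ 6 := by positivity
    have : 0 < 3 * C ^ 5 * (Q:ℝ) ^ 6 := by positivity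
    norm_num at hdom; linarith
  have hPr : (P:ℝ) ≠ 0 := by exact_mod_cast hP
  set x : ℝ := Q / P with hx
  have hQx : (Q:ℝ) = P * x := by rw [hx]; field_simp
  have hP6 : (0:ℝ) < (P:ℝ) ^ 6 := by positivity
  have hd : 3 * C ^ 5 * x ^ 6 ≤ 8 := by
    rw [hQx, mul_pow] at hdom
    have : (P:ℝ) ^ 6 * (3 * C ^ 5 * x ^ 6) ≤ (P:ℝ) ^ 6 * 8 := by linarith
    exact le_of_mul_le_mul_left this hP6
  have hx6 : 0 ≤ x ^ 6 := by positivity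
  have hxs : |x| ≤ 1 / 8 := by
    apply abs_le_of_pow_le _ _ 6 (by norm_num) (by norm_num)
    rw [(by decide : Even 6).pow_abs]
    nlinarith
  have hx1 := abs_le.1 hxs
  have hxsq : x ^ 2 ≤ 1 / 64 := by nlinarith
  have hx3 : |x ^ 3| ≤ 1 / 512 := by
    rw [abs_pow]; calc |x| ^ 3 ≤ (1 / 8) ^ 3 := pow_le_pow_left₀ (abs_nonneg x) hxs 3
      _ = _ := by norm_num
  have hx3' := abs_le.1 hx3
  have hP8 : |(P:ℝ)| ^ 9 ≤ 30 * C ^ D := by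
    have hP8' : (0:ℝ) < |(P:ℝ)| ^ 9 := by positivity
    have a1 : (39:ℝ) / 40 ≤ 1 - 8 * x ^ 3 := by linarith
    have a2 : (99:ℝ) / 100 ≤ 1 + x ^ 3 := by linarith
    have key : (9:ℝ) / 10 ≤ (1 - 8 * x ^ 3) * (1 + x ^ 3) ^ 2 ∧ (9:ℝ) / 10 ≤ (1 - 8 * x ^ 3) ^ 2 * (1 + x ^ 3) := by
      constructor
      · calc (9:ℝ) / 10 ≤ 39 / 40 * (99 / 100) ^ 2 := by norm_num
          _ ≤ _ := by gcongr
      · calc (9:ℝ) / 10 ≤ (39 / 40) ^ 2 * (99 / 100) := by norm_num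
          _ ≤ _ := by gcongr
    have fin : ∀ k : ℝ, 9 / 10 ≤ k → (P:ℝ) ^ 9 * k = 27 * (c:ℝ) ^ D → |(P:ℝ)| ^ 9 ≤ 30 * C ^ D := by
      intro k hk h
      have h' := congrArg abs h
      rw [abs_mul, abs_mul, abs_pow, abs_pow, ← hC, abs_of_pos (by linarith : 0 < k)] at h'
      norm_num at h'
      nlinarith
    rcases heq with h | h
    · have h' : ((P:ℝ) ^ 3 - 8 * (Q:ℝ) ^ 3) * ((P:ℝ) ^ 3 + (Q:ℝ) ^ 3) ^ 2 = 27 * (c:ℝ) ^ D := by exact_mod_cast h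
      rw [hQx] at h'
      exact fin _ key.1 (by rw [← h']; ring)
    · have h' : ((P:ℝ) ^ 3 - 8 * (Q:ℝ) ^ 3) ^ 2 * ((P:ℝ) ^ 3 + (Q:ℝ) ^ 3) = 27 * (c:ℝ) ^ D := by exact_mod_cast h
      rw [hQx] at h'
      exact fin _ key.2 (by rw [← h']; ring)
  have hP2 : (0:ℝ) < (P:ℝ) ^ 2 := by positivity
  have hf2' : (3:ℝ) * (g2:ℝ) ^ D = (P:ℝ) ^ 2 * (1 + 2 * x + 4 * x ^ 2) := by
    have : (P:ℝ) ^ 2 + 2 * P * Q + 4 * Q ^ 2 = 3 * (g2:ℝ) ^ D := by exact_mod_cast hf2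
    rw [← this, hQx]; ring
  have hf4' : (3:ℝ) * (g4:ℝ) ^ D = (P:ℝ) ^ 2 * (1 - x + x ^ 2) := by
    have : (P:ℝ) ^ 2 - P * Q + Q ^ 2 = 3 * (g4:ℝ) ^ D := by exact_mod_cast hf4
    rw [← this, hQx]; ring
  have hne : g4 ≠ g2 := by
    rintro rfl
    have : 3 * Q * (P + Q) = 0 := by linear_combination hf2 - hf4
    have h3 : 3 * Q * (P + Q) ≠ 0 := by positivity
    exact h3 this
  have hax : 7 / 8 ≤ 1 - x + x ^ 2 := by nlinarith
  have hax' : 1 - x + x ^ 2 ≤ 3 := by nlinarith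
  have hg4 : g4 ≠ 0 := by
    rintro rfl
    rw [Int.cast_zero, zero_pow (by omega), mul_zero] at hf4'
    nlinarith
  have g := close_norm g4 g2 D 3 (4 * |x|) _ _ _ hD (by norm_num) hP2.ne' hf4' hf2' hg4 hne
    (by linarith) (by
      rw [show 1 - x + x ^ 2 - (1 + 2 * x + 4 * x ^ 2) = x * (-3 - 3 * x) by ring, abs_mul, abs_of_pos (by linarith : 0 < 1 - x + x ^ 2)]
      have : |(-3 - 3 * x)| ≤ 7 / 2 := by
        rw [abs_le]; constructor <;> linarith
      nlinarith [abs_nonneg x])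
  have hDr : (35:ℝ) ≤ D := by exact_mod_cast hD35
  have g1 : 1 ≤ |x| * |(g4:ℝ)| := by nlinarith
  have hW : |(g4:ℝ)| ^ 9 ≤ 2 * C ^ 2 := by
    apply root_bound D hD35 _ (30 ^ 2) _ (by norm_num) (by positivity)
    have e : (|(g4:ℝ)| ^ 9) ^ D = |(g4:ℝ) ^ D| ^ 9 := by rw [abs_pow, ← pow_mul, ← pow_mul, mul_comm]
    have e2 : (g4:ℝ) ^ D = P ^ 2 * ((1 - x + x ^ 2) / 3) := by linarith
    have e3 : (C ^ 2) ^ D = (C ^ D) ^ 2 := by rw [← pow_mul, ← pow_mul, mul_comm]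
    rw [e, e2, e3, abs_mul, mul_pow, ← mul_pow (30:ℝ), ← mul_one ((30 * C ^ D) ^ 2)]
    have h2 : (|(P:ℝ)| ^ 9) ^ 2 ≤ (30 * C ^ D) ^ 2 := pow_le_pow_left₀ (by positivity) hP8 2
    apply mul_le_mul
    · rw [abs_pow, ← pow_mul]; rw [← pow_mul] at h2; exact h2
    · apply pow_le_one₀ (abs_nonneg _)
      rw [abs_le]; constructor <;> linarith
    · positivity
    · positivity
  have g2 : 1 ≤ (|x| * |(g4:ℝ)|) ^ 18 := one_le_pow₀ g1
  have g3 : (|x| * |(g4:ℝ)|) ^ 18 = (x ^ 6) ^ 3 * (|(g4:ℝ)| ^ 9) ^ 2 := by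
    rw [mul_pow, (by decide : Even 18).pow_abs]; ring
  have g4' : (3 * C ^ 5 * x ^ 6) ^ 3 ≤ 8 ^ 3 := pow_le_pow_left₀ (by positivity) hd 3
  have g5 : (|(g4:ℝ)| ^ 9) ^ 2 ≤ (2 * C ^ 2) ^ 2 := pow_le_pow_left₀ (by positivity) hW 2
  have g6 : (3 * C ^ 5) ^ 3 ≤ 8 ^ 3 * (2 * C ^ 2) ^ 2 := by
    calc (3 * C ^ 5) ^ 3 ≤ (3 * C ^ 5) ^ 3 * ((x ^ 6) ^ 3 * (|(g4:ℝ)| ^ 9) ^ 2) := by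
          rw [← g3]; exact le_mul_of_one_le_right (by positivity) g2
      _ = (3 * C ^ 5 * x ^ 6) ^ 3 * (|(g4:ℝ)| ^ 9) ^ 2 := by ring
      _ ≤ _ := by gcongr
  have g7 : C ^ 4 * (27 * C ^ 11) ≤ C ^ 4 * 2048 := by linarith [g6, show (3 * C ^ 5) ^ 3 = C ^ 4 * (27 * C ^ 11) by ring, show 8 ^ 3 * (2 * C ^ 2) ^ 2 = C ^ 4 * 2048 by ring]
  have g8 := le_of_mul_le_mul_left g7 (by positivity)
  have g9 : (15:ℝ) ^ 11 ≤ C ^ 11 := pow_le_pow_left₀ (by norm_num) hC15 11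
  linarith
end

section
theorem a3_Ubound (U : ℤ) (D k : ℕ) (Q N a C : ℝ) (hD35 : 35 ≤ D) (hk : k ≤ 17) (hN : 0 < N) (hC : 0 ≤ C)
    (hU : N * (U:ℝ) ^ D = Q ^ (3 * k) * a) (ha : |a| ≤ N) (hQ9 : |Q| ^ 9 ≤ 4 * C ^ D) :
    |(U:ℝ)| ^ 3 ≤ 2 * C ^ k := by
  apply root_bound D hD35 _ (4 ^ k) _ ?_ (by positivity)
  · have e : (|(U:ℝ)| ^ 3) ^ D = |(U:ℝ) ^ D| ^ 3 := by rw [abs_pow, ← pow_mul, ← pow_mul, mul_comm]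
    have e2 : (U:ℝ) ^ D = Q ^ (3 * k) * (a / N) := by field_simp; linarith
    have e3 : (C ^ k) ^ D = (C ^ D) ^ k := by rw [← pow_mul, ← pow_mul, mul_comm]
    rw [e, e2, e3, abs_mul, mul_pow, ← mul_pow (4:ℝ), ← mul_one ((4 * C ^ D) ^ k)]
    have h2 : (|Q| ^ 9) ^ k ≤ (4 * C ^ D) ^ k := pow_le_pow_left₀ (by positivity) hQ9 k
    apply mul_le_mul
    · rw [abs_pow, ← pow_mul]; rw [← pow_mul] at h2; rw [show 3 * k * 3 = 9 * k by ring]; exact h2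
    · apply pow_le_one₀ (abs_nonneg _)
      rw [abs_div, abs_of_pos hN, div_le_one hN]; exact ha
    · positivity
    · positivity
  · calc (4:ℝ) ^ k ≤ 4 ^ 17 := pow_le_pow_right₀ (by norm_num) hk
      _ ≤ 2 ^ 35 := by norm_num

theorem a3_fin12 (x U C : ℝ) (hU : 0 ≤ U) (hC : 15 ≤ C) (hd : 3 * C ^ 5 * |x| ^ 3 ≤ 8)
    (g : 1 ≤ |x| * U) (hW : U ^ 3 ≤ 2 * C ^ 4) : False := by
  have hC0 : 0 < C := by linarith
  have g2 : 1 ≤ (|x| * U) ^ 3 := one_le_pow₀ g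
  have g6 : 3 * C ^ 5 ≤ 8 * (2 * C ^ 4) := by
    calc 3 * C ^ 5 ≤ 3 * C ^ 5 * (|x| * U) ^ 3 := le_mul_of_one_le_right (by positivity) g2
      _ = (3 * C ^ 5 * |x| ^ 3) * U ^ 3 := by ring
      _ ≤ _ := by gcongr
  have g7 : C ^ 4 * (3 * C) ≤ C ^ 4 * 16 := by linarith
  have g8 := le_of_mul_le_mul_left g7 (by positivity)
  linarith

theorem a3_fin21 (x U C : ℝ) (hU : 0 ≤ U) (hC : 75 ≤ C) (hd : 3 * C ^ 5 * x ^ 6 ≤ 512)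
    (g : 2 ≤ |x| * U) (hW : U ^ 3 ≤ 2 * C ^ 2) : False := by
  have hC0 : 0 < C := by linarith
  have g2 : 2 ^ 6 ≤ (|x| * U) ^ 6 := pow_le_pow_left₀ (by norm_num) g 6
  have g5 : (U ^ 3) ^ 2 ≤ (2 * C ^ 2) ^ 2 := pow_le_pow_left₀ (by positivity) hW 2
  have g6 : 3 * C ^ 5 * 2 ^ 6 ≤ 512 * (2 * C ^ 2) ^ 2 := by
    calc 3 * C ^ 5 * 2 ^ 6 ≤ 3 * C ^ 5 * (|x| * U) ^ 6 := by gcongr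
      _ = (3 * C ^ 5 * x ^ 6) * (U ^ 3) ^ 2 := by rw [mul_pow, (by decide : Even 6).pow_abs]; ring
      _ ≤ _ := by gcongr
  have g7 : C ^ 4 * (192 * C) ≤ C ^ 4 * 2048 := by linarith
  have g8 := le_of_mul_le_mul_left g7 (by positivity)
  linarith

theorem a3_setup12 (P Q c : ℤ) (C : ℝ) (D : ℕ) (hC : C = |(c:ℝ)|) (hC15 : 15 ≤ C) (hQ : Q ≠ 0)
    (hdom : 3 * C ^ 5 * |(P:ℝ)| ^ 3 ≤ 8 * |(Q:ℝ)| ^ 3)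
    (heq : (P ^ 3 - 8 * Q ^ 3) * (P ^ 3 + Q ^ 3) ^ 2 = 27 * c ^ D) :
    ∃ x : ℝ, (P:ℝ) = Q * x ∧ 3 * C ^ 5 * |x| ^ 3 ≤ 8 ∧ |x| ≤ 1 / 65 ∧ |(Q:ℝ)| ^ 9 ≤ 4 * C ^ D := by
  have hQr : (Q:ℝ) ≠ 0 := by exact_mod_cast hQ
  have hc5 : (15:ℝ) ^ 5 ≤ C ^ 5 := pow_le_pow_left₀ (by norm_num) hC15 5
  obtain ⟨x, hx⟩ : ∃ x : ℝ, (P:ℝ) = Q * x := ⟨P / Q, by field_simp⟩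
  have hQ3 : 0 < |(Q:ℝ)| ^ 3 := by positivity
  have hd : 3 * C ^ 5 * |x| ^ 3 ≤ 8 := by
    rw [hx, abs_mul, mul_pow] at hdom
    have : |(Q:ℝ)| ^ 3 * (3 * C ^ 5 * |x| ^ 3) ≤ |(Q:ℝ)| ^ 3 * 8 := by linarith
    exact le_of_mul_le_mul_left this hQ3
  have hx3p : 0 ≤ |x| ^ 3 := by positivity
  have hxs : |x| ≤ 1 / 65 := by
    apply abs_le_of_pow_le _ _ 3 (by norm_num) (by norm_num)
    nlinarith
  refine ⟨x, hx, hd, hxs, ?_⟩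
  have hx3 : |x ^ 3| ≤ 1 / 1000 := by
    rw [abs_pow]; calc |x| ^ 3 ≤ (1 / 65) ^ 3 := pow_le_pow_left₀ (abs_nonneg x) hxs 3
      _ ≤ _ := by norm_num
  have hx3' := abs_le.1 hx3
  have key : (27:ℝ) / 4 ≤ (8 - x ^ 3) * (1 + x ^ 3) ^ 2 := by
    calc (27:ℝ) / 4 ≤ (7) * (99 / 100) ^ 2 := by norm_num
          _ ≤ _ := by gcongr <;> linarith
  have h' : ((P:ℝ) ^ 3 - 8 * (Q:ℝ) ^ 3) * ((P:ℝ) ^ 3 + (Q:ℝ) ^ 3) ^ 2 = 27 * (c:ℝ) ^ D := by exact_mod_cast heq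
  rw [hx] at h'
  have h2 : (Q:ℝ) ^ 9 * ((8 - x ^ 3) * (1 + x ^ 3) ^ 2) = - (27 * (c:ℝ) ^ D) := by rw [← h']; ring
  have h3 := congrArg abs h2
  rw [abs_neg, abs_mul, abs_of_pos (by linarith : 0 < (8 - x ^ 3) * (1 + x ^ 3) ^ 2), abs_mul, abs_pow, abs_pow, ← hC] at h3
  norm_num at h3
  have : 0 ≤ |(Q:ℝ)| ^ 9 := by positivity
  nlinarith

theorem a3_setup21 (P Q c : ℤ) (C : ℝ) (D : ℕ) (hC : C = |(c:ℝ)|) (hC75 : 75 ≤ C) (hQ : Q ≠ 0)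
    (hdom : 3 * C ^ 5 * (P:ℝ) ^ 6 ≤ 512 * (Q:ℝ) ^ 6)
    (heq : (P ^ 3 - 8 * Q ^ 3) ^ 2 * (P ^ 3 + Q ^ 3) = 27 * c ^ D) :
    ∃ x : ℝ, (P:ℝ) = Q * x ∧ 3 * C ^ 5 * x ^ 6 ≤ 512 ∧ |x| ≤ 13 / 200 ∧ |(Q:ℝ)| ^ 9 ≤ 4 * C ^ D := by
  have hQr : (Q:ℝ) ≠ 0 := by exact_mod_cast hQ
  have hc5 : (75:ℝ) ^ 5 ≤ C ^ 5 := pow_le_pow_left₀ (by norm_num) hC75 5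
  obtain ⟨x, hx⟩ : ∃ x : ℝ, (P:ℝ) = Q * x := ⟨P / Q, by field_simp⟩
  have hQ3 : 0 < (Q:ℝ) ^ 6 := by positivity
  have hd : 3 * C ^ 5 * x ^ 6 ≤ 512 := by
    rw [hx, mul_pow] at hdom
    have : (Q:ℝ) ^ 6 * (3 * C ^ 5 * x ^ 6) ≤ (Q:ℝ) ^ 6 * 512 := by linarith
    exact le_of_mul_le_mul_left this hQ3
  have hx3p : 0 ≤ x ^ 6 := by positivity
  have hxs : |x| ≤ 13 / 200 := by
    apply abs_le_of_pow_le _ _ 6 (by norm_num) (by norm_num)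
    rw [(by decide : Even 6).pow_abs]
    nlinarith
  refine ⟨x, hx, hd, hxs, ?_⟩
  have hx3 : |x ^ 3| ≤ 1 / 1000 := by
    rw [abs_pow]; calc |x| ^ 3 ≤ (13 / 200) ^ 3 := pow_le_pow_left₀ (abs_nonneg x) hxs 3
      _ ≤ _ := by norm_num
  have hx3' := abs_le.1 hx3
  have key : (27:ℝ) ≤ (8 - x ^ 3) ^ 2 * (1 + x ^ 3) := by
    calc (27:ℝ) ≤ (7) ^ 2 * (99 / 100) := by norm_num
          _ ≤ _ := by gcongr <;> linarith
  have h' : ((P:ℝ) ^ 3 - 8 * (Q:ℝ) ^ 3) ^ 2 * ((P:ℝ) ^ 3 + (Q:ℝ) ^ 3) = 27 * (c:ℝ) ^ D := by exact_mod_cast heq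
  rw [hx] at h'
  have h2 : (Q:ℝ) ^ 9 * ((8 - x ^ 3) ^ 2 * (1 + x ^ 3)) = (27 * (c:ℝ) ^ D) := by rw [← h']; ring
  have h3 := congrArg abs h2
  rw [abs_mul, abs_of_pos (by linarith : 0 < (8 - x ^ 3) ^ 2 * (1 + x ^ 3)), abs_mul, abs_pow, abs_pow, ← hC] at h3
  norm_num at h3
  have : 0 ≤ |(Q:ℝ)| ^ 9 := by positivity
  nlinarith

theorem a3_Q12nat (P Q c U V : ℤ) (C : ℝ) (D : ℕ) (hD : Odd D) (hD35 : 35 ≤ D)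
    (hfU : (P ^ 2 + 2 * P * Q + 4 * Q ^ 2) * (P ^ 2 - P * Q + Q ^ 2) ^ 5 = 3 ^ 6 * U ^ D)
    (hfV : (P - 2 * Q) ^ 2 * (P + Q) ^ 10 = 3 ^ 6 * V ^ D) (hUV : U ≠ V)
    (hC : C = |(c:ℝ)|) (hC15 : 15 ≤ C) (hQ : Q ≠ 0)
    (hdom : 3 * C ^ 5 * |(P:ℝ)| ^ 3 ≤ 8 * |(Q:ℝ)| ^ 3)
    (heq : (P ^ 3 - 8 * Q ^ 3) * (P ^ 3 + Q ^ 3) ^ 2 = 27 * c ^ D) : False := by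
  obtain ⟨x, hx, hd, hxs, hQ9⟩ := a3_setup12 P Q c C D hC hC15 hQ hdom heq
  have hQr : (Q:ℝ) ≠ 0 := by exact_mod_cast hQ
  have hx1 := abs_le.1 hxs
  have hU' : (3 ^ 6 : ℝ) * (U:ℝ) ^ D = (Q:ℝ) ^ (3 * 4) * ((4 + 2 * x + x ^ 2) * (1 - x + x ^ 2) ^ 5) := by
    have : ((P:ℝ) ^ 2 + 2 * P * Q + 4 * Q ^ 2) * (P ^ 2 - P * Q + Q ^ 2) ^ 5 = 3 ^ 6 * (U:ℝ) ^ D := by exact_mod_cast hfU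
    rw [← this, hx]; ring
  have hV' : (3 ^ 6 : ℝ) * (V:ℝ) ^ D = (Q:ℝ) ^ (3 * 4) * ((x - 2) ^ 2 * (x + 1) ^ 10) := by
    have : ((P:ℝ) - 2 * Q) ^ 2 * (P + Q) ^ 10 = 3 ^ 6 * (V:ℝ) ^ D := by exact_mod_cast hfV
    rw [← this, hx]; ring
  have hb0 : 63 / 64 ≤ 1 - x + x ^ 2 := by nlinarith
  have hb0' : 1 - x + x ^ 2 ≤ 65 / 64 := by nlinarith
  have hb1 : (9:ℝ) / 10 ≤ (1 - x + x ^ 2) ^ 5 := by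
    calc (9:ℝ) / 10 ≤ (63 / 64) ^ 5 := by norm_num
      _ ≤ _ := by gcongr
  have hb2 : (1 - x + x ^ 2) ^ 5 ≤ 11 / 10 := by
    calc (1 - x + x ^ 2) ^ 5 ≤ (65 / 64) ^ 5 := by gcongr; 
      _ ≤ _ := by norm_num
  have ha1 : (7:ℝ) / 2 ≤ (4 + 2 * x + x ^ 2) * (1 - x + x ^ 2) ^ 5 := by nlinarith
  have ha2 : (4 + 2 * x + x ^ 2) * (1 - x + x ^ 2) ^ 5 ≤ 5 := by nlinarith
  have hU0 : U ≠ 0 := by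
    rintro rfl
    rw [Int.cast_zero, zero_pow (by omega), mul_zero] at hU'
    have : 0 < (Q:ℝ) ^ (3 * 4) := (by decide : Even (3 * 4)).pow_pos hQr
    nlinarith
  have habs : |(4 + 2 * x + x ^ 2) * (1 - x + x ^ 2) ^ 5| = (4 + 2 * x + x ^ 2) * (1 - x + x ^ 2) ^ 5 := abs_of_pos (by linarith)
  have hk : ∀ t k T : ℝ, |t| ≤ T → |k + x * t| ≤ |k| + T / 65 := by
    intro t k T h
    refine (abs_add_le _ _).trans ?_
    rw [abs_mul]
    have := mul_le_mul hxs h (abs_nonneg _) (by norm_num)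
    linarith
  have hp : |(-54 + x * (-90 + x * (-405 + x * (-270 + x * (-432 + x * (81 + x * (27 + x * (135 + x * (0 + x * (0 + x * (-9)))))))))))| ≤ 56 := by
    refine (hk _ _ _ (hk _ _ _ (hk _ _ _ (hk _ _ _ (hk _ _ _ (hk _ _ _ (hk _ _ _ (hk _ _ _ (hk _ _ _ (hk _ _ _ le_rfl)))))))))).trans ?_
    norm_num [abs_of_pos, abs_of_neg]
  have g := close_strong U V D (3 ^ 6) (16 * |x|) _ _ _ hD (by norm_num) (by positivity) hU' hV' hU0 hUV
    (by linarith) (by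
      rw [show (4 + 2 * x + x ^ 2) * (1 - x + x ^ 2) ^ 5 - (x - 2) ^ 2 * (x + 1) ^ 10 = x * (-54 + x * (-90 + x * (-405 + x * (-270 + x * (-432 + x * (81 + x * (27 + x * (135 + x * (0 + x * (0 + x * (-9)))))))))))
         by ring, abs_mul, habs]
      nlinarith [abs_nonneg x])
  have hDr : (35:ℝ) ≤ D := by exact_mod_cast hD35
  have g1 : 1 ≤ |x| * |(U:ℝ)| := by nlinarith
  refine a3_fin12 x |(U:ℝ)| C (abs_nonneg _) hC15 hd g1 ?_
  exact a3_Ubound U D 4 Q _ _ C hD35 (by norm_num) (by norm_num) (by linarith) hU' (by rw [habs]; linarith) hQ9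

theorem a3_Q12un (P Q c U V : ℤ) (C : ℝ) (D : ℕ) (hD : Odd D) (hD35 : 35 ≤ D)
    (hfU : (P ^ 2 + 2 * P * Q + 4 * Q ^ 2) ^ 2 * (P ^ 2 - P * Q + Q ^ 2) = 27 * U ^ D)
    (hfV : (P - 2 * Q) ^ 4 * (P + Q) ^ 2 = 27 * V ^ D) (hUV : U ≠ V)
    (hC : C = |(c:ℝ)|) (hC15 : 15 ≤ C) (hQ : Q ≠ 0)
    (hdom : 3 * C ^ 5 * |(P:ℝ)| ^ 3 ≤ 8 * |(Q:ℝ)| ^ 3)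
    (heq : (P ^ 3 - 8 * Q ^ 3) * (P ^ 3 + Q ^ 3) ^ 2 = 27 * c ^ D) : False := by
  obtain ⟨x, hx, hd, hxs, hQ9⟩ := a3_setup12 P Q c C D hC hC15 hQ hdom heq
  have hQr : (Q:ℝ) ≠ 0 := by exact_mod_cast hQ
  have hx1 := abs_le.1 hxs
  have hU' : (27 : ℝ) * (U:ℝ) ^ D = (Q:ℝ) ^ (3 * 2) * ((4 + 2 * x + x ^ 2) ^ 2 * (1 - x + x ^ 2)) := by
    have : ((P:ℝ) ^ 2 + 2 * P * Q + 4 * Q ^ 2) ^ 2 * (P ^ 2 - P * Q + Q ^ 2) = 27 * (U:ℝ) ^ D := by exact_mod_cast hfU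
    rw [← this, hx]; ring
  have hV' : (27 : ℝ) * (V:ℝ) ^ D = (Q:ℝ) ^ (3 * 2) * ((x - 2) ^ 4 * (x + 1) ^ 2) := by
    have : ((P:ℝ) - 2 * Q) ^ 4 * (P + Q) ^ 2 = 27 * (V:ℝ) ^ D := by exact_mod_cast hfV
    rw [← this, hx]; ring
  have hb0 : 63 / 64 ≤ 1 - x + x ^ 2 := by nlinarith
  have hb0' : 1 - x + x ^ 2 ≤ 65 / 64 := by nlinarith
  have hb1 : (15:ℝ) ≤ (4 + 2 * x + x ^ 2) ^ 2 := by nlinarith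
  have hb2 : (4 + 2 * x + x ^ 2) ^ 2 ≤ 17 := by
    have : 4 + 2 * x + x ^ 2 ≤ 65 / 16 := by nlinarith
    have : 0 ≤ 4 + 2 * x + x ^ 2 := by nlinarith
    nlinarith
  have ha1 : (14:ℝ) ≤ (4 + 2 * x + x ^ 2) ^ 2 * (1 - x + x ^ 2) := by nlinarith
  have ha2 : (4 + 2 * x + x ^ 2) ^ 2 * (1 - x + x ^ 2) ≤ 18 := by nlinarith
  have hU0 : U ≠ 0 := by
    rintro rfl
    rw [Int.cast_zero, zero_pow (by omega), mul_zero] at hU'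
    have : 0 < (Q:ℝ) ^ (3 * 2) := (by decide : Even (3 * 2)).pow_pos hQr
    nlinarith
  have habs : |(4 + 2 * x + x ^ 2) ^ 2 * (1 - x + x ^ 2)| = (4 + 2 * x + x ^ 2) ^ 2 * (1 - x + x ^ 2) := abs_of_pos (by linarith)
  have hk : ∀ t k T : ℝ, |t| ≤ T → |k + x * t| ≤ |k| + T / 65 := by
    intro t k T h
    refine (abs_add_le _ _).trans ?_
    rw [abs_mul]
    have := mul_le_mul hxs h (abs_nonneg _) (by norm_num)
    linarith
  have hp : |(0 + x * (36 + x * (0 + x * (0 + x * 9))))| ≤ 2 := by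
    refine (hk _ _ _ (hk _ _ _ (hk _ _ _ (hk _ _ _ le_rfl)))).trans ?_
    norm_num [abs_of_pos, abs_of_neg]
  have g := close_norm U V D 27 (1 * |x|) _ _ _ hD (by norm_num) (by positivity) hU' hV' hU0 hUV
    (by linarith) (by
      rw [show (4 + 2 * x + x ^ 2) ^ 2 * (1 - x + x ^ 2) - (x - 2) ^ 4 * (x + 1) ^ 2 = x * (0 + x * (36 + x * (0 + x * (0 + x * 9))))
         by ring, abs_mul, habs]
      nlinarith [abs_nonneg x])
  have hDr : (35:ℝ) ≤ D := by exact_mod_cast hD35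
  have g1 : 1 ≤ |x| * |(U:ℝ)| := by nlinarith
  refine a3_fin12 x |(U:ℝ)| C (abs_nonneg _) hC15 hd g1 ?_
  have := a3_Ubound U D 2 Q _ _ C hD35 (by norm_num) (by norm_num) (by linarith) hU' (by rw [habs]; linarith) hQ9
  have h4 : C ^ 2 ≤ C ^ 4 := pow_le_pow_right₀ (by linarith) (by norm_num)
  linarith

theorem a3_Q21un (P Q c U V : ℤ) (C : ℝ) (D : ℕ) (hD : Odd D) (hD35 : 35 ≤ D)
    (hfU : (P ^ 2 + 2 * P * Q + 4 * Q ^ 2) * (P ^ 2 - P * Q + Q ^ 2) ^ 2 = 27 * U ^ D)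
    (hfV : (P - 2 * Q) ^ 2 * (P + Q) ^ 4 = 27 * V ^ D) (hUV : U ≠ V)
    (hC : C = |(c:ℝ)|) (hC75 : 75 ≤ C) (hQ : Q ≠ 0)
    (hdom : 3 * C ^ 5 * (P:ℝ) ^ 6 ≤ 512 * (Q:ℝ) ^ 6)
    (heq : (P ^ 3 - 8 * Q ^ 3) ^ 2 * (P ^ 3 + Q ^ 3) = 27 * c ^ D) : False := by
  obtain ⟨x, hx, hd, hxs, hQ9⟩ := a3_setup21 P Q c C D hC hC75 hQ hdom heq
  have hQr : (Q:ℝ) ≠ 0 := by exact_mod_cast hQ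
  have hx1 := abs_le.1 hxs
  have hU' : (27 : ℝ) * (U:ℝ) ^ D = (Q:ℝ) ^ (3 * 2) * ((4 + 2 * x + x ^ 2) * (1 - x + x ^ 2) ^ 2) := by
    have : ((P:ℝ) ^ 2 + 2 * P * Q + 4 * Q ^ 2) * (P ^ 2 - P * Q + Q ^ 2) ^ 2 = 27 * (U:ℝ) ^ D := by exact_mod_cast hfU
    rw [← this, hx]; ring
  have hV' : (27 : ℝ) * (V:ℝ) ^ D = (Q:ℝ) ^ (3 * 2) * ((x - 2) ^ 2 * (x + 1) ^ 4) := by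
    have : ((P:ℝ) - 2 * Q) ^ 2 * (P + Q) ^ 4 = 27 * (V:ℝ) ^ D := by exact_mod_cast hfV
    rw [← this, hx]; ring
  have ha1 : (7:ℝ) / 2 ≤ (4 + 2 * x + x ^ 2) * (1 - x + x ^ 2) ^ 2 := by
    have h1 : (187:ℝ) / 200 ≤ 1 - x + x ^ 2 := by nlinarith
    have h2 : (4 + 2 * x + x ^ 2) * (1 - x + x ^ 2) ^ 2 = ((4 + 2 * x + x ^ 2) * (1 - x + x ^ 2)) * (1 - x + x ^ 2) := by ring
    have h3 : (4 + 2 * x + x ^ 2) * (1 - x + x ^ 2) = 4 - 2 * x + 3 * x ^ 2 + x ^ 3 * (1 + x) := by ring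
    have h4 : -(1 / 100) ≤ x ^ 3 * (1 + x) := by nlinarith
    have h5 : 4 - 2 * x - 1 / 100 ≤ (4 + 2 * x + x ^ 2) * (1 - x + x ^ 2) := by rw [h3]; nlinarith
    rw [h2]
    nlinarith
  have ha2 : (4 + 2 * x + x ^ 2) * (1 - x + x ^ 2) ^ 2 ≤ 5 := by
    have h1 : 1 - x + x ^ 2 ≤ 1 - x + 1 / 200 := by nlinarith
    have h1' : (0:ℝ) ≤ 1 - x + x ^ 2 := by nlinarith
    have h2 : (4 + 2 * x + x ^ 2) * (1 - x + x ^ 2) ^ 2 = ((4 + 2 * x + x ^ 2) * (1 - x + x ^ 2)) * (1 - x + x ^ 2) := by ring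
    have h5 : (4 + 2 * x + x ^ 2) * (1 - x + x ^ 2) ≤ 9 / 2 := by nlinarith
    rw [h2]
    calc _ ≤ (9 / 2) * (1 - x + x ^ 2) := by gcongr
      _ ≤ _ := by linarith
  have hU0 : U ≠ 0 := by
    rintro rfl
    rw [Int.cast_zero, zero_pow (by omega), mul_zero] at hU'
    have : 0 < (Q:ℝ) ^ (3 * 2) := (by decide : Even (3 * 2)).pow_pos hQr
    nlinarith
  have habs : |(4 + 2 * x + x ^ 2) * (1 - x + x ^ 2) ^ 2| = (4 + 2 * x + x ^ 2) * (1 - x + x ^ 2) ^ 2 := abs_of_pos (by linarith)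
  have hk : ∀ t k T : ℝ, |t| ≤ T → |k + x * t| ≤ |k| + T / 10 := by
    intro t k T h
    refine (abs_add_le _ _).trans ?_
    rw [abs_mul]
    have h1 := mul_le_mul hxs h (abs_nonneg _) (by norm_num)
    have h2 := (abs_nonneg t).trans h
    linarith
  have hp : |(-18 + x * (0 + x * (0 + x * 9)))| ≤ 19 := by
    refine (hk _ _ _ (hk _ _ _ (hk _ _ _ le_rfl))).trans ?_
    norm_num [abs_of_pos, abs_of_neg]
  have g := close_strong U V D 27 (6 * |x|) _ _ _ hD (by norm_num) (by positivity) hU' hV' hU0 hUV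
    (by linarith) (by
      rw [show (4 + 2 * x + x ^ 2) * (1 - x + x ^ 2) ^ 2 - (x - 2) ^ 2 * (x + 1) ^ 4 = x * (-18 + x * (0 + x * (0 + x * 9)))
         by ring, abs_mul, habs]
      nlinarith [abs_nonneg x])
  have hDr : (35:ℝ) ≤ D := by exact_mod_cast hD35
  have g1 : 2 ≤ |x| * |(U:ℝ)| := by nlinarith
  refine a3_fin21 x |(U:ℝ)| C (abs_nonneg _) hC75 hd g1 ?_
  exact a3_Ubound U D 2 Q _ _ C hD35 (by norm_num) (by norm_num) (by linarith) hU' (by rw [habs]; linarith) hQ9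
end

section
theorem nat_is_cube (n : ℕ) (hn : n ≠ 0) (h : ∀ p : ℕ, p.Prime → 3 ∣ padicValNat p n) : ∃ j : ℕ, n = j ^ 3 := by
  refine ⟨n.factorization.prod fun p k => p ^ (k / 3), ?_⟩
  conv_lhs => rw [← Nat.prod_factorization_pow_eq_self hn]
  rw [Finsupp.prod, Finsupp.prod, ← Finset.prod_pow]
  apply Finset.prod_congr rfl
  intro p hp
  have hp' : p.Prime := Nat.prime_of_mem_primeFactors hp
  rw [← pow_mul, Nat.factorization_def _ hp', Nat.div_mul_cancel (h p hp')]

theorem int_is_cube (n : ℤ) (hn : n ≠ 0) (h : ∀ p : ℕ, p.Prime → 3 ∣ padicValInt p n) : ∃ j : ℤ, n = j ^ 3 := by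
  obtain ⟨j, hj⟩ := nat_is_cube n.natAbs (by simpa using hn) h
  rcases Int.natAbs_eq n with h1 | h1
  · exact ⟨j, by rw [h1, hj]; push_cast; rfl⟩
  · exact ⟨-j, by rw [h1, hj]; push_cast; ring⟩

theorem a3_trouble (P Q c g1 g2 h g4 : ℤ) (C : ℝ) (D : ℕ) (hD : Odd D) (hD35 : 35 ≤ D)
    (hf1 : P - 2 * Q = 3 * g1 ^ D) (hf2 : P ^ 2 + 2 * P * Q + 4 * Q ^ 2 = 3 * g2 ^ D)
    (hf3 : 9 * (P + Q) = h ^ D) (hf4 : P ^ 2 - P * Q + Q ^ 2 = 3 * g4 ^ D)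
    (hcf : c = g1 ^ 2 * g2 ^ 2 * h * g4) (hco : IsCoprime (g1 * g2) (h * g4))
    (hc3 : c ≠ 0) (hPo : Odd P) (hPQ : IsCoprime P Q) (h3P : ¬ (3:ℤ) ∣ P)
    (hB : ∀ p : ℕ, p.Prime → p ≠ 2 → p ≠ 3 → ¬ 3 ∣ padicValInt p c → (p:ℤ) ∣ P + Q)
    (hC : C = |(c:ℝ)|) (hC75 : 75 ≤ C) (hQ : Q ≠ 0)
    (hdom : 3 * C ^ 5 * (P:ℝ) ^ 6 ≤ 512 * (Q:ℝ) ^ 6)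
    (heq : (P ^ 3 - 8 * Q ^ 3) ^ 2 * (P ^ 3 + Q ^ 3) = 27 * c ^ D) : False := by
  have hD0 : D ≠ 0 := by omega
  have hprod : (g1 * g2) ^ D * 9 = P ^ 3 - 8 * Q ^ 3 := by
    rw [mul_pow]
    linear_combination (-1) * (P ^ 2 + 2 * P * Q + 4 * Q ^ 2) * hf1 - 3 * g1 ^ D * hf2
  have hprod2 : 3 * (P ^ 3 + Q ^ 3) = (h * g4) ^ D := by
    have : 27 * (P ^ 3 + Q ^ 3) = 9 * (h * g4) ^ D := by
      rw [mul_pow]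
      linear_combination 3 * (P ^ 2 - P * Q + Q ^ 2) * hf3 + 3 * h ^ D * hf4
    linarith
  have h0 : g1 * g2 ≠ 0 := by
    intro h0
    apply hc3; rw [hcf, show g1 ^ 2 * g2 ^ 2 * h * g4 = (g1 * g2) * (g1 * g2 * h * g4) by ring, h0, zero_mul]
  have h0' : h * g4 ≠ 0 := by
    intro h0
    apply hc3; rw [hcf, show g1 ^ 2 * g2 ^ 2 * h * g4 = g1 ^ 2 * g2 ^ 2 * (h * g4) by ring, h0, mul_zero]
  have h3h : (3:ℤ) ∣ h := Int.prime_three.dvd_of_dvd_pow (n := D) ⟨3 * (P + Q), by linarith⟩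
  have hodd : Odd ((g1 * g2) ^ D * 9) := by
    rw [hprod]
    exact (hPo.pow).sub_even ⟨4 * Q ^ 3, by ring⟩
  have hoddg : ¬ (2:ℤ) ∣ g1 * g2 := by
    intro h2
    rw [← Int.not_even_iff_odd] at hodd
    exact hodd (((even_iff_two_dvd.2 h2).pow_of_ne_zero hD0).mul_right 9)
  obtain ⟨j, hj⟩ := int_is_cube (g1 * g2) h0 (by
    intro p hp
    by_contra hv
    have := Fact.mk hp
    have hpd : (p:ℤ) ∣ g1 * g2 := by
      by_contra hnd
      apply hv
      rw [padicValInt.eq_zero_of_not_dvd hnd]; exact dvd_zero 3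
    have hpn : ¬ (p:ℤ) ∣ h * g4 := by
      intro hd
      exact (Nat.prime_iff_prime_int.1 hp).not_isUnit (hco.isUnit_of_dvd' hpd hd)
    have hp2 : p ≠ 2 := by rintro rfl; exact hoddg (by exact_mod_cast hpd)
    have hp3 : p ≠ 3 := by rintro rfl; exact hpn ((show ((3:ℕ):ℤ) ∣ h by exact_mod_cast h3h).mul_right _)
    have hvc : ¬ 3 ∣ padicValInt p c := by
      rw [hcf, show g1 ^ 2 * g2 ^ 2 * h * g4 = (g1 * g2) * ((g1 * g2) * (h * g4)) by ring,
        padicValInt.mul h0 (mul_ne_zero h0 h0'), padicValInt.mul h0 h0', padicValInt.eq_zero_of_not_dvd hpn]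
      omega
    have hd := hB p hp hp2 hp3 hvc
    apply hpn
    refine Dvd.dvd.mul_right ?_ _
    refine (Nat.prime_iff_prime_int.1 hp).dvd_of_dvd_pow (n := D) ?_
    rw [← hf3]; exact hd.mul_left _)
  set J := j ^ D with hJ
  have hJ3 : 9 * J ^ 3 = P ^ 3 - 8 * Q ^ 3 := by
    rw [← hprod, hj, hJ]; ring
  have e27 : 27 * (P ^ 3 - J ^ 3) = 8 * (h * g4) ^ D := by linarith
  have h3D : (3:ℤ) ^ 4 ∣ (h * g4) ^ D := by
    refine (pow_dvd_pow 3 (show 4 ≤ D by omega)).trans ?_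
    exact pow_dvd_pow_of_dvd (h3h.mul_right _) D
  have h3e : (3:ℤ) ∣ P ^ 3 - J ^ 3 := by
    obtain ⟨k, hk⟩ := h3D
    exact ⟨8 * k, by omega⟩
  have h3PJ : (3:ℤ) ∣ P - J := by
    have : (3:ℤ) ∣ (P - J) ^ 3 := by
      obtain ⟨k, hk⟩ := h3e
      exact ⟨k - P ^ 2 * J + P * J ^ 2, by linear_combination hk⟩
    exact Int.prime_three.dvd_of_dvd_pow this
  obtain ⟨e, he⟩ := h3PJ
  obtain ⟨W, hW⟩ : ∃ W, W = P ^ 2 - 3 * e * P + 3 * e ^ 2 := ⟨_, rfl⟩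
  have hJe : J = P - 3 * e := by linarith
  have hW3 : P ^ 2 + P * J + J ^ 2 = 3 * W := by rw [hW, hJe]; ring
  have hJo : Odd J := by
    have : Odd (9 * J ^ 3) := by rw [hJ3, ← hprod]; exact hodd
    exact (Int.odd_pow' (by norm_num : (3:ℕ) ≠ 0)).1 (Int.odd_mul.1 this).2
  have hWo : Odd W := by
    have : Odd (3 * W) := by
      rw [← hW3]; exact ((hPo.pow).add_odd (hPo.mul hJo)).add_odd hJo.pow
    exact (Int.odd_mul.1 this).2
  have hWn3 : ¬ (3:ℤ) ∣ W := by
    rintro ⟨k, hk⟩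
    apply h3P
    refine Int.prime_three.dvd_of_dvd_pow (n := 2) ⟨k + e * P - e ^ 2, by linarith⟩
  have e81 : 81 * (P - J) * W = 8 * (h * g4) ^ D := by
    rw [← e27]; linear_combination (-27) * (P - J) * hW3
  have hW2 : IsCoprime W 2 := by
    obtain ⟨k, hk⟩ := hWo
    exact ⟨1, -k, by rw [hk]; ring⟩
  have hW3' : IsCoprime W 3 := ((Int.prime_three.coprime_iff_not_dvd).2 hWn3).symm
  have hW8 : IsCoprime (8:ℤ) (81 * W) := by
    have h1 : IsCoprime (2:ℤ) (81 * W) := IsCoprime.mul_right ⟨-40, 1, by norm_num⟩ hW2.symm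
    have := h1.pow_left (m := 3)
    norm_num at this; exact this
  obtain ⟨m, hm⟩ : (8:ℤ) ∣ P - J := hW8.dvd_of_dvd_mul_left ⟨(h * g4) ^ D, by linarith⟩
  have hWm : IsCoprime W (81 * m) := by
    have h81 : IsCoprime W 81 := by
      have := hW3'.pow_right (n := 4)
      norm_num at this; exact this
    refine h81.mul_right ?_
    have hWP : IsCoprime W (P - J) := by
      rw [Int.isCoprime_iff_gcd_eq_one]
      by_contra hne
      obtain ⟨q, hq, hqd⟩ := Nat.exists_prime_and_dvd hne
      have hqW : (q:ℤ) ∣ W := (Int.natCast_dvd_natCast.2 hqd).trans (Int.gcd_dvd_left _ _)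
      have hqP : (q:ℤ) ∣ P - J := (Int.natCast_dvd_natCast.2 hqd).trans (Int.gcd_dvd_right _ _)
      have hqp := Nat.prime_iff_prime_int.1 hq
      have hq3 : ¬ (q:ℤ) ∣ 3 := fun hh => hqp.not_isUnit (hW3'.isUnit_of_dvd' hqW hh)
      have hq2 : ¬ (q:ℤ) ∣ 2 := fun hh => hqp.not_isUnit (hW2.isUnit_of_dvd' hqW hh)
      have h3P2 : (q:ℤ) ∣ 3 * P ^ 2 := by
        have : 3 * P ^ 2 = 3 * W + (P - J) * (2 * P + J) := by rw [← hW3]; ring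
        rw [this]; exact dvd_add (hqW.mul_left _) (hqP.mul_right _)
      have hqP' : (q:ℤ) ∣ P := by
        rcases hqp.dvd_or_dvd h3P2 with hh | hh
        · exact absurd hh hq3
        · exact hqp.dvd_of_dvd_pow hh
      have hqJ : (q:ℤ) ∣ J := by
        have := dvd_sub hqP' hqP
        rwa [sub_sub_cancel] at this
      have hqQ : (q:ℤ) ∣ 2 ^ 3 * Q ^ 3 := by
        have : 2 ^ 3 * Q ^ 3 = P * P ^ 2 - J * (9 * J ^ 2) := by linarith
        rw [this]; exact dvd_sub (hqP'.mul_right _) (hqJ.mul_right _)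
      rcases hqp.dvd_or_dvd hqQ with hh | hh
      · exact hq2 (hqp.dvd_of_dvd_pow hh)
      · exact hqp.not_isUnit (hPQ.isUnit_of_dvd' hqP' (hqp.dvd_of_dvd_pow hh))
    exact hWP.of_isCoprime_of_dvd_right ⟨8, by linarith⟩
  obtain ⟨l, hl⟩ := dth2 W (81 * m) (h * g4) 1 D hD (by simp) hWm (by
    have : 8 * (W ^ 1 * (81 * m)) = 8 * (h * g4) ^ D := by rw [← e81, hm]; ring
    linarith)
  obtain ⟨x, hx, hd, hxs, hQ9⟩ := a3_setup21 P Q c C D hC hC75 hQ hdom heq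
  have hQr : (Q:ℝ) ≠ 0 := by exact_mod_cast hQ
  have hx1 := abs_le.1 hxs
  obtain ⟨t, ht⟩ : ∃ t : ℝ, (J:ℝ) = Q * t := ⟨J / Q, by field_simp⟩
  have hx3 : |x ^ 3| ≤ 1 / 1000 := by
    rw [abs_pow]; calc |x| ^ 3 ≤ (13 / 200) ^ 3 := pow_le_pow_left₀ (abs_nonneg x) hxs 3
      _ ≤ _ := by norm_num
  have hx3' := abs_le.1 hx3
  have ht3 : 9 * t ^ 3 = x ^ 3 - 8 := by
    have h' : 9 * (J:ℝ) ^ 3 = (P:ℝ) ^ 3 - 8 * (Q:ℝ) ^ 3 := by exact_mod_cast hJ3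
    rw [hx, ht] at h'
    have hQ3 : (Q:ℝ) ^ 3 ≠ 0 := pow_ne_zero 3 hQr
    apply mul_left_cancel₀ hQ3
    linear_combination h'
  have ht1 : -1 ≤ t := by
    by_contra hlt
    push Not at hlt
    have : (1:ℝ) ^ 3 ≤ (-t) ^ 3 := pow_le_pow_left₀ (by norm_num) (by linarith) 3
    have e : (-t) ^ 3 = - t ^ 3 := by ring
    linarith
  have ht2 : t ≤ -(9 / 10) := by
    by_contra hlt
    push Not at hlt
    rcases le_or_gt t 0 with hle | hgt
    · have : (-t) ^ 3 ≤ (9 / 10 : ℝ) ^ 3 := pow_le_pow_left₀ (by linarith) (by linarith) 3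
      have e : (-t) ^ 3 = - t ^ 3 := by ring
      norm_num at this
      linarith
    · have : 0 < t ^ 3 := by positivity
      linarith
  have hA : (27:ℝ) * ((g1 ^ 3 : ℤ) : ℝ) ^ D = (Q:ℝ) ^ (3 * 1) * (x - 2) ^ 3 := by
    have : (P:ℝ) - 2 * Q = 3 * (g1:ℝ) ^ D := by exact_mod_cast hf1
    have e : (27:ℝ) * ((g1 ^ 3 : ℤ) : ℝ) ^ D = (3 * (g1:ℝ) ^ D) ^ 3 := by push_cast; ring
    rw [e, ← this, hx]; ring
  have hBv : (27:ℝ) * ((j * l : ℤ) : ℝ) ^ D = (Q:ℝ) ^ (3 * 1) * (9 * t * (x ^ 2 + x * t + t ^ 2)) := by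
    have h1 : (27:ℤ) * (j * l) ^ D = 9 * J * (P ^ 2 + P * J + J ^ 2) := by rw [hW3, hl, hJ]; ring
    have h2 : (27:ℝ) * ((j * l : ℤ) : ℝ) ^ D = 9 * J * (P ^ 2 + P * J + J ^ 2) := by exact_mod_cast h1
    rw [h2, hx, ht]; ring
  have hP0 : P ≠ 0 := by rintro rfl; simp at hPo
  have hx0 : x ≠ 0 := by
    rintro rfl
    rw [mul_zero] at hx
    exact hP0 (by exact_mod_cast hx)
  have hdiff : (x - 2) ^ 3 - 9 * t * (x ^ 2 + x * t + t ^ 2) = x * (12 - 6 * x - 9 * t * x - 9 * t ^ 2) := by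
    linear_combination -ht3
  have hfl : 2 ≤ 12 - 6 * x - 9 * t * x - 9 * t ^ 2 := by nlinarith
  have hfu : 12 - 6 * x - 9 * t * x - 9 * t ^ 2 ≤ 6 := by nlinarith
  have hUV : g1 ^ 3 ≠ j * l := by
    intro hh
    rw [hh, hBv] at hA
    have := mul_left_cancel₀ (pow_ne_zero (3 * 1) hQr) hA
    rw [← this, sub_self] at hdiff
    rcases mul_eq_zero.1 hdiff.symm with hz | hz
    · exact hx0 hz
    · linarith
  have ha1 : (x - 2) ^ 3 ≤ -6 := by
    have : (19 / 10 : ℝ) ^ 3 ≤ (2 - x) ^ 3 := pow_le_pow_left₀ (by norm_num) (by linarith) 3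
    have e : (2 - x) ^ 3 = - (x - 2) ^ 3 := by ring
    norm_num at this
    linarith
  have ha2 : -27 ≤ (x - 2) ^ 3 := by
    have : (2 - x) ^ 3 ≤ (3:ℝ) ^ 3 := pow_le_pow_left₀ (by linarith) (by linarith) 3
    have e : (2 - x) ^ 3 = - (x - 2) ^ 3 := by ring
    norm_num at this
    linarith
  have habs : |(x - 2) ^ 3| = - (x - 2) ^ 3 := abs_of_neg (by linarith)
  have hg1 : g1 ^ 3 ≠ 0 := pow_ne_zero 3 (left_ne_zero_of_mul h0)
  have g := close_norm (g1 ^ 3) (j * l) D 27 (1 * |x|) _ _ _ hD (by norm_num) (pow_ne_zero _ hQr) hA hBv hg1 hUV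
    (by linarith) (by
      rw [hdiff, habs, abs_mul, abs_of_pos (by linarith : 0 < 12 - 6 * x - 9 * t * x - 9 * t ^ 2)]
      nlinarith [abs_nonneg x])
  have hDr : (35:ℝ) ≤ D := by exact_mod_cast hD35
  have g1' : 2 ≤ |x| * |((g1 ^ 3 : ℤ) : ℝ)| := by nlinarith
  refine a3_fin21 x _ C (abs_nonneg _) hC75 hd g1' ?_
  have := a3_Ubound (g1 ^ 3) D 1 Q _ _ C hD35 (by norm_num) (by norm_num) (by linarith) hA (by rw [habs]; linarith) hQ9
  have h4 : C ^ 1 ≤ C ^ 2 := pow_le_pow_right₀ (by linarith) (by norm_num)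
  linarith
end

section
theorem cop3 (P Q a b A B r s t u : ℤ) (hPQ : IsCoprime P Q) (h2 : ¬ (2:ℤ) ∣ a ∨ ¬ (2:ℤ) ∣ b)
    (h3 : ¬ (3:ℤ) ∣ a ∨ ¬ (3:ℤ) ∣ b) (haA : a ∣ A) (hbB : b ∣ B)
    (e1 : 36 * P ^ 3 = r * A + s * B) (e2 : 36 * Q ^ 3 = t * A + u * B) : IsCoprime a b := by
  apply isCoprime_of_prime_dvd
  · rintro ⟨rfl, rfl⟩; simp at h2
  · intro p hp hpa hpb
    have n2 : ¬ p ∣ 2 := by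
      intro h
      have := (hp.associated_of_dvd Int.prime_two h).symm.dvd
      rcases h2 with h2 | h2
      · exact h2 (this.trans hpa)
      · exact h2 (this.trans hpb)
    have n3 : ¬ p ∣ 3 := by
      intro h
      have := (hp.associated_of_dvd Int.prime_three h).symm.dvd
      rcases h3 with h2 | h2
      · exact h2 (this.trans hpa)
      · exact h2 (this.trans hpb)
    have n36 : ¬ p ∣ 36 := by
      intro h; rw [show (36:ℤ) = 2 * 2 * (3 * 3) by norm_num] at h
      rcases hp.dvd_or_dvd h with h | h
      · rcases hp.dvd_or_dvd h with h | h <;> exact n2 h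
      · rcases hp.dvd_or_dvd h with h | h <;> exact n3 h
    have hpf := hpa.trans haA
    have hpg := hpb.trans hbB
    have k1 : p ∣ 36 * P ^ 3 := by rw [e1]; exact dvd_add (hpf.mul_left _) (hpg.mul_left _)
    have k2 : p ∣ 36 * Q ^ 3 := by rw [e2]; exact dvd_add (hpf.mul_left _) (hpg.mul_left _)
    have k3 := hp.dvd_of_dvd_pow ((hp.dvd_or_dvd k1).resolve_left n36)
    have k4 := hp.dvd_of_dvd_pow ((hp.dvd_or_dvd k2).resolve_left n36)
    exact hp.not_isUnit (hPQ.isUnit_of_dvd' k3 k4)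

theorem cop27 (z w : ℤ) (h3 : ¬ (3:ℤ) ∣ z) (h : IsCoprime z w) : IsCoprime z (27 * w) := by
  have h1 : IsCoprime z 3 := ((Int.prime_three.coprime_iff_not_dvd).2 h3).symm
  have := h1.pow_right (n := 3)
  norm_num at this
  exact this.mul_right h

set_option maxHeartbeats 1000000 in
theorem a3_core (P Q c : ℤ) (C : ℝ) (D : ℕ) (hD : Odd D) (hD35 : 35 ≤ D) (hC : C = |(c:ℝ)|)
    (hc0 : c ≠ 0) (hc3 : (3:ℤ) ∣ c) (hPo : Odd P) (hPQ : IsCoprime P Q)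
    (h : ((P ^ 3 - 8 * Q ^ 3) * (P ^ 3 + Q ^ 3) ^ 2 = 27 * c ^ D ∧
        (3 * C ^ 5 * (Q:ℝ) ^ 6 ≤ 8 * (P:ℝ) ^ 6 ∨ 3 * C ^ 5 * |(P:ℝ)| ^ 3 ≤ 8 * |(Q:ℝ)| ^ 3)) ∨
      ((P ^ 3 - 8 * Q ^ 3) ^ 2 * (P ^ 3 + Q ^ 3) = 27 * c ^ D ∧
        (3 * C ^ 5 * (Q:ℝ) ^ 6 ≤ 8 * (P:ℝ) ^ 6 ∨ 3 * C ^ 5 * (P:ℝ) ^ 6 ≤ 512 * (Q:ℝ) ^ 6) ∧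
        (∀ p : ℕ, p.Prime → p ≠ 2 → p ≠ 3 → ¬ 3 ∣ padicValInt p c → (p:ℤ) ∣ P + Q))) : False := by
  have hD0 : D ≠ 0 := by omega
  have hcD : c ^ D ≠ 0 := pow_ne_zero D hc0
  have c1 : Nat.Coprime 1 D := by simp
  have c2 : Nat.Coprime 2 D := by rw [Nat.coprime_two_left]; exact hD
  have h3PQ : (3:ℤ) ∣ P + Q := by
    have hm : (3:ℤ) ∣ (P ^ 3 - 8 * Q ^ 3) ∨ (3:ℤ) ∣ (P ^ 3 + Q ^ 3) := by
      rcases h with ⟨heq, -⟩ | ⟨heq, -⟩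
      · have : (3:ℤ) ∣ (P ^ 3 - 8 * Q ^ 3) * (P ^ 3 + Q ^ 3) ^ 2 := ⟨9 * c ^ D, by rw [heq]; ring⟩
        exact (Int.prime_three.dvd_or_dvd this).imp id (Int.prime_three.dvd_of_dvd_pow)
      · have : (3:ℤ) ∣ (P ^ 3 - 8 * Q ^ 3) ^ 2 * (P ^ 3 + Q ^ 3) := ⟨9 * c ^ D, by rw [heq]; ring⟩
        exact (Int.prime_three.dvd_or_dvd this).imp (Int.prime_three.dvd_of_dvd_pow) id
    have : (3:ℤ) ∣ (P + Q) ^ 3 := by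
      rcases hm with ⟨k, hk⟩ | ⟨k, hk⟩
      · exact ⟨k + 3 * Q ^ 3 + P ^ 2 * Q + P * Q ^ 2, by linear_combination hk⟩
      · exact ⟨k + P ^ 2 * Q + P * Q ^ 2, by linear_combination hk⟩
    exact Int.prime_three.dvd_of_dvd_pow this
  have h3Q : ¬ (3:ℤ) ∣ Q := by
    intro hq
    have hp : (3:ℤ) ∣ P := by have := dvd_sub h3PQ hq; rwa [add_sub_cancel_right] at this
    exact Int.prime_three.not_isUnit (hPQ.isUnit_of_dvd' hp hq)
  have h3P : ¬ (3:ℤ) ∣ P := by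
    intro hp
    have hq : (3:ℤ) ∣ Q := by have := dvd_sub h3PQ hp; rwa [add_sub_cancel_left] at this
    exact h3Q hq
  have hQ0 : Q ≠ 0 := by rintro rfl; simp at h3Q
  have hPQ0 : P + Q ≠ 0 := by
    intro h0
    have : P ^ 3 + Q ^ 3 = 0 := by rw [show P = -Q by linarith]; ring
    rcases h with ⟨heq, -⟩ | ⟨heq, -⟩
    · rw [this] at heq; apply hcD; linarith
    · rw [this] at heq; apply hcD; linarith
  obtain ⟨F3, hF3⟩ := h3PQ
  have hF30 : F3 ≠ 0 := by rintro rfl; simp at hF3; exact hPQ0 hF3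
  obtain ⟨F1, hF1'⟩ : ∃ F1, F1 = F3 - Q := ⟨_, rfl⟩
  have hF1 : P - 2 * Q = 3 * F1 := by rw [hF1']; linarith
  obtain ⟨f2, hf2'⟩ : ∃ f, f = 3 * F3 ^ 2 + Q ^ 2 := ⟨_, rfl⟩
  obtain ⟨f4, hf4'⟩ : ∃ f, f = 3 * F3 ^ 2 - P * Q := ⟨_, rfl⟩
  have hP : P = 3 * F3 - Q := by linarith
  have hf2 : P ^ 2 + 2 * P * Q + 4 * Q ^ 2 = 3 * f2 := by rw [hf2', hP]; ring
  have hf4 : P ^ 2 - P * Q + Q ^ 2 = 3 * f4 := by rw [hf4']; linear_combination (P + Q + 3 * F3) * hF3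
  have n32 : ¬ (3:ℤ) ∣ f2 := by
    rintro ⟨k, hk⟩
    exact h3Q (Int.prime_three.dvd_of_dvd_pow (n := 2) ⟨k - F3 ^ 2, by linarith⟩)
  have n34 : ¬ (3:ℤ) ∣ f4 := by
    rintro ⟨k, hk⟩
    have : (3:ℤ) ∣ P * Q := ⟨F3 ^ 2 - k, by linarith⟩
    rcases Int.prime_three.dvd_or_dvd this with h | h
    · exact h3P h
    · exact h3Q h
  have o1 : ¬ (2:ℤ) ∣ F1 := by
    intro hd
    obtain ⟨k, hk⟩ := hd
    obtain ⟨l, hl⟩ := hPo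
    omega
  have oP2 : Odd (P ^ 2) := hPo.pow
  have o2 : ¬ (2:ℤ) ∣ f2 := by
    rintro ⟨k, hk⟩
    rw [← Int.not_even_iff_odd] at oP2
    exact oP2 ⟨3 * k - P * Q - 2 * Q ^ 2, by linarith⟩
  have o4 : ¬ (2:ℤ) ∣ f4 := by
    rintro ⟨k, hk⟩
    have he : Even (Q * (Q - 1)) := Int.even_mul_pred_self Q
    rcases Int.even_or_odd Q with hQe | hQo
    · obtain ⟨l, hl⟩ := hQe
      rw [← Int.not_even_iff_odd] at oP2
      exact oP2 ⟨3 * k + P * l - 2 * l ^ 2, by rw [hl] at hf4; linarith⟩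
    · have := ((hPo.pow (n := 2)).sub_odd (hPo.mul hQo)).add_odd (hQo.pow (n := 2))
      rw [hf4, ← Int.not_even_iff_odd] at this
      exact this ⟨3 * k, by rw [hk]; ring⟩
  have d1 : F1 ∣ P - 2 * Q := ⟨3, by linarith⟩
  have d2 : f2 ∣ P ^ 2 + 2 * P * Q + 4 * Q ^ 2 := ⟨3, by linarith⟩
  have d3 : F3 ∣ P + Q := ⟨3, by linarith⟩
  have d4 : f4 ∣ P ^ 2 - P * Q + Q ^ 2 := ⟨3, by linarith⟩
  have n13 : ¬ (3:ℤ) ∣ F1 ∨ ¬ (3:ℤ) ∣ F3 := by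
    by_contra hcon
    push Not at hcon
    apply h3Q
    have := dvd_sub hcon.2 hcon.1
    rwa [hF1', sub_sub_cancel] at this
  have k12 : IsCoprime F1 f2 := cop3 P Q F1 f2 _ _ (12 * P * (3 * P - (P - 2 * Q))) (12 * P) (-3 * Q * ((P - 2 * Q) + 6 * Q)) (3 * Q)
    hPQ (Or.inl o1) (Or.inr n32) d1 d2 (by ring) (by ring)
  have k13 : IsCoprime F1 F3 := cop3 P Q F1 F3 _ _ (12 * P ^ 2) (24 * P ^ 2) (-12 * Q ^ 2) (12 * Q ^ 2)
    hPQ (Or.inl o1) n13 d1 d3 (by ring) (by ring)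
  have k14 : IsCoprime F1 f4 := cop3 P Q F1 f4 _ _ (-12 * P * (P - 2 * Q)) (48 * P) (-12 * Q * ((P - 2 * Q) + 3 * Q)) (12 * Q)
    hPQ (Or.inl o1) (Or.inr n34) d1 d4 (by ring) (by ring)
  have k23 : IsCoprime f2 F3 := cop3 P Q f2 F3 _ _ (12 * P) (12 * P * (6 * P - 4 * (P + Q))) (12 * Q) (-12 * Q * (P + Q))
    hPQ (Or.inl o2) (Or.inl n32) d2 d3 (by ring) (by ring)
  have k24 : IsCoprime f2 f4 := cop3 P Q f2 f4 _ _ (4 * (3 * P - (2 * Q + 2 * P))) (16 * (2 * Q + 2 * P)) (-4 * (P - 2 * Q)) (4 * (3 * Q + (P - 2 * Q)))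
    hPQ (Or.inl o2) (Or.inl n32) d2 d4 (by ring) (by ring)
  have k34 : IsCoprime F3 f4 := cop3 P Q F3 f4 _ _ (-12 * P * (P + Q - 3 * P)) (12 * P) (-12 * Q * (P + Q - 3 * Q)) (12 * Q)
    hPQ (Or.inr o4) (Or.inr n34) d3 d4 (by ring) (by ring)
  have hfac : P ^ 3 - 8 * Q ^ 3 = 9 * (F1 * f2) ∧ P ^ 3 + Q ^ 3 = 9 * (F3 * f4) := by
    constructor
    · linear_combination (P ^ 2 + 2 * P * Q + 4 * Q ^ 2) * hF1 + 3 * F1 * hf2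
    · linear_combination (P ^ 2 - P * Q + Q ^ 2) * hF3 + 3 * F3 * hf4
  have hg2 : ∀ g : ℤ, f2 = g ^ D → 5 ≤ g := by
    intro g hg
    have hf2pos : 0 < f2 := by rw [hf2']; positivity
    have hgpos : 0 < g := by
      by_contra hneg
      have := hD.pow_nonpos (not_lt.1 hneg)
      omega
    have ng2 : ¬ (2:ℤ) ∣ g := fun hd => o2 (hg ▸ (dvd_pow hd hD0))
    have ng3 : ¬ (3:ℤ) ∣ g := fun hd => n32 (hg ▸ (dvd_pow hd hD0))
    have ng1 : g ≠ 1 := by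
      rintro rfl
      rw [one_pow] at hg
      have : 0 < F3 ^ 2 := by positivity
      have : 0 ≤ Q ^ 2 := by positivity
      omega
    omega
  have hC1 : ∀ g : ℤ, f2 = g ^ D → g ∣ c → 15 ≤ C := by
    intro g hg hgc
    have h5 := hg2 g hg
    have ng3 : ¬ (3:ℤ) ∣ g := fun hd => n32 (hg ▸ (dvd_pow hd hD0))
    have hd : 3 * g ∣ c := ((Int.prime_three.coprime_iff_not_dvd).2 ng3).mul_dvd hc3 hgc
    have := Int.le_of_dvd (abs_pos.2 hc0) ((dvd_abs _ _).2 hd)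
    have h15 : 15 ≤ |c| := by omega
    rw [hC]; exact_mod_cast h15
  have hC2 : ∀ g : ℤ, f2 = g ^ D → g ^ 2 ∣ c → 75 ≤ C := by
    intro g hg hgc
    have h5 := hg2 g hg
    have ng3 : ¬ (3:ℤ) ∣ g := fun hd => n32 (hg ▸ (dvd_pow hd hD0))
    have hd : 3 * g ^ 2 ∣ c := (((Int.prime_three.coprime_iff_not_dvd).2 ng3).pow_right).mul_dvd hc3 hgc
    have := Int.le_of_dvd (abs_pos.2 hc0) ((dvd_abs _ _).2 hd)
    have h25 : 25 ≤ g ^ 2 := by nlinarith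
    have h15 : 75 ≤ |c| := by omega
    rw [hC]; exact_mod_cast h15
  have n3pow : ∀ g z : ℤ, z = g ^ D → ¬ (3:ℤ) ∣ z → ¬ (3:ℤ) ∣ g := by
    intro g z hz hn hd
    exact hn (hz ▸ dvd_pow hd hD0)
  rcases h with ⟨heq, hdom⟩ | ⟨heq, hdom, hB⟩
  · have heq' : 27 * F1 * f2 * F3 ^ 2 * f4 ^ 2 = c ^ D := by
      rw [hfac.1, hfac.2] at heq; linarith
    by_cases hn3 : (3:ℤ) ∣ F3
    · have hn1 : ¬ (3:ℤ) ∣ F1 := n13.resolve_right (not_not.2 hn3)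
      obtain ⟨g1, g2, m, g4, E1, E2, E3, E4, Ec⟩ := dth4 F1 f2 (27 * F3 ^ 2) f4 c 1 1 1 2 D hD c1 c1 c1 c2
        k12 (cop27 _ _ hn1 k13.pow_right) k14 (cop27 _ _ n32 k23.pow_right) k24 (cop27 _ _ n34 k34.symm.pow_right).symm
        (by linarith)
      have C15 := hC1 g2 E2 ⟨g1 * m * g4 ^ 2, by rw [Ec]; ring⟩
      rcases hdom with hdom | hdom
      · exact a3_Pdom P Q c g2 g4 C D hD hD35 hC C15 (by rw [hf2, E2]) (by rw [hf4, E4]) hQ0 hPQ0 hdom (Or.inl heq)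
      · refine a3_Q12un P Q c (g2 ^ 2 * g4) (g1 ^ 4 * m) C D hD hD35 ?_ ?_ ?_ hC C15 hQ0 hdom heq
        · rw [hf2, hf4, E2, E4]; ring
        · rw [mul_pow, ← E3, hF1, hF3, E1]; ring
        · have hm : (3:ℤ) ∣ m := Int.prime_three.dvd_of_dvd_pow (n := D) (E3 ▸ ⟨9 * F3 ^ 2, by ring⟩)
          intro hh
          have : (3:ℤ) ∣ g2 ^ 2 * g4 := by rw [hh]; exact hm.mul_left _
          rcases Int.prime_three.dvd_or_dvd this with h | h
          · exact n3pow g2 _ E2 n32 (Int.prime_three.dvd_of_dvd_pow h)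
          · exact n3pow g4 _ E4 n34 h
    · obtain ⟨m, g2, g3, g4, E1, E2, E3, E4, Ec⟩ := dth4 (27 * F1) f2 F3 f4 c 1 1 2 2 D hD c1 c1 c2 c2
        (cop27 _ _ n32 k12.symm).symm (cop27 _ _ hn3 k13.symm).symm (cop27 _ _ n34 k14.symm).symm k23 k24 k34
        (by linarith)
      have C15 := hC1 g2 E2 ⟨m * g3 ^ 2 * g4 ^ 2, by rw [Ec]; ring⟩
      rcases hdom with hdom | hdom
      · exact a3_Pdom P Q c g2 g4 C D hD hD35 hC C15 (by rw [hf2, E2]) (by rw [hf4, E4]) hQ0 hPQ0 hdom (Or.inl heq)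
      · refine a3_Q12nat P Q c (g2 * g4 ^ 5) (m ^ 2 * g3 ^ 10) C D hD hD35 ?_ ?_ ?_ hC C15 hQ0 hdom heq
        · rw [hf2, hf4, E2, E4]; ring
        · rw [mul_pow, ← pow_mul, mul_comm 2 D, pow_mul, ← E1, hF1, hF3, E3]; ring
        · have hm : (3:ℤ) ∣ m := Int.prime_three.dvd_of_dvd_pow (n := D) (E1 ▸ ⟨9 * F1, by ring⟩)
          intro hh
          have : (3:ℤ) ∣ g2 * g4 ^ 5 := by rw [hh]; exact (dvd_pow hm (by norm_num)).mul_right _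
          rcases Int.prime_three.dvd_or_dvd this with h | h
          · exact n3pow g2 _ E2 n32 h
          · exact n3pow g4 _ E4 n34 (Int.prime_three.dvd_of_dvd_pow h)
  · have heq' : 27 * F1 ^ 2 * f2 ^ 2 * F3 * f4 = c ^ D := by
      rw [hfac.1, hfac.2] at heq; linarith
    by_cases hn3 : (3:ℤ) ∣ F3
    · have hn1 : ¬ (3:ℤ) ∣ F1 := n13.resolve_right (not_not.2 hn3)
      obtain ⟨g1, g2, m, g4, E1, E2, E3, E4, Ec⟩ := dth4 F1 f2 (27 * F3) f4 c 2 2 1 1 D hD c2 c2 c1 c1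
        k12 (cop27 _ _ hn1 k13) k14 (cop27 _ _ n32 k23) k24 (cop27 _ _ n34 k34.symm).symm
        (by linarith)
      have C75 := hC2 g2 E2 ⟨g1 ^ 2 * m * g4, by rw [Ec]; ring⟩
      rcases hdom with hdom | hdom
      · exact a3_Pdom P Q c g2 g4 C D hD hD35 hC (by linarith) (by rw [hf2, E2]) (by rw [hf4, E4]) hQ0 hPQ0 hdom (Or.inr heq)
      · have K1 : IsCoprime (g1 * g2) (m * g4) := by
          have q13 := cop27 _ _ hn1 k13
          have q23 := cop27 _ _ n32 k23
          rw [E1, E3, IsCoprime.pow_iff hD.pos hD.pos] at q13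
          rw [E2, E3, IsCoprime.pow_iff hD.pos hD.pos] at q23
          rw [E1, E4, IsCoprime.pow_iff hD.pos hD.pos] at k14
          rw [E2, E4, IsCoprime.pow_iff hD.pos hD.pos] at k24
          exact (q13.mul_right k14).mul_left (q23.mul_right k24)
        exact a3_trouble P Q c g1 g2 m g4 C D hD hD35 (by rw [hF1, E1]) (by rw [hf2, E2])
          (by rw [← E3, hF3]; ring) (by rw [hf4, E4]) (by rw [Ec]; ring) K1 hc0 hPo hPQ h3P hB hC C75 hQ0 hdom heq
    · obtain ⟨m, g2, g3, g4, E1, E2, E3, E4, Ec⟩ := dth4 (27 * F1 ^ 2) f2 F3 f4 c 1 2 1 1 D hD c1 c2 c1 c1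
        (cop27 _ _ n32 k12.symm.pow_right).symm (cop27 _ _ hn3 k13.symm.pow_right).symm (cop27 _ _ n34 k14.symm.pow_right).symm k23 k24 k34
        (by linarith)
      have C75 := hC2 g2 E2 ⟨m * g3 * g4, by rw [Ec]; ring⟩
      rcases hdom with hdom | hdom
      · exact a3_Pdom P Q c g2 g4 C D hD hD35 hC (by linarith) (by rw [hf2, E2]) (by rw [hf4, E4]) hQ0 hPQ0 hdom (Or.inr heq)
      · refine a3_Q21un P Q c (g2 * g4 ^ 2) (m * g3 ^ 4) C D hD hD35 ?_ ?_ ?_ hC C75 hQ0 hdom heq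
        · rw [hf2, hf4, E2, E4]; ring
        · rw [mul_pow, ← E1, hF1, hF3, E3]; ring
        · have hm : (3:ℤ) ∣ m := Int.prime_three.dvd_of_dvd_pow (n := D) (E1 ▸ ⟨9 * F1 ^ 2, by ring⟩)
          intro hh
          have : (3:ℤ) ∣ g2 * g4 ^ 2 := by rw [hh]; exact hm.mul_right _
          rcases Int.prime_three.dvd_or_dvd this with h | h
          · exact n3pow g2 _ E2 n32 h
          · exact n3pow g4 _ E4 n34 (Int.prime_three.dvd_of_dvd_pow h)
end

section
theorem a3_dich (T X Y : ℝ) (hX : 0 < X) (hY : 0 < Y) (hT : 729 ≤ T)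
    (h : 9 / 2 * (T * X * Y ^ 2) ≤ (X + 8 * Y) * (X + Y) ^ 2) : T * X ≤ 8 * Y ∨ T * Y ^ 2 ≤ 8 * X ^ 2 := by
  by_contra! hc
  obtain ⟨h1, h2⟩ := hc
  have e1 : 8 * X ^ 3 < T * X * Y ^ 2 := by
    have := mul_lt_mul_of_pos_left h2 hX
    nlinarith
  have e2 : 8 * Y ^ 3 < T * X * Y ^ 2 := by
    have := mul_lt_mul_of_pos_left h1 (pow_pos hY 2)
    nlinarith
  have e3 : 729 * (X * Y ^ 2) ≤ T * X * Y ^ 2 := by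
    have : 0 < X * Y ^ 2 := by positivity
    nlinarith
  have e4 : 0 ≤ X * (X - Y) ^ 2 := by positivity
  have e5 : 0 < X * Y ^ 2 := by positivity
  nlinarith

theorem arith3 (c R X y : ℤ) (D : ℕ) (hD : Odd D) (hD5 : 5 ≤ D) (hc : 2 ≤ |c|) (hR : R ≠ 0)
    (hcop : IsCoprime R c) (hb : R ^ 6 * |c| ^ 5 ≤ 2 * |c| ^ D) (hN : R = 1 ∨ 35 ≤ D)
    (h1 : y ^ 3 = R ^ 6 + c ^ D) (h2 : X ^ 3 - 3 * y * X = 2 * R ^ 3)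
    (hB : ∀ p : ℕ, p.Prime → p ≠ 3 → ¬ 3 ∣ padicValInt p c → (p : ℤ) ∣ X - 2 * R) : False := by
  have hc0 : c ≠ 0 := by rintro rfl; simp at hc
  have hcD : c ^ D ≠ 0 := pow_ne_zero _ hc0
  by_cases hc3 : (3:ℤ) ∣ c
  swap
  · exact arith3_no3 c R y D hD hD5 hc hc3 hR hcop hb h1
  have hX0 : X ≠ 0 := by
    rintro rfl
    have : R ^ 3 = 0 := by linarith
    exact hR (pow_eq_zero_iff (by norm_num) |>.1 this)
  have E : (X ^ 3 - 8 * R ^ 3) * (X ^ 3 + R ^ 3) ^ 2 = 27 * X ^ 3 * c ^ D := by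
    have e : 3 * y * X = X ^ 3 - 2 * R ^ 3 := by linarith
    have e2 : 27 * X ^ 3 * y ^ 3 = (X ^ 3 - 2 * R ^ 3) ^ 3 := by rw [← e]; ring
    rw [h1] at e2
    linear_combination -e2
  rcases hN with rfl | hD35
  · have hd : X ∣ 2 := ⟨X ^ 2 - 3 * y, by linear_combination -h2⟩
    have hle := Int.le_of_dvd (by norm_num) hd
    have hge := Int.le_of_dvd (by norm_num) ((neg_dvd).2 hd)
    have : X = 1 ∨ X = 2 ∨ X = -1 ∨ X = -2 := by omega
    rcases this with rfl | rfl | rfl | rfl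
    · have := mul_ne_zero (by norm_num : (27:ℤ) ≠ 0) hcD
      omega
    · omega
    · omega
    · have : y = 1 := by omega
      rw [this] at h1
      omega
  have hC3 : 3 ≤ |c| := by
    have := Int.le_of_dvd (abs_pos.2 hc0) ((dvd_abs _ _).2 hc3)
    exact this
  set C : ℝ := |(c:ℝ)| with hC
  have hC3r : 3 ≤ C := by rw [hC]; exact_mod_cast hC3
  have hC5 : (243:ℝ) ≤ C ^ 5 := by
    calc (243:ℝ) = 3 ^ 5 := by norm_num
      _ ≤ C ^ 5 := pow_le_pow_left₀ (by norm_num) hC3r 5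
  have hdich : 3 * C ^ 5 * |(X:ℝ)| ^ 3 ≤ 8 * |(R:ℝ)| ^ 3 ∨ 3 * C ^ 5 * (R:ℝ) ^ 6 ≤ 8 * (X:ℝ) ^ 6 := by
    have hx : 0 < |(X:ℝ)| := abs_pos.2 (by exact_mod_cast hX0)
    have hq : 0 < |(R:ℝ)| := abs_pos.2 (by exact_mod_cast hR)
    have hbr : (R:ℝ) ^ 6 * C ^ 5 ≤ 2 * C ^ D := by rw [hC]; exact_mod_cast hb
    have Er : ((X:ℝ) ^ 3 - 8 * (R:ℝ) ^ 3) * ((X:ℝ) ^ 3 + (R:ℝ) ^ 3) ^ 2 = 27 * (X:ℝ) ^ 3 * (c:ℝ) ^ D := by exact_mod_cast E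
    have Ea := congrArg abs Er
    rw [abs_mul, abs_mul, abs_mul, abs_pow, abs_pow, abs_pow, ← hC] at Ea
    have b1 : |(X:ℝ) ^ 3 - 8 * (R:ℝ) ^ 3| ≤ |(X:ℝ)| ^ 3 + 8 * |(R:ℝ)| ^ 3 := by
      have := abs_sub ((X:ℝ) ^ 3) (8 * (R:ℝ) ^ 3)
      rwa [abs_mul, abs_pow, abs_pow, abs_of_pos (by norm_num : (0:ℝ) < 8)] at this
    have b2 : |(X:ℝ) ^ 3 + (R:ℝ) ^ 3| ≤ |(X:ℝ)| ^ 3 + |(R:ℝ)| ^ 3 := by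
      have := abs_add_le ((X:ℝ) ^ 3) ((R:ℝ) ^ 3)
      rwa [abs_pow, abs_pow] at this
    have b3 : |(X:ℝ) ^ 3 - 8 * (R:ℝ) ^ 3| * |(X:ℝ) ^ 3 + (R:ℝ) ^ 3| ^ 2 ≤ (|(X:ℝ)| ^ 3 + 8 * |(R:ℝ)| ^ 3) * (|(X:ℝ)| ^ 3 + |(R:ℝ)| ^ 3) ^ 2 := by
      gcongr
    rw [Ea, abs_of_pos (by norm_num : (0:ℝ) < 27)] at b3
    have r6 : (R:ℝ) ^ 6 = (|(R:ℝ)| ^ 3) ^ 2 := by rw [← pow_mul, (by decide : Even (3*2)).pow_abs]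
    have x6 : (X:ℝ) ^ 6 = (|(X:ℝ)| ^ 3) ^ 2 := by rw [← pow_mul, (by decide : Even (3*2)).pow_abs]
    rw [r6] at hbr ⊢
    rw [x6]
    apply a3_dich (3 * C ^ 5) _ _ (by positivity) (by positivity) (by linarith)
    refine le_trans ?_ b3
    have : 0 < |(X:ℝ)| ^ 3 := by positivity
    nlinarith
  obtain ⟨G, P, Q, hG0, hPQ, hXG, hRG⟩ : ∃ G P Q : ℤ, G ≠ 0 ∧ IsCoprime P Q ∧ X = G * P ∧ R = G * Q := by
    obtain ⟨P, hP⟩ := Int.gcd_dvd_left X R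
    obtain ⟨Q, hQ⟩ := Int.gcd_dvd_right X R
    have hg : ((Int.gcd X R : ℕ) : ℤ) ≠ 0 := by
      exact_mod_cast Int.gcd_ne_zero_left hX0
    refine ⟨Int.gcd X R, P, Q, hg, ?_, hP, hQ⟩
    refine ⟨Int.gcdA X R, Int.gcdB X R, mul_left_cancel₀ hg ?_⟩
    have := Int.gcd_eq_gcd_ab X R
    linear_combination -this - X.gcdA R * hP - X.gcdB R * hQ
  have hGc : IsCoprime G c := by
    rw [hRG] at hcop
    exact hcop.of_mul_left_left
  have hG3 : IsCoprime G 27 := by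
    have : IsCoprime G 3 := hGc.of_isCoprime_of_dvd_right hc3
    have := this.pow_right (n := 3)
    norm_num at this
    exact this
  have E2 : G ^ 6 * ((P ^ 3 - 8 * Q ^ 3) * (P ^ 3 + Q ^ 3) ^ 2) = 27 * P ^ 3 * c ^ D := by
    rw [hXG, hRG] at E
    apply mul_left_cancel₀ (pow_ne_zero 3 hG0)
    linear_combination E
  have hGP : G ^ 2 ∣ P := by
    have d1 : G ^ 6 ∣ (27 * c ^ D) * P ^ 3 := ⟨(P ^ 3 - 8 * Q ^ 3) * (P ^ 3 + Q ^ 3) ^ 2, by linear_combination -E2⟩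
    have d2 : IsCoprime (G ^ 6) (27 * c ^ D) := (hG3.mul_right (hGc.pow_right)).pow_left
    have d3 := d2.dvd_of_dvd_mul_left d1
    rw [show G ^ 6 = (G ^ 2) ^ 3 by ring] at d3
    exact (Int.pow_dvd_pow_iff (by norm_num)).1 d3
  obtain ⟨k, hk⟩ := hGP
  have E3 : (P ^ 3 - 8 * Q ^ 3) * (P ^ 3 + Q ^ 3) ^ 2 = 27 * k ^ 3 * c ^ D := by
    apply mul_left_cancel₀ (pow_ne_zero 6 hG0)
    rw [E2]
    rw [show P ^ 3 = (G ^ 2 * k) ^ 3 by rw [← hk]]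
    ring
  have hP0 : P ≠ 0 := by rintro rfl; simp at hXG; exact hX0 hXG
  have hkP : k ∣ P := ⟨G ^ 2, by rw [hk]; ring⟩
  have hk8 : k ^ 3 ∣ 2 ^ 3 := by
    have hkp3 : k ^ 3 ∣ P ^ 3 := pow_dvd_pow_of_dvd hkP 3
    have d1 : k ^ 3 ∣ 8 * Q ^ 9 := by
      obtain ⟨w, hw⟩ := hkp3
      refine ⟨w * (P ^ 6 - 6 * P ^ 3 * Q ^ 3 - 15 * Q ^ 6) - 27 * c ^ D, ?_⟩
      linear_combination -E3 + (P ^ 6 - 6 * P ^ 3 * Q ^ 3 - 15 * Q ^ 6) * hw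
    have d2 : IsCoprime (k ^ 3) (Q ^ 9) := ((hPQ.of_isCoprime_of_dvd_left hkP)).pow
    have := d2.dvd_of_dvd_mul_right d1
    norm_num
    exact this
  have hk2 : k ∣ 2 := (Int.pow_dvd_pow_iff (by norm_num)).1 hk8
  have hk4 : (k = 1 ∨ k = -1) ∨ (k = 2 ∨ k = -2) := by
    have hle := Int.le_of_dvd (by norm_num) hk2
    have hge := Int.le_of_dvd (by norm_num) ((neg_dvd).2 hk2)
    have : k ≠ 0 := by rintro rfl; simp at hk; exact hP0 hk
    omega
  have hGr : (0:ℝ) < |(G:ℝ)| := abs_pos.2 (by exact_mod_cast hG0)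
  have hPd : 3 * C ^ 5 * |(P:ℝ)| ^ 3 ≤ 8 * |(Q:ℝ)| ^ 3 ∨ 3 * C ^ 5 * (Q:ℝ) ^ 6 ≤ 8 * (P:ℝ) ^ 6 := by
    rcases hdich with h | h
    · left
      rw [hXG, hRG] at h
      push_cast at h
      rw [abs_mul, abs_mul] at h
      have g3 := pow_pos hGr 3
      refine le_of_mul_le_mul_left ?_ g3
      linarith
    · right
      rw [hXG, hRG] at h
      push_cast at h
      have g3 : 0 < (G:ℝ) ^ 6 := by rw [← (by decide : Even 6).pow_abs]; exact pow_pos hGr 6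
      refine le_of_mul_le_mul_left ?_ g3
      linarith
  rcases hk4 with hk1 | hk2'
  · obtain ⟨c', hcc, hcD'⟩ : ∃ c' : ℤ, (c' = c ∨ c' = -c) ∧ k ^ 3 * c ^ D = c' ^ D := by
      rcases hk1 with rfl | rfl
      · exact ⟨c, Or.inl rfl, by ring⟩
      · exact ⟨-c, Or.inr rfl, by rw [hD.neg_pow]; ring⟩
    have hCc : C = |(c':ℝ)| := by
      rcases hcc with rfl | rfl
      · exact hC
      · push_cast; rw [abs_neg]
    have hPo : Odd P := by
      rw [← Int.not_even_iff_odd]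
      intro hPe
      have hPG : P = G ^ 2 ∨ P = - G ^ 2 := by
        rcases hk1 with rfl | rfl
        · left; rw [hk]; ring
        · right; rw [hk]; ring
      have hGe : Even G := by
        rcases hPG with h | h
        · rw [h, Int.even_pow] at hPe; exact hPe.1
        · rw [h, even_neg, Int.even_pow] at hPe; exact hPe.1
      have hce : Even c := by
        have : Even (27 * k ^ 3 * c ^ D) := by
          rw [← E3]
          apply Even.mul_right
          apply Even.sub
          · exact hPe.pow_of_ne_zero (by norm_num)
          · exact Even.mul_right (by decide) _
        have hk3 : Odd (27 * k ^ 3) := by rcases hk1 with rfl | rfl <;> decide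
        rcases Int.even_mul.1 this with h | h
        · exact absurd h (Int.not_even_iff_odd.2 hk3)
        · exact (Int.even_pow.1 h).1
      have := hGc.isUnit_of_dvd' hGe.two_dvd hce.two_dvd
      rw [Int.isUnit_iff] at this
      omega
    refine a3_core P Q c' C D hD hD35 hCc ?_ ?_ hPo hPQ (Or.inl ⟨?_, hPd.symm⟩)
    · rcases hcc with rfl | rfl
      · exact hc0
      · exact neg_ne_zero.2 hc0
    · rcases hcc with rfl | rfl
      · exact hc3
      · exact (dvd_neg).2 hc3
    · rw [E3, mul_assoc, hcD']
  · obtain ⟨c', hcc, hcD'⟩ : ∃ c' : ℤ, (c' = c ∨ c' = -c) ∧ k ^ 3 * c ^ D = -8 * c' ^ D := by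
      rcases hk2' with rfl | rfl
      · exact ⟨-c, Or.inr rfl, by rw [hD.neg_pow]; ring⟩
      · exact ⟨c, Or.inl rfl, by ring⟩
    have hCc : C = |(c':ℝ)| := by
      rcases hcc with rfl | rfl
      · exact hC
      · push_cast; rw [abs_neg]
    have hPe : (2:ℤ) ∣ P := by
      rcases hk2' with rfl | rfl
      · exact hkP
      · exact (neg_dvd).1 hkP
    obtain ⟨q, hq⟩ := hPe
    have hQo : Odd Q := by
      rw [← Int.not_even_iff_odd]
      intro hQe
      have := hPQ.isUnit_of_dvd' ⟨q, hq⟩ hQe.two_dvd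
      rw [Int.isUnit_iff] at this
      omega
    have hqQ : IsCoprime Q (-q) := by
      apply IsCoprime.neg_right
      exact (hPQ.of_isCoprime_of_dvd_left ⟨2, by rw [hq]; ring⟩).symm
    refine a3_core Q (-q) c' C D hD hD35 hCc ?_ ?_ hQo hqQ (Or.inr ⟨?_, ?_, ?_⟩)
    · rcases hcc with rfl | rfl
      · exact hc0
      · exact neg_ne_zero.2 hc0
    · rcases hcc with rfl | rfl
      · exact hc3
      · exact (dvd_neg).2 hc3
    · rw [mul_assoc, hcD', hq] at E3
      apply mul_left_cancel₀ (by norm_num : (-8:ℤ) ≠ 0)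
      linear_combination E3
    · rw [hq] at hPd
      push_cast at hPd ⊢
      rcases hPd with h | h
      · left
        have hb1 : 3 * C ^ 5 * |(q:ℝ)| ^ 3 ≤ |(Q:ℝ)| ^ 3 := by
          rw [abs_mul, abs_of_pos (by norm_num : (0:ℝ) < 2)] at h
          linarith
        have hq0 : 0 ≤ |(q:ℝ)| ^ 3 := by positivity
        have hb2 : |(q:ℝ)| ^ 3 ≤ |(Q:ℝ)| ^ 3 := by nlinarith
        have r6 : (Q:ℝ) ^ 6 = (|(Q:ℝ)| ^ 3) ^ 2 := by rw [← pow_mul, (by decide : Even (3*2)).pow_abs]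
        have x6 : (-(q:ℝ)) ^ 6 = (|(q:ℝ)| ^ 3) ^ 2 := by rw [← pow_mul, (by decide : Even (3*2)).pow_abs]; ring
        rw [r6, x6]
        nlinarith [mul_le_mul hb1 hb2 hq0 (by positivity)]
      · right
        linarith [show (-(q:ℝ)) ^ 6 = (q:ℝ) ^ 6 by ring]
    · intro p hp hp2 hp3 hv
      have hv' : ¬ 3 ∣ padicValInt p c := by
        rcases hcc with rfl | rfl
        · exact hv
        · simpa [padicValInt] using hv
      have hpd := hB p hp hp3 hv'
      have hpc : (p:ℤ) ∣ c := by
        by_contra hcon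
        apply hv'
        rw [padicValInt.eq_zero_of_not_dvd hcon]
        exact dvd_zero 3
      have hpi : Prime (p:ℤ) := Nat.prime_iff_prime_int.1 hp
      have e : X - 2 * R = (-2 * G) * (Q + -q) := by rw [hXG, hRG, hq]; ring
      rw [e] at hpd
      rcases hpi.dvd_or_dvd hpd with h | h
      · exfalso
        rcases hpi.dvd_or_dvd h with h | h
        · rw [dvd_neg] at h
          have h' : p ∣ 2 := by exact_mod_cast h
          exact hp2 ((Nat.prime_dvd_prime_iff_eq hp Nat.prime_two).1 h')
        · exact hpi.not_unit (hGc.isUnit_of_dvd' h hpc)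
      · exact h
end

section
open Polynomial

theorem mem_adj_poly {K : Type*} [Field K] [Algebra ℚ K] (g : K) (m : ℕ) (hm : 1 ≤ m)
    (hdeg : (minpoly ℚ g).natDegree = m) (S : K) (hS : S ∈ IntermediateField.adjoin ℚ {g}) :
    ∃ P : ℚ[X], P.natDegree < m ∧ aeval g P = S := by
  have hintg : IsIntegral ℚ g := by
    by_contra h
    rw [minpoly.eq_zero h] at hdeg
    simp at hdeg
    omega
  rw [← IntermediateField.mem_toSubalgebra, IntermediateField.adjoin_simple_toSubalgebra_of_isAlgebraic hintg.isAlgebraic,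
    Algebra.adjoin_singleton_eq_range_aeval] at hS
  obtain ⟨P, hP⟩ := hS
  have hP : aeval g P = S := hP
  refine ⟨P %ₘ minpoly ℚ g, ?_, ?_⟩
  · rw [← hdeg]
    apply natDegree_modByMonic_lt _ (minpoly.monic hintg)
    intro h1
    rw [h1] at hdeg
    simp at hdeg
    omega
  · rw [← hP]
    exact Polynomial.aeval_modByMonic_eq_self_of_root (minpoly.aeval ℚ g)

theorem poly_zero_of_root {K : Type*} [Field K] [Algebra ℚ K] (g : K) (m : ℕ)
    (hdeg : (minpoly ℚ g).natDegree = m) (P : ℚ[X]) (hP : P.natDegree < m) (h0 : aeval g P = 0) : P = 0 := by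
  by_contra hne
  have := natDegree_le_of_dvd (minpoly.dvd ℚ g h0) hne
  omega

theorem lin_zero {K : Type*} [Field K] [Algebra ℚ K] (g : K) (m : ℕ)
    (hdeg : (minpoly ℚ g).natDegree = m) (a : ℕ → ℚ)
    (h : ∑ i ∈ Finset.range m, algebraMap ℚ K (a i) * g ^ i = 0) (i : ℕ) (hi : i < m) : a i = 0 := by
  have hz := poly_zero_of_root g m hdeg (∑ i ∈ Finset.range m, C (a i) * X ^ i) (by
    rcases Nat.eq_zero_or_pos m with rfl | hm
    · omega
    refine lt_of_le_of_lt (natDegree_sum_le_of_forall_le (n := m - 1) _ _ ?_) (by omega)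
    intro j hj
    refine (natDegree_C_mul_X_pow_le _ _).trans ?_
    have := Finset.mem_range.1 hj
    omega) (by simpa using h)
  have e := congrArg (fun p => coeff p i) hz
  simp [finset_sum_coeff, coeff_C_mul, coeff_X_pow, hi] at e
  exact e

theorem lin3 {K : Type*} [Field K] [Algebra ℚ K] (g : K)
    (hdeg : (minpoly ℚ g).natDegree = 3) (a0 a1 a2 : ℚ)
    (h : algebraMap ℚ K a0 + algebraMap ℚ K a1 * g + algebraMap ℚ K a2 * g ^ 2 = 0) : a0 = 0 ∧ a1 = 0 ∧ a2 = 0 := by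
  have key := lin_zero g 3 hdeg (fun i => ([a0, a1, a2].getD i 0)) (by
    simp [Finset.sum_range_succ, -eq_ratCast]
    linear_combination h)
  exact ⟨key 0 (by norm_num), key 1 (by norm_num), key 2 (by norm_num)⟩

theorem lin6 {K : Type*} [Field K] [Algebra ℚ K] (g : K)
    (hdeg : (minpoly ℚ g).natDegree = 6) (a0 a1 a2 a3 a4 a5 : ℚ)
    (h : algebraMap ℚ K a0 + algebraMap ℚ K a1 * g + algebraMap ℚ K a2 * g ^ 2 + algebraMap ℚ K a3 * g ^ 3
      + algebraMap ℚ K a4 * g ^ 4 + algebraMap ℚ K a5 * g ^ 5 = 0) :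
    a0 = 0 ∧ a1 = 0 ∧ a2 = 0 ∧ a3 = 0 ∧ a4 = 0 ∧ a5 = 0 := by
  have key := lin_zero g 6 hdeg (fun i => ([a0, a1, a2, a3, a4, a5].getD i 0)) (by
    simp [Finset.sum_range_succ, -eq_ratCast]
    linear_combination h)
  exact ⟨key 0 (by norm_num), key 1 (by norm_num), key 2 (by norm_num), key 3 (by norm_num), key 4 (by norm_num), key 5 (by norm_num)⟩

theorem rat_int_of_monic (q : ℚ) (P : ℤ[X]) (hP : P.Monic) (h : aeval q P = 0) : ∃ n : ℤ, (n:ℚ) = q := by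
  have : IsIntegral ℤ q := ⟨P, hP, by simpa [aeval_def] using h⟩
  obtain ⟨n, hn⟩ := IsIntegrallyClosed.isIntegral_iff.1 this
  exact ⟨n, by simpa using hn⟩

theorem field2 {K : Type*} [Field K] [Algebra ℚ K] (g : K) (c R : ℤ) (D : ℕ)
    (hdeg : (minpoly ℚ g).natDegree = 3) (hg : g ^ 3 = - (c:K) ^ D) (S : K)
    (hS : S ∈ IntermediateField.adjoin ℚ {g}) (hS2 : S ^ 2 = (R:K) ^ 2 - g) :
    ∃ X y : ℤ, y ^ 2 = R ^ 6 + c ^ D ∧ X ^ 4 - 6 * R ^ 2 * X ^ 2 - 3 * R ^ 4 = 8 * X * y := by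
  obtain ⟨P, hPd, rfl⟩ := mem_adj_poly g 3 (by norm_num) hdeg S hS
  obtain ⟨x0, x1, x2, rfl⟩ : ∃ x0 x1 x2 : ℚ, P = C x0 + C x1 * X + C x2 * X ^ 2 := by
    refine ⟨P.coeff 0, P.coeff 1, P.coeff 2, ?_⟩
    conv_lhs => rw [P.as_sum_range' 3 hPd]
    simp [Finset.sum_range_succ, ← C_mul_X_pow_eq_monomial]
  set t : ℚ := - (c:ℚ) ^ D with ht
  have hgt : g ^ 3 = algebraMap ℚ K t := by rw [hg, ht]; simp
  have hz := lin3 g hdeg (x0 ^ 2 + 2 * x1 * x2 * t - R ^ 2) (2 * x0 * x1 + x2 ^ 2 * t + 1)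
    (2 * x0 * x2 + x1 ^ 2) (by
      simp only [map_add, map_mul, map_pow, aeval_C, aeval_X, map_sub, map_intCast, map_ofNat, map_one] at hS2 ⊢
      linear_combination hS2 - (2 * algebraMap ℚ K x1 * algebraMap ℚ K x2 + algebraMap ℚ K x2 ^ 2 * g) * hgt)
  obtain ⟨e0, e1, e2⟩ := hz
  set y : ℚ := x0 ^ 3 + x1 ^ 3 * t + x2 ^ 3 * t ^ 2 - 3 * x0 * x1 * x2 * t with hy
  have E0 : x0 ^ 2 + 2 * x1 * x2 * t = R ^ 2 := by linarith
  have E1 : 2 * x0 * x1 + x2 ^ 2 * t = -1 := by linarith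
  have hyy : y ^ 2 = R ^ 6 - t := by
    have n2 : y ^ 2 = (x0 ^ 2 + 2 * x1 * x2 * t) ^ 3 + (2 * x0 * x1 + x2 ^ 2 * t) ^ 3 * t + (2 * x0 * x2 + x1 ^ 2) ^ 3 * t ^ 2
      - 3 * (x0 ^ 2 + 2 * x1 * x2 * t) * (2 * x0 * x1 + x2 ^ 2 * t) * (2 * x0 * x2 + x1 ^ 2) * t := by rw [hy]; ring
    rw [n2, E0, E1, e2]; ring
  have hXX : (3 * x0) ^ 4 - 6 * R ^ 2 * (3 * x0) ^ 2 - 3 * R ^ 4 = 8 * (3 * x0) * y := by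
    rw [show (R:ℚ) ^ 4 = (R ^ 2) ^ 2 by ring, ← E0, hy]
    linear_combination (-24 * x0 * x1 * t - 12 * x2 ^ 2 * t ^ 2) * e2
  obtain ⟨Y, hY⟩ := rat_int_of_monic y (X ^ 2 - C (R ^ 6 + c ^ D)) (monic_X_pow_sub_C _ (by norm_num)) (by
    simp [hyy, ht])
  obtain ⟨Z, hZ⟩ := rat_int_of_monic (3 * x0) (X ^ 4 + (C (- 6 * R ^ 2) * X ^ 2 + C (- 8 * Y) * X + C (- 3 * R ^ 4)))
    (by
      apply monic_X_pow_add
      refine lt_of_le_of_lt degree_quadratic_le (by norm_num)) (by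
    simp only [map_add, map_mul, map_pow, aeval_C, aeval_X, map_neg, map_ofNat, algebraMap_int_eq, eq_intCast, map_intCast, hY]
    linear_combination hXX)
  refine ⟨Z, Y, ?_, ?_⟩
  · rw [← hY] at hyy
    have : ((Y ^ 2 : ℤ) : ℚ) = ((R ^ 6 + c ^ D : ℤ) : ℚ) := by push_cast; rw [hyy, ht]; ring
    exact_mod_cast this
  · rw [← hZ, ← hY] at hXX
    exact_mod_cast hXX
end

section
open Polynomial

/-- Algebra for the cube case. -/
theorem field3 {K : Type*} [Field K] [Algebra ℚ K] (g : K) (c R : ℤ) (D : ℕ)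
    (hdeg : (minpoly ℚ g).natDegree = 6) (hg : g ^ 6 = - (c:K) ^ D) (S : K)
    (hS : S ∈ IntermediateField.adjoin ℚ {g}) (hS3 : S ^ 3 = (R:K) - g) :
    ∃ x0 x1 x2 x3 x4 x5 : ℚ, ∃ X y : ℤ, y ^ 3 = R ^ 6 + c ^ D ∧ X ^ 3 - 3 * y * X = 2 * R ^ 3 ∧
      (X:ℚ) - 2 * R = - 18 * (- (c:ℚ) ^ D * (x0 * x1 * x5 + x0 * x4 * x2 + x3 * x1 * x2) + ((c:ℚ) ^ D) ^ 2 * (x3 * x4 * x5)) ∧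
      ∀ (L : Type) [Field L] [CharZero L] (h : L), h ^ 6 = - (c:L) ^ D →
        ((x0:L) + x1 * h + x2 * h ^ 2 + x3 * h ^ 3 + x4 * h ^ 4 + x5 * h ^ 5) ^ 3 = (R:L) - h := by
  obtain ⟨P, hPd, rfl⟩ := mem_adj_poly g 6 (by norm_num) hdeg S hS
  have hintg : IsIntegral ℚ g := by
    by_contra h
    rw [minpoly.eq_zero h] at hdeg
    simp at hdeg
  obtain ⟨x0, x1, x2, x3, x4, x5, hPx⟩ : ∃ x0 x1 x2 x3 x4 x5 : ℚ,
      P = C x0 + C x1 * X + C x2 * X ^ 2 + C x3 * X ^ 3 + C x4 * X ^ 4 + C x5 * X ^ 5 := by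
    refine ⟨P.coeff 0, P.coeff 1, P.coeff 2, P.coeff 3, P.coeff 4, P.coeff 5, ?_⟩
    conv_lhs => rw [P.as_sum_range' 6 hPd]
    simp [Finset.sum_range_succ, ← C_mul_X_pow_eq_monomial]
  set t : ℚ := - (c:ℚ) ^ D with ht
  have hgt : g ^ 6 = algebraMap ℚ K t := by rw [hg, ht]; simp
  have hmin : X ^ 6 - C t = minpoly ℚ g := by
    apply minpoly.unique_of_degree_le_degree_minpoly
    · exact monic_X_pow_sub_C _ (by norm_num)
    · simp only [map_sub, map_pow, aeval_X, aeval_C, hgt, sub_self]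
    · rw [degree_X_pow_sub_C (by norm_num), degree_eq_natDegree (minpoly.ne_zero hintg), hdeg]
      try exact le_refl _
  have hdvd : X ^ 6 - C t ∣ P ^ 3 - (C (R:ℚ) - X) := by
    rw [hmin]
    apply minpoly.dvd
    simp only [map_sub, map_pow, aeval_X, aeval_C, hS3, map_intCast, sub_self]
  set u : K := g ^ 3 with hu
  have hu2 : u ^ 2 = algebraMap ℚ K t := by rw [← hgt, hu]; ring
  let φ : ℚ →+* K := algebraMap ℚ K
  set A0 : K := algebraMap ℚ K x0 + algebraMap ℚ K x3 * u with hA0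
  set A1 : K := algebraMap ℚ K x1 + algebraMap ℚ K x4 * u with hA1
  set A2 : K := algebraMap ℚ K x2 + algebraMap ℚ K x5 * u with hA2
  set T := Algebra.adjoin ℚ {u} with hT
  have huT : u ∈ T := Algebra.subset_adjoin rfl
  have hTform : ∀ z ∈ T, ∃ p q : ℚ, z = algebraMap ℚ K p + algebraMap ℚ K q * u := by
    intro z hz
    induction hz using Algebra.adjoin_induction with
    | mem z hz => exact ⟨0, 1, by rw [Set.mem_singleton_iff.1 hz]; simp⟩
    | algebraMap r => exact ⟨r, 0, by simp⟩
    | add a b _ _ iha ihb =>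
      obtain ⟨p, q, rfl⟩ := iha
      obtain ⟨p', q', rfl⟩ := ihb
      exact ⟨p + p', q + q', by simp only [map_add]; ring⟩
    | mul a b _ _ iha ihb =>
      obtain ⟨p, q, rfl⟩ := iha
      obtain ⟨p', q', rfl⟩ := ihb
      refine ⟨p * p' + q * q' * t, p * q' + q * p', ?_⟩
      simp only [map_add, map_mul]
      linear_combination algebraMap ℚ K q * algebraMap ℚ K q' * hu2
  have hA0T : A0 ∈ T := T.add_mem (T.algebraMap_mem _) (T.mul_mem (T.algebraMap_mem _) huT)
  have hA1T : A1 ∈ T := T.add_mem (T.algebraMap_mem _) (T.mul_mem (T.algebraMap_mem _) huT)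
  have hA2T : A2 ∈ T := T.add_mem (T.algebraMap_mem _) (T.mul_mem (T.algebraMap_mem _) huT)
  have hRT : (R:K) ∈ T := by
    have := T.algebraMap_mem (R:ℚ)
    simpa using this
  have hn : ∀ n : ℕ, (n:K) ∈ T := fun n => T.natCast_mem n
  have hSA : aeval g P = A0 + A1 * g + A2 * g ^ 2 := by
    rw [hPx, hA0, hA1, hA2, hu]
    simp only [map_add, map_mul, map_pow, aeval_C, aeval_X]
    ring
  have b0T : A0 ^ 3 + A1 ^ 3 * u + A2 ^ 3 * u ^ 2 + (6:ℕ) * A0 * A1 * A2 * u - R ∈ T :=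
    T.sub_mem (T.add_mem (T.add_mem (T.add_mem (T.pow_mem hA0T 3) (T.mul_mem (T.pow_mem hA1T 3) huT))
      (T.mul_mem (T.pow_mem hA2T 3) (T.pow_mem huT 2)))
      (T.mul_mem (T.mul_mem (T.mul_mem (T.mul_mem (hn 6) hA0T) hA1T) hA2T) huT)) hRT
  have b1T : (3:ℕ) * (A0 ^ 2 * A1 + A1 ^ 2 * A2 * u + A2 ^ 2 * A0 * u) + (1:ℕ) ∈ T :=
    T.add_mem (T.mul_mem (hn 3) (T.add_mem (T.add_mem (T.mul_mem (T.pow_mem hA0T 2) hA1T)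
      (T.mul_mem (T.mul_mem (T.pow_mem hA1T 2) hA2T) huT)) (T.mul_mem (T.mul_mem (T.pow_mem hA2T 2) hA0T) huT))) (hn 1)
  have b2T : (3:ℕ) * (A0 ^ 2 * A2 + A0 * A1 ^ 2 + A1 * A2 ^ 2 * u) ∈ T :=
    T.mul_mem (hn 3) (T.add_mem (T.add_mem (T.mul_mem (T.pow_mem hA0T 2) hA2T)
      (T.mul_mem hA0T (T.pow_mem hA1T 2))) (T.mul_mem (T.mul_mem hA1T (T.pow_mem hA2T 2)) huT))
  obtain ⟨p0, q0, h0⟩ := hTform _ b0T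
  obtain ⟨p1, q1, h1⟩ := hTform _ b1T
  obtain ⟨p2, q2, h2⟩ := hTform _ b2T
  rw [hSA] at hS3
  have key := lin6 g hdeg p0 p1 p2 q0 q1 q2 (by
    push_cast at h0 h1 h2
    linear_combination hS3 - h0 - g * h1 - g ^ 2 * h2 + (A1 ^ 3 + 6 * A0 * A1 * A2 + 3 * A1 ^ 2 * A2 * g + 3 * A0 * A2 ^ 2 * g + 3 * A1 * A2 ^ 2 * g ^ 2 + A2 ^ 3 * (g ^ 3 + u)) * hu)
  obtain ⟨rfl, rfl, rfl, rfl, rfl, rfl⟩ := key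
  simp only [map_zero, zero_mul, add_zero] at h0 h1 h2
  push_cast at h0 h1 h2
  set k0 : ℚ := t * (x0 * x1 * x5 + x0 * x4 * x2 + x3 * x1 * x2) + t ^ 2 * (x3 * x4 * x5) with hk0
  set k1 : ℚ := x0 * x1 * x2 + t * (x0 * x4 * x5 + x3 * x1 * x5 + x3 * x4 * x2) with hk1
  have hκ : A0 * A1 * A2 * u = algebraMap ℚ K k0 + algebraMap ℚ K k1 * u := by
    rw [hk0, hk1, hA0, hA1, hA2]
    simp only [map_add, map_mul, map_pow, ← hu2]
    ring
  set e : ℚ := R - 9 * k0 with he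
  set f : ℚ := - 9 * k1 with hf
  have hs2 : (algebraMap ℚ K e + algebraMap ℚ K f * u) = A0 ^ 3 + A1 ^ 3 * u + A2 ^ 3 * u ^ 2 - 3 * A0 * A1 * A2 * u := by
    rw [he, hf]
    simp only [map_sub, map_mul, map_neg, map_ofNat, map_intCast]
    linear_combination -h0 + 9 * hκ
  have hs3 : (algebraMap ℚ K e + algebraMap ℚ K f * u) ^ 3 = (R:K) ^ 3 - u := by
    have n0 : A0 ^ 3 + A1 ^ 3 * u + A2 ^ 3 * u ^ 2 + 6 * A0 * A1 * A2 * u = R := by linear_combination h0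
    have n1 : 3 * (A0 ^ 2 * A1 + A1 ^ 2 * A2 * u + A2 ^ 2 * A0 * u) = -1 := by linear_combination h1
    have nn : (A0 ^ 3 + A1 ^ 3 * u + A2 ^ 3 * u ^ 2 - 3 * A0 * A1 * A2 * u) ^ 3 =
      (A0 ^ 3 + A1 ^ 3 * u + A2 ^ 3 * u ^ 2 + 6 * A0 * A1 * A2 * u) ^ 3
      + (3 * (A0 ^ 2 * A1 + A1 ^ 2 * A2 * u + A2 ^ 2 * A0 * u)) ^ 3 * u
      + (3 * (A0 ^ 2 * A2 + A0 * A1 ^ 2 + A1 * A2 ^ 2 * u)) ^ 3 * u ^ 2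
      - 3 * (A0 ^ 3 + A1 ^ 3 * u + A2 ^ 3 * u ^ 2 + 6 * A0 * A1 * A2 * u) * (3 * (A0 ^ 2 * A1 + A1 ^ 2 * A2 * u + A2 ^ 2 * A0 * u)) *
        (3 * (A0 ^ 2 * A2 + A0 * A1 ^ 2 + A1 * A2 ^ 2 * u)) * u := by
      clear_value A0 A1 A2 u
      ring
    rw [hs2, nn, n0, n1, h2]
    ring
  have key2 := lin6 g hdeg (e ^ 3 + 3 * e * f ^ 2 * t - R ^ 3) 0 0 (3 * e ^ 2 * f + f ^ 3 * t + 1) 0 0 (by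
    simp only [map_sub, map_add, map_mul, map_pow, map_ofNat, map_intCast, map_zero, map_one, ← hu2, ← hu]
    linear_combination hs3)
  obtain ⟨E0, -, -, E3, -, -⟩ := key2
  have hyy : (e ^ 2 - f ^ 2 * t) ^ 3 = R ^ 6 - t := by
    have : (e ^ 2 - f ^ 2 * t) ^ 3 = (e ^ 3 + 3 * e * f ^ 2 * t) ^ 2 - (3 * e ^ 2 * f + f ^ 3 * t) ^ 2 * t := by ring
    rw [this, sub_eq_zero.1 E0, eq_neg_of_add_eq_zero_left E3]
    ring
  obtain ⟨Y, hY⟩ := rat_int_of_monic (e ^ 2 - f ^ 2 * t) (X ^ 3 - C (R ^ 6 + c ^ D)) (monic_X_pow_sub_C _ (by norm_num)) (by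
    simp only [map_sub, map_pow, aeval_X, aeval_C]
    rw [hyy, ht]
    simp)
  obtain ⟨Z, hZ⟩ := rat_int_of_monic (2 * e) (X ^ 3 + (C (- 3 * Y) * X + C (- 2 * R ^ 3)))
    (by
      apply monic_X_pow_add
      refine lt_of_le_of_lt degree_linear_le (by norm_num)) (by
    simp only [map_add, map_mul, map_pow, aeval_C, aeval_X, map_neg, map_ofNat, algebraMap_int_eq, eq_intCast, map_intCast, hY]
    linear_combination 2 * E0)
  refine ⟨x0, x1, x2, x3, x4, x5, Z, Y, ?_, ?_, ?_, ?_⟩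
  · rw [← hY] at hyy
    have : ((Y ^ 3 : ℤ) : ℚ) = ((R ^ 6 + c ^ D : ℤ) : ℚ) := by push_cast; rw [hyy, ht]; ring
    exact_mod_cast this
  · have : (Z:ℚ) ^ 3 - 3 * Y * Z = 2 * R ^ 3 := by
      rw [hZ, hY]
      linear_combination 2 * E0
    exact_mod_cast this
  · rw [hZ, he, hk0, ht]
    ring
  · intro L _ _ h hh
    have hev : aeval h (P ^ 3 - (C (R:ℚ) - X)) = 0 := by
      obtain ⟨W, hW⟩ := hdvd
      rw [hW, map_mul]
      simp [ht, hh]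
    rw [hPx] at hev
    simp only [map_sub, map_add, map_mul, map_pow, aeval_C, aeval_X, eq_ratCast, Rat.cast_intCast] at hev
    linear_combination hev
end

section
theorem pl_norm_rat (p : ℕ) [Fact p.Prime] (q : ℚ) : ‖(q : PadicAlgCl p)‖ = ((padicNorm p q : ℚ) : ℝ) := by
  have h := PadicAlgCl.norm_extends p (q : ℚ_[p])
  rw [Padic.eq_padicNorm] at h
  rw [← h]
  congr 1

theorem pl_norm_rat_zpow (p : ℕ) [Fact p.Prime] (q : ℚ) (hq : q ≠ 0) : ‖(q : PadicAlgCl p)‖ = (p:ℝ) ^ (- padicValRat p q) := by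
  rw [pl_norm_rat, padicNorm.eq_zpow_of_nonzero hq]
  push_cast
  rfl

theorem pl_norm_int (p : ℕ) [Fact p.Prime] (n : ℤ) : ‖(n : PadicAlgCl p)‖ ≤ 1 := by
  have := pl_norm_rat p n
  rw [Rat.cast_intCast] at this
  rw [this]
  exact_mod_cast padicNorm.of_int n

theorem pl_norm_int_lt (p : ℕ) [Fact p.Prime] (n : ℤ) (h : ‖(n : PadicAlgCl p)‖ < 1) : (p:ℤ) ∣ n := by
  have := pl_norm_rat p n
  rw [Rat.cast_intCast] at this
  rw [this] at h
  exact (padicNorm.int_lt_one_iff n).1 (by exact_mod_cast h)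

theorem pl_norm_three (p : ℕ) [hp : Fact p.Prime] (h3 : p ≠ 3) : ‖(3 : PadicAlgCl p)‖ = 1 := by
  have h1 := pl_norm_int p 3
  push_cast at h1
  rcases lt_or_eq_of_le h1 with h | h
  · have := pl_norm_int_lt p 3 (by push_cast; exact h)
    exact absurd ((Nat.prime_dvd_prime_iff_eq hp.out Nat.prime_three).1 (by exact_mod_cast this)) h3
  · exact h

theorem pl_normsq (p : ℕ) [hp : Fact p.Prime] (a b t : ℚ) (u : PadicAlgCl p) (hu : u ^ 2 = (t : PadicAlgCl p))
    (hA : (a : PadicAlgCl p) + b * u ≠ 0) : ∃ k : ℤ, ‖(a : PadicAlgCl p) + b * u‖ ^ 2 = (p:ℝ) ^ k := by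
  have hp0 : (p:ℝ) ≠ 0 := by exact_mod_cast hp.out.ne_zero
  by_cases hB : (a : PadicAlgCl p) - b * u = 0
  · have e : (a : PadicAlgCl p) + b * u = ((2 * a : ℚ) : PadicAlgCl p) := by
      push_cast
      linear_combination - hB
    have hne : (2 * a : ℚ) ≠ 0 := by
      intro h
      rw [e, h] at hA
      simp at hA
    rw [e, pl_norm_rat_zpow p _ hne]
    exact ⟨_, by rw [← zpow_natCast, ← zpow_mul]⟩
  have hprod : ((a : PadicAlgCl p) + b * u) * (a - b * u) = ((a ^ 2 - b ^ 2 * t : ℚ) : PadicAlgCl p) := by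
    push_cast
    linear_combination - (b : PadicAlgCl p) ^ 2 * hu
  have hne : (a ^ 2 - b ^ 2 * t : ℚ) ≠ 0 := by
    intro h
    rw [h] at hprod
    simp at hprod
    rcases hprod with h | h
    · exact hA h
    · exact hB h
  have hn := congrArg norm hprod
  rw [norm_mul, pl_norm_rat_zpow p _ hne] at hn
  have hApos : 0 < ‖(a : PadicAlgCl p) + b * u‖ := norm_pos_iff.2 hA
  by_cases heq : ‖(a : PadicAlgCl p) + b * u‖ = ‖(a : PadicAlgCl p) - b * u‖
  · exact ⟨_, by rw [← hn, ← heq, sq]⟩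
  have hmax := IsUltrametricDist.norm_add_eq_max_of_norm_ne_norm heq
  rw [show (a : PadicAlgCl p) + b * u + (a - b * u) = ((2 * a : ℚ) : PadicAlgCl p) by push_cast; ring] at hmax
  have hne2 : (2 * a : ℚ) ≠ 0 := by
    intro h
    rw [h] at hmax
    simp at hmax
    have := le_max_left ‖(a : PadicAlgCl p) + b * u‖ ‖(a : PadicAlgCl p) - b * u‖
    linarith
  rw [pl_norm_rat_zpow p _ hne2] at hmax
  rcases max_choice ‖(a : PadicAlgCl p) + b * u‖ ‖(a : PadicAlgCl p) - b * u‖ with h | h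
  · rw [h] at hmax
    exact ⟨_, by rw [← hmax, ← zpow_natCast, ← zpow_mul]⟩
  · rw [h] at hmax
    rw [← hmax] at hn
    have : ‖(a : PadicAlgCl p) + b * u‖ = (p:ℝ) ^ (-padicValRat p (a ^ 2 - b ^ 2 * t) - (-padicValRat p (2 * a))) := by
      rw [zpow_sub₀ hp0, eq_div_iff (zpow_ne_zero _ hp0), hn]
    exact ⟨_, by rw [this, ← zpow_natCast, ← zpow_mul]⟩

theorem pl_kappa (p : ℕ) [hp : Fact p.Prime] (h3 : p ≠ 3) (c R : ℤ) (hc : c ≠ 0) (D : ℕ) (hD3 : Nat.Coprime 3 D)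
    (hv : ¬ 3 ∣ padicValInt p c) (x0 x1 x2 x3 x4 x5 : ℚ)
    (hS : ∀ h : PadicAlgCl p, h ^ 6 = - (c:PadicAlgCl p) ^ D →
        ((x0:PadicAlgCl p) + x1 * h + x2 * h ^ 2 + x3 * h ^ 3 + x4 * h ^ 4 + x5 * h ^ 5) ^ 3 = (R:PadicAlgCl p) - h)
    (h : PadicAlgCl p) (hh : h ^ 6 = - (c:PadicAlgCl p) ^ D) :
    ‖((x0:PadicAlgCl p) + x3 * h ^ 3) * (x1 + x4 * h ^ 3) * (x2 + x5 * h ^ 3) * h ^ 3‖ < 1 := by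
  have hp0 : (p:ℝ) ≠ 0 := by exact_mod_cast hp.out.ne_zero
  obtain ⟨s, hs⟩ := IsAlgClosed.exists_pow_nat_eq (-3 : PadicAlgCl p) (n := 2) (by norm_num)
  obtain ⟨w, hw⟩ : ∃ w : PadicAlgCl p, w ^ 2 + w + 1 = 0 := ⟨(-1 + s) / 2, by
    field_simp
    linear_combination hs⟩
  have hw3 : w ^ 3 = 1 := by linear_combination (w - 1) * hw
  have hwn : ‖w‖ = 1 := by
    have := congrArg norm hw3
    rw [norm_pow, norm_one] at this
    exact (pow_eq_one_iff_of_nonneg (norm_nonneg _) (by norm_num)).1 this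
  have hhn6 : ‖h‖ ^ 6 = ‖(c:PadicAlgCl p)‖ ^ D := by
    rw [← norm_pow, hh, norm_neg, norm_pow]
  have hhn : ‖h‖ ≤ 1 := by
    have : ‖h‖ ^ 6 ≤ 1 := by rw [hhn6]; exact pow_le_one₀ (norm_nonneg _) (pl_norm_int p c)
    exact (pow_le_one_iff_of_nonneg (norm_nonneg _) (by norm_num)).1 this
  have add2 : ∀ a b : PadicAlgCl p, ‖a‖ ≤ 1 → ‖b‖ ≤ 1 → ‖a + b‖ ≤ 1 := fun a b ha hb =>
    (IsUltrametricDist.norm_add_le_max a b).trans (max_le ha hb)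
  have hSn : ∀ z : PadicAlgCl p, z ^ 6 = - (c:PadicAlgCl p) ^ D → ‖z‖ ≤ 1 →
     ‖(x0:PadicAlgCl p) + x1 * z + x2 * z ^ 2 + x3 * z ^ 3 + x4 * z ^ 4 + x5 * z ^ 5‖ ≤ 1 := by
    intro z hz hzn
    have e := congrArg norm (hS z hz)
    rw [norm_pow] at e
    have : ‖(R:PadicAlgCl p) - z‖ ≤ 1 := by
      rw [sub_eq_add_neg]
      exact add2 _ _ (pl_norm_int p R) (by rw [norm_neg]; exact hzn)
    rw [← e] at this
    exact (pow_le_one_iff_of_nonneg (norm_nonneg _) (by norm_num)).1 this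
  have w6 : w ^ 6 = 1 := by rw [show w ^ 6 = (w ^ 3) ^ 2 by ring, hw3]; ring
  have n0 := hSn h hh hhn
  have n1 := hSn (w * h) (by rw [mul_pow, w6, one_mul, hh]) (by rw [norm_mul, hwn, one_mul]; exact hhn)
  have n2 := hSn (w ^ 2 * h) (by rw [mul_pow, ← pow_mul, mul_comm 2 6, pow_mul, w6, one_pow, one_mul, hh])
    (by rw [norm_mul, norm_pow, hwn, one_pow, one_mul]; exact hhn)
  set S0 := (x0:PadicAlgCl p) + x1 * h + x2 * h ^ 2 + x3 * h ^ 3 + x4 * h ^ 4 + x5 * h ^ 5 with hS0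
  set S1 := (x0:PadicAlgCl p) + x1 * (w * h) + x2 * (w * h) ^ 2 + x3 * (w * h) ^ 3 + x4 * (w * h) ^ 4 + x5 * (w * h) ^ 5 with hS1
  set S2 := (x0:PadicAlgCl p) + x1 * (w ^ 2 * h) + x2 * (w ^ 2 * h) ^ 2 + x3 * (w ^ 2 * h) ^ 3 + x4 * (w ^ 2 * h) ^ 4 + x5 * (w ^ 2 * h) ^ 5 with hS2
  set A0 := (x0:PadicAlgCl p) + x3 * h ^ 3 with hA0
  set A1 := (x1:PadicAlgCl p) + x4 * h ^ 3 with hA1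
  set A2 := (x2:PadicAlgCl p) + x5 * h ^ 3 with hA2
  have f0 : S0 = A0 + A1 * h + A2 * h ^ 2 := by rw [hS0, hA0, hA1, hA2]; ring
  have f1 : S1 = A0 + w * (A1 * h) + w ^ 2 * (A2 * h ^ 2) := by
    rw [hS1, hA0, hA1, hA2]
    linear_combination (x3 * h ^ 3 + x4 * w * h ^ 4 + x5 * w ^ 2 * h ^ 5) * hw3
  have f2 : S2 = A0 + w ^ 2 * (A1 * h) + w * (A2 * h ^ 2) := by
    rw [hS2, hA0, hA1, hA2]
    linear_combination (x2 * w * h ^ 2 + x3 * h ^ 3 * (w ^ 3 + 1) + x4 * h ^ 4 * (w ^ 5 + w ^ 2) + x5 * h ^ 5 * (w ^ 7 + w ^ 4 + w)) * hw3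
  have t3 := pl_norm_three p h3
  have m0 : ‖A0‖ ≤ 1 := by
    have : 3 * A0 = S0 + S1 + S2 := by
      rw [f0, f1, f2]; linear_combination - (A1 * h + A2 * h ^ 2) * hw
    have e := congrArg norm this
    rw [norm_mul, t3, one_mul] at e
    rw [e]
    exact add2 _ _ (add2 _ _ n0 n1) n2
  have m1 : ‖A1 * h‖ ≤ 1 := by
    have : 3 * (A1 * h) = S0 + w ^ 2 * S1 + w * S2 := by
      rw [f0, f1, f2]
      linear_combination - (A0 + A2 * h ^ 2) * hw - (2 * (A1 * h) + A2 * h ^ 2 * w) * hw3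
    have e := congrArg norm this
    rw [norm_mul, t3, one_mul] at e
    rw [e]
    exact add2 _ _ (add2 _ _ n0 (by rw [norm_mul, norm_pow, hwn]; simpa using n1)) (by rw [norm_mul, hwn]; simpa using n2)
  have m2 : ‖A2 * h ^ 2‖ ≤ 1 := by
    have : 3 * (A2 * h ^ 2) = S0 + w * S1 + w ^ 2 * S2 := by
      rw [f0, f1, f2]
      linear_combination - (A0 + A1 * h) * hw - (2 * (A2 * h ^ 2) + A1 * h * w) * hw3
    have e := congrArg norm this
    rw [norm_mul, t3, one_mul] at e
    rw [e]
    exact add2 _ _ (add2 _ _ n0 (by rw [norm_mul, hwn]; simpa using n1)) (by rw [norm_mul, norm_pow, hwn]; simpa using n2)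
  have m1' : ‖A1 * h‖ < 1 := by
    refine lt_of_le_of_ne m1 ?_
    intro he
    have hA1ne : A1 ≠ 0 := by
      intro h0
      rw [h0] at he
      simp at he
    obtain ⟨k, hk⟩ := pl_normsq p x1 x4 (- (c:ℚ) ^ D) (h ^ 3) (by push_cast; rw [← hh]; ring) hA1ne
    rw [← hA1] at hk
    have e6 : ‖A1‖ ^ 6 * ‖h‖ ^ 6 = 1 := by rw [← mul_pow, ← norm_mul, he, one_pow]
    have hcn := pl_norm_rat_zpow p (c:ℚ) (by exact_mod_cast hc)
    rw [Rat.cast_intCast, padicValRat.of_int] at hcn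
    rw [hhn6, show ‖A1‖ ^ 6 = (‖A1‖ ^ 2) ^ 3 by ring, hk, hcn, ← zpow_natCast, ← zpow_mul, ← zpow_natCast, ← zpow_mul,
      ← zpow_add₀ hp0] at e6
    have hz := (zpow_eq_one_iff_right₀ (by positivity) (by exact_mod_cast hp.out.one_lt.ne')).1 e6
    push_cast at hz
    have hdv : (3:ℤ) ∣ (padicValInt p c : ℤ) * D := ⟨k, by linarith⟩
    have hdv' : 3 ∣ padicValInt p c * D := by exact_mod_cast hdv
    exact hv (hD3.dvd_of_dvd_mul_right hdv')
  have : A0 * A1 * A2 * h ^ 3 = A0 * (A1 * h) * (A2 * h ^ 2) := by ring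
  rw [this, norm_mul, norm_mul]
  calc ‖A0‖ * ‖A1 * h‖ * ‖A2 * h ^ 2‖ ≤ 1 * ‖A1 * h‖ * 1 := by gcongr
    _ < 1 := by linarith

theorem padicB (p : ℕ) (hp : p.Prime) (h3 : p ≠ 3) (c R X : ℤ) (hc : c ≠ 0) (D : ℕ) (hD3 : Nat.Coprime 3 D)
    (hv : ¬ 3 ∣ padicValInt p c) (x0 x1 x2 x3 x4 x5 : ℚ)
    (hX : (X:ℚ) - 2 * R = - 18 * (- (c:ℚ) ^ D * (x0 * x1 * x5 + x0 * x4 * x2 + x3 * x1 * x2) + ((c:ℚ) ^ D) ^ 2 * (x3 * x4 * x5)))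
    (hS : ∀ (L : Type) [Field L] [CharZero L] (h : L), h ^ 6 = - (c:L) ^ D →
        ((x0:L) + x1 * h + x2 * h ^ 2 + x3 * h ^ 3 + x4 * h ^ 4 + x5 * h ^ 5) ^ 3 = (R:L) - h) :
    (p:ℤ) ∣ X - 2 * R := by
  haveI : Fact p.Prime := ⟨hp⟩
  apply pl_norm_int_lt p
  obtain ⟨h, hh⟩ := IsAlgClosed.exists_pow_nat_eq (- (c:PadicAlgCl p) ^ D) (n := 6) (by norm_num)
  have k1 := pl_kappa p h3 c R hc D hD3 hv x0 x1 x2 x3 x4 x5 (hS (PadicAlgCl p)) h hh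
  have k2 := pl_kappa p h3 c R hc D hD3 hv x0 x1 x2 x3 x4 x5 (hS (PadicAlgCl p)) (-h) (by rw [← hh]; ring)
  have hXL : ((X - 2 * R : ℤ) : PadicAlgCl p) = (-9 : ℤ) * (((x0:PadicAlgCl p) + x3 * h ^ 3) * (x1 + x4 * h ^ 3) * (x2 + x5 * h ^ 3) * h ^ 3
      + ((x0:PadicAlgCl p) + x3 * (-h) ^ 3) * (x1 + x4 * (-h) ^ 3) * (x2 + x5 * (-h) ^ 3) * (-h) ^ 3) := by
    have e := congrArg (fun q : ℚ => (q : PadicAlgCl p)) hX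
    push_cast at e ⊢
    rw [e]
    have hh' : (c:PadicAlgCl p) ^ D = - h ^ 6 := by rw [hh]; ring
    rw [hh']
    ring
  rw [hXL, norm_mul]
  have b1 := pl_norm_int p (-9)
  have b2 := lt_of_le_of_lt (IsUltrametricDist.norm_add_le_max (((x0:PadicAlgCl p) + x3 * h ^ 3) * (x1 + x4 * h ^ 3) * (x2 + x5 * h ^ 3) * h ^ 3) (((x0:PadicAlgCl p) + x3 * (-h) ^ 3) * (x1 + x4 * (-h) ^ 3) * (x2 + x5 * (-h) ^ 3) * (-h) ^ 3)) (max_lt k1 k2)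
  exact lt_of_le_of_lt (mul_le_of_le_one_left (norm_nonneg _) b1) b2
end

section
open Polynomial Module

theorem norm_sub_eq_eval {k K : Type*} [Field k] [Field K] [Algebra k K] [FiniteDimensional k K] (x : K)
    (hdeg : (minpoly k x).natDegree = finrank k K) (e : k) :
    Algebra.norm k (algebraMap k K e - x) = (minpoly k x).eval e := by
  have h1 : (Algebra.lmul k K x).charpoly = minpoly k x := by
    apply minpoly.unique_of_degree_le_degree_minpoly
    · exact LinearMap.charpoly_monic _
    · have h := LinearMap.aeval_self_charpoly (Algebra.lmul k K x)
      rw [Polynomial.aeval_algHom_apply] at h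
      have := congrArg (fun φ : Module.End k K => φ 1) h
      simpa using this
    · rw [degree_eq_natDegree (LinearMap.charpoly_monic _).ne_zero, LinearMap.charpoly_natDegree,
        degree_eq_natDegree (minpoly.ne_zero (IsIntegral.of_finite k x)), hdeg]
  rw [← h1, LinearMap.eval_charpoly, Algebra.norm_apply]
  congr 1
  rw [map_sub, AlgHom.commutes]

theorem relnorm {𝔽 K : Type*} [Field 𝔽] [Field K] [Algebra 𝔽 K] (x : K) (hx : IntermediateField.adjoin 𝔽 {x} = ⊤)
    (hxi : IsIntegral 𝔽 x)
    (A : 𝔽[X]) (hA : A.Monic) (M m m' : ℕ) (hM : A.natDegree = M) (hM1 : 1 ≤ M) (hm : 1 ≤ m) (hm' : 1 ≤ m')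
    (hdeg : (minpoly 𝔽 x).natDegree = M * (m * m')) (q : 𝔽) (hq : (aeval x A) ^ (m * m') = algebraMap 𝔽 K q)
    (b : 𝔽) (hb : b ≠ 0) (g : K) (hg : g = algebraMap 𝔽 K b * (aeval x A) ^ m') :
    (minpoly 𝔽 g).natDegree = m ∧ finrank (IntermediateField.adjoin 𝔽 {g}) K = M * m' ∧
    FiniteDimensional (IntermediateField.adjoin 𝔽 {g}) K ∧
    ∀ e : 𝔽, algebraMap (IntermediateField.adjoin 𝔽 {g}) K (Algebra.norm (IntermediateField.adjoin 𝔽 {g}) (algebraMap 𝔽 K e - x))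
      = algebraMap 𝔽 K ((A.eval e) ^ m') - (aeval x A) ^ m' := by
  have hfin : FiniteDimensional 𝔽 K := by
    have : FiniteDimensional 𝔽 (IntermediateField.adjoin 𝔽 {x}) := IntermediateField.adjoin.finiteDimensional hxi
    rw [hx] at this
    exact (IntermediateField.topEquiv (F := 𝔽) (E := K)).toLinearEquiv.finiteDimensional
  have hfr : finrank 𝔽 K = M * (m * m') := by
    rw [← hdeg, ← IntermediateField.adjoin.finrank hxi, hx, IntermediateField.finrank_top']
  set k := IntermediateField.adjoin 𝔽 {g} with hk
  have hgi : IsIntegral 𝔽 g := IsIntegral.of_finite 𝔽 g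
  have hbK : algebraMap 𝔽 K b ≠ 0 := (_root_.map_ne_zero _).2 hb
  set α := aeval x A with hα
  have hβ : α ^ m' ∈ k := by
    have : α ^ m' = algebraMap 𝔽 K b⁻¹ * g := by
      rw [hg, ← mul_assoc, ← map_mul, inv_mul_cancel₀ hb, map_one, one_mul]
    rw [this]
    exact k.mul_mem (k.algebraMap_mem _) (IntermediateField.mem_adjoin_simple_self 𝔽 g)
  have hm1 : (minpoly 𝔽 g).natDegree ≤ m := by
    have hroot : aeval g (X ^ m - C (b ^ m * q)) = 0 := by
      simp only [map_sub, map_pow, aeval_X, aeval_C, map_mul]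
      rw [hg, mul_pow, ← pow_mul, mul_comm m' m, hq]
      ring
    have := natDegree_le_of_dvd (minpoly.dvd 𝔽 g hroot) (X_pow_sub_C_ne_zero hm _)
    rwa [natDegree_X_pow_sub_C] at this
  set F : k[X] := (A.map (algebraMap 𝔽 k)) ^ m' - C ⟨α ^ m', hβ⟩ with hF
  have hAm : (A.map (algebraMap 𝔽 k)).Monic := hA.map _
  have hnd : ((A.map (algebraMap 𝔽 k)) ^ m').natDegree = M * m' := by
    rw [hAm.natDegree_pow, hA.natDegree_map, hM, mul_comm]
  have hMm : 0 < M * m' := Nat.mul_pos hM1 hm'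
  have hdl : (C (⟨α ^ m', hβ⟩ : k)).degree < ((A.map (algebraMap 𝔽 k)) ^ m').degree := by
    refine lt_of_le_of_lt degree_C_le ?_
    rw [degree_eq_natDegree (hAm.pow m').ne_zero, hnd]
    exact_mod_cast hMm
  have hFm : F.Monic := (hAm.pow m').sub_of_left hdl
  have hFd : F.natDegree = M * m' := by
    rw [hF, natDegree_sub_eq_left_of_natDegree_lt, hnd]
    rw [hnd, natDegree_C]
    exact hMm
  have hFx : aeval x F = 0 := by
    rw [hF]
    simp only [map_sub, map_pow, aeval_C, aeval_map_algebraMap, ← hα]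
    exact sub_self _
  have hkx : IntermediateField.adjoin k {x} = ⊤ := by
    rw [← IntermediateField.restrictScalars_eq_top_iff (K := 𝔽), eq_top_iff, ← hx, IntermediateField.adjoin_simple_le_iff]
    exact IntermediateField.mem_adjoin_simple_self k x
  have hfk : FiniteDimensional k K := inferInstance
  have hxk : IsIntegral k x := IsIntegral.of_finite k x
  have hfrk : finrank k K = (minpoly k x).natDegree := by
    rw [← IntermediateField.adjoin.finrank hxk, hkx, IntermediateField.finrank_top']
  have hn1 : (minpoly k x).natDegree ≤ M * m' := by
    rw [← hFd]
    exact natDegree_le_of_dvd (minpoly.dvd k x hFx) hFm.ne_zero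
  have htow : finrank 𝔽 k * finrank k K = finrank 𝔽 K := finrank_mul_finrank 𝔽 k K
  have hkf : finrank 𝔽 k = (minpoly 𝔽 g).natDegree := IntermediateField.adjoin.finrank hgi
  rw [hkf, hfrk, hfr] at htow
  have e1 : (minpoly 𝔽 g).natDegree = m := by
    refine le_antisymm hm1 ?_
    by_contra hlt
    have : (minpoly 𝔽 g).natDegree * (minpoly k x).natDegree < m * (M * m') :=
      lt_of_le_of_lt (Nat.mul_le_mul_left _ hn1) (Nat.mul_lt_mul_of_pos_right (by omega) hMm)
    rw [htow] at this
    have e : M * (m * m') = m * (M * m') := by ring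
    omega
  have e2 : (minpoly k x).natDegree = M * m' := by
    rw [e1] at htow
    have e : M * (m * m') = m * (M * m') := by ring
    rw [e] at htow
    exact Nat.eq_of_mul_eq_mul_left hm htow
  have hFmin : F = minpoly k x := by
    apply minpoly.unique_of_degree_le_degree_minpoly _ _ hFm hFx
    rw [degree_eq_natDegree hFm.ne_zero, degree_eq_natDegree (minpoly.ne_zero hxk), hFd, e2]
  refine ⟨e1, by rw [hfrk, e2], hfk, ?_⟩
  intro e
  have := norm_sub_eq_eval (k := k) x hfrk.symm (algebraMap 𝔽 k e)
  rw [← IsScalarTower.algebraMap_apply] at this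
  rw [this, ← hFmin, hF]
  simp only [eval_sub, eval_pow, eval_C, eval_map_algebraMap, map_sub, map_pow]
  rw [Polynomial.aeval_algebraMap_apply, ← IsScalarTower.algebraMap_apply]
  rfl
end

section
open Polynomial Module IntermediateField

theorem norm_gen_kummer {K E : Type*} [Field K] [Field E] [Algebra K E] (x : E) (m : ℕ) (hm : 1 ≤ m) (a : K)
    (hx : minpoly K x = X ^ m - C a) :
    Algebra.norm K (AdjoinSimple.gen K x) = - (-1) ^ m * a ∧ Algebra.norm K (- AdjoinSimple.gen K x) = - a := by
  have hintg : IsIntegral K x := not_not.mp fun h ↦ by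
      simpa only [degree_zero, degree_X_pow_sub_C hm,
        WithBot.natCast_ne_bot] using congr_arg degree (hx.symm.trans (dif_neg h))
  have h1 : Algebra.norm K (AdjoinSimple.gen K x) = - (-1) ^ m * a := by
    rw [← adjoin.powerBasis_gen hintg,
      Algebra.PowerBasis.norm_gen_eq_coeff_zero_minpoly]
    have h0 : m ≠ 0 := by omega
    simp [minpoly_gen, hx, h0.symm]
  refine ⟨h1, ?_⟩
  have hfin : FiniteDimensional K K⟮x⟯ := adjoin.finiteDimensional hintg
  have hfr : finrank K K⟮x⟯ = m := by
    rw [adjoin.finrank hintg, hx, natDegree_X_pow_sub_C]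
  rw [← neg_one_mul, map_mul, h1, show (-1 : K⟮x⟯) = algebraMap K _ (-1) by simp, Algebra.norm_algebraMap, hfr]
  have : ((-1:K) ^ m) * (-1) ^ m = 1 := by rw [← mul_pow]; simp
  linear_combination - a * this

theorem irr_two_pow (r : ℕ) {K : Type*} [Field K] (a : K) (h1 : ∀ b : K, b ^ 2 ≠ a) (h2 : ∀ b : K, b ^ 2 ≠ - a) :
    Irreducible (X ^ (2 ^ r) - C a) := by
  induction r generalizing K a with
  | zero => simpa using irreducible_X_sub_C a
  | succ r ih =>
    rw [pow_succ]
    apply X_pow_mul_sub_C_irreducible (X_pow_sub_C_irreducible_of_prime Nat.prime_two h1)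
    intro E _ _ x hx
    obtain ⟨n1, n2⟩ := norm_gen_kummer x 2 (by norm_num) a hx
    apply ih
    · intro b hb
      apply h2 (Algebra.norm K b)
      rw [← map_pow, hb, n1]
      ring
    · intro b hb
      apply h2 (Algebra.norm K b)
      rw [← map_pow, hb, n2]

theorem irr_six (r s : ℕ) {K : Type*} [Field K] (a : K) (h1 : ∀ b : K, b ^ 2 ≠ a) (h2 : ∀ b : K, b ^ 2 ≠ - a)
    (h3 : ∀ b : K, b ^ 3 ≠ a) : Irreducible (X ^ (2 ^ r * 3 ^ s) - C a) := by
  apply X_pow_mul_sub_C_irreducible (X_pow_sub_C_irreducible_of_prime_pow Nat.prime_three (by norm_num) s h3)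
  intro E _ _ x hx
  obtain ⟨n1, n2⟩ := norm_gen_kummer x (3 ^ s) (Nat.one_le_pow _ _ (by norm_num)) a hx
  have ho : Odd (3 ^ s) := Odd.pow (by decide)
  rw [ho.neg_one_pow] at n1
  apply irr_two_pow
  · intro b hb
    apply h1 (Algebra.norm K b)
    rw [← map_pow, hb, n1]
    ring
  · intro b hb
    apply h2 (Algebra.norm K b)
    rw [← map_pow, hb, n2]
end

section
open Polynomial Module

/-- The iterates of `f`. -/
noncomputable def itF (f : ℚ[X]) (n : ℕ) : ℚ[X] := (f.comp ·)^[n] X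

theorem itF_zero (f : ℚ[X]) : itF f 0 = X := rfl

theorem itF_succ (f : ℚ[X]) (n : ℕ) : itF f (n + 1) = f.comp (itF f n) := by
  unfold itF
  rw [Function.iterate_succ_apply']

theorem itF_succ' (f : ℚ[X]) (n : ℕ) : itF f (n + 1) = (itF f n).comp f := by
  induction n with
  | zero => rw [itF_succ, itF_zero, comp_X, X_comp]
  | succ n ih => rw [itF_succ, ih, ← comp_assoc, ← itF_succ, ih]

theorem itF_monic (f : ℚ[X]) (hf : f.Monic) (d : ℕ) (hd : f.natDegree = d) (hd0 : d ≠ 0) (n : ℕ) :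
    (itF f n).Monic ∧ (itF f n).natDegree = d ^ n := by
  induction n with
  | zero => exact ⟨monic_X, by rw [itF_zero]; simp⟩
  | succ n ih =>
    rw [itF_succ']
    refine ⟨ih.1.comp hf (by omega), ?_⟩
    rw [natDegree_comp, ih.2, hd, pow_succ]

/-- The numerators of the critical orbit. -/
def aseq (c : ℤ) (d : ℕ) : ℕ → ℤ
  | 0 => 1
  | n + 1 => (aseq c d n) ^ d + c ^ (d ^ (n + 1) - 1)

theorem aseq_cop (c : ℤ) (d : ℕ) (hd : 2 ≤ d) (n : ℕ) : IsCoprime (aseq c d n) c := by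
  cases n with
  | zero => exact isCoprime_one_left
  | succ n =>
    induction n with
    | zero =>
      have h1 : 2 ≤ d ^ 1 := by simpa using hd
      obtain ⟨k, hk⟩ : ∃ k, d ^ (0 + 1) - 1 = k + 1 := ⟨d ^ 1 - 2, by simp only [zero_add]; omega⟩
      rw [aseq, hk, pow_succ]
      exact (IsCoprime.add_mul_right_left (by simp [aseq, isCoprime_one_left]) _)
    | succ n ih =>
      have h1 : 2 ≤ d ^ (n + 1 + 1) := hd.trans (Nat.le_self_pow (by omega) d)
      obtain ⟨k, hk⟩ : ∃ k, d ^ (n + 1 + 1) - 1 = k + 1 := ⟨d ^ (n + 1 + 1) - 2, by omega⟩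
      rw [aseq, hk, pow_succ]
      exact (IsCoprime.add_mul_right_left (ih.pow_left) _)

theorem eight_mul_le (d : ℕ) (hd : 6 ≤ d) : 8 * d ≤ 2 ^ d := by
  induction d, hd using Nat.le_induction with
  | base => norm_num
  | succ n hn ih => rw [pow_succ]; omega

theorem one_add_pow_le_two (d : ℕ) (hd : 6 ≤ d) (ε : ℝ) (h0 : 0 ≤ ε) (h : d * ε ≤ 1 / 2) : (1 + ε) ^ d ≤ 2 := by
  have hd' : (6:ℝ) ≤ d := by exact_mod_cast hd
  have he : ε ≤ 1 := by nlinarith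
  have hb := one_add_mul_le_pow (a := - ε) (by linarith) d
  have hm : (1 + ε) ^ d * (1 + -ε) ^ d ≤ 1 := by
    rw [← mul_pow]
    exact pow_le_one₀ (by nlinarith) (by nlinarith)
  have hp : 0 ≤ (1 + ε) ^ d := by positivity
  have : (1:ℝ) / 2 ≤ (1 + -ε) ^ d := by linarith
  nlinarith

theorem aseq_bound (c : ℤ) (hc : 2 ≤ |c|) (d : ℕ) (hd : 6 ≤ d) (n : ℕ) :
    |(aseq c d n : ℝ)| ^ d ≤ 2 * |(c:ℝ)| ^ (d ^ (n + 1) - d) := by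
  set C : ℝ := |(c:ℝ)| with hC
  have hC2 : 2 ≤ C := by rw [hC]; exact_mod_cast hc
  induction n with
  | zero => simp [aseq]
  | succ n ih =>
    have hdd : d ≤ d ^ (n + 1) := Nat.le_self_pow (by omega) d
    have h1 : |(aseq c d (n + 1) : ℝ)| ≤ C ^ (d ^ (n + 1) - 1) * (1 + 4 / 2 ^ d) := by
      rw [aseq]
      push_cast
      refine (abs_add_le _ _).trans ?_
      rw [abs_pow, abs_pow, ← hC]
      have e : d ^ (n + 1) - 1 = (d ^ (n + 1) - d) + (d - 1) := by omega
      have h2 : (2:ℝ) ^ d ≤ 2 * C ^ (d - 1) := by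
        obtain ⟨k, rfl⟩ : ∃ k, d = k + 1 := ⟨d - 1, by omega⟩
        rw [pow_succ, Nat.add_sub_cancel]
        have := pow_le_pow_left₀ (by norm_num) hC2 k
        linarith
      have h3 : 2 * C ^ (d ^ (n + 1) - d) ≤ C ^ (d ^ (n + 1) - 1) * (4 / 2 ^ d) := by
        rw [e, pow_add C]
        have h2p : (0:ℝ) < 2 ^ d := by positivity
        rw [mul_div_assoc', le_div_iff₀ h2p]
        have : 0 ≤ C ^ (d ^ (n + 1) - d) := by positivity
        have h5 := mul_le_mul_of_nonneg_left h2 this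
        generalize C ^ (d ^ (n + 1) - d) = P at *
        generalize C ^ (d - 1) = Q at *
        generalize (2:ℝ) ^ d = W at *
        linarith
      linarith
    have h4 : (1 + 4 / (2:ℝ) ^ d) ^ d ≤ 2 := by
      apply one_add_pow_le_two d hd _ (by positivity)
      have h8 : (8 * d : ℝ) ≤ 2 ^ d := by exact_mod_cast eight_mul_le d hd
      have h2p : (0:ℝ) < 2 ^ d := by positivity
      rw [mul_div_assoc', div_le_iff₀ h2p]
      linarith
    have h5 := pow_le_pow_left₀ (abs_nonneg _) h1 d
    rw [mul_pow, ← pow_mul] at h5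
    have e2 : (d ^ (n + 1) - 1) * d = d ^ (n + 1 + 1) - d := by
      rw [Nat.sub_mul, one_mul, ← pow_succ]
    rw [e2] at h5
    have : 0 ≤ C ^ (d ^ (n + 1 + 1) - d) := by positivity
    have h6 := mul_le_mul_of_nonneg_left h4 this
    linarith

theorem aseq_bound' (c : ℤ) (hc : 2 ≤ |c|) (d : ℕ) (hd : 6 ≤ d) (h6 : 6 ∣ d) (n : ℕ) :
    ((aseq c d n) ^ (d / 6)) ^ 6 * |c| ^ 5 ≤ 2 * |c| ^ (d ^ (n + 1) - 1) := by
  have h := aseq_bound c hc d hd n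
  have he : Even d := (by decide : Even 6).trans_dvd h6
  rw [he.pow_abs] at h
  have h' : (aseq c d n) ^ d ≤ 2 * |c| ^ (d ^ (n + 1) - d) := by exact_mod_cast h
  rw [← pow_mul, Nat.div_mul_cancel h6]
  have hdd : d ≤ d ^ (n + 1) := Nat.le_self_pow (by omega) d
  have hp : 0 ≤ |c| ^ 5 := by positivity
  calc (aseq c d n) ^ d * |c| ^ 5 ≤ 2 * |c| ^ (d ^ (n + 1) - d) * |c| ^ 5 := by gcongr
    _ = 2 * |c| ^ (d ^ (n + 1) - d + 5) := by rw [pow_add]; ring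
    _ ≤ 2 * |c| ^ (d ^ (n + 1) - 1) := by
      have : |c| ^ (d ^ (n + 1) - d + 5) ≤ |c| ^ (d ^ (n + 1) - 1) := pow_le_pow_right₀ (by omega) (by omega)
      linarith

theorem aseq_eval (c : ℤ) (hc : c ≠ 0) (d : ℕ) (hd : 6 ≤ d) (f : ℚ[X]) (hf : f = X ^ d + C (1 / (c : ℚ))) (n : ℕ) :
    (aseq c d n : ℚ) = (c:ℚ) ^ (d ^ n) * (itF f (n + 1)).eval 0 := by
  have hc' : (c:ℚ) ≠ 0 := by exact_mod_cast hc
  induction n with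
  | zero =>
    rw [itF_succ, itF_zero, hf]
    have : d ≠ 0 := by omega
    simp [aseq, hc', this]
  | succ n ih =>
    rw [itF_succ, eval_comp, aseq]
    push_cast
    rw [ih]
    generalize (itF f (n + 1)).eval 0 = z
    rw [hf]
    simp only [eval_add, eval_pow, eval_X, eval_C]
    have h1 : 1 ≤ d ^ (n + 1) := Nat.one_le_pow _ _ (by omega)
    obtain ⟨k, hk⟩ : ∃ k, d ^ (n + 1) = k + 1 := ⟨d ^ (n + 1) - 1, by omega⟩
    rw [mul_pow, ← pow_mul, ← pow_succ, hk, Nat.add_sub_cancel, pow_succ]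
    field_simp
end

section
open Polynomial Module

theorem coreN {K : Type*} [Field K] [Algebra ℚ K] (c : ℤ) (hc : c ≠ 0) (d m m' l t n : ℕ) (hd : 6 ≤ d)
    (hdm : d = m * m') (hdl : d = t * l) (f : ℚ[X]) (hf : f = X ^ d + C (1 / (c : ℚ)))
    (x : K) (hx : IntermediateField.adjoin ℚ {x} = ⊤) (hmin : minpoly ℚ x = itF f (n + 1))
    (ε : ℤ) (hε : ε ^ (d ^ n * m') = 1) (b : K)
    (hb : (ε : K) * b ^ l = x - algebraMap ℚ K (1 / (c : ℚ))) :
    ∃ g S : K, (minpoly ℚ g).natDegree = m ∧ g ^ m = - (c : K) ^ (d ^ (n + 1) - 1) ∧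
      S ∈ IntermediateField.adjoin ℚ {g} ∧ S ^ l = ((aseq c d n : ℤ) : K) ^ m' - g := by
  haveI : CharZero K := algebraRat.charZero K
  have hcQ : (c:ℚ) ≠ 0 := by exact_mod_cast hc
  have hcK : (c:K) ≠ 0 := by exact_mod_cast hc
  have e1 : algebraMap ℚ K (1 / (c : ℚ)) = 1 / (c : K) := by simp
  have hfm : f.Monic := by rw [hf]; exact monic_X_pow_add_C _ (by omega)
  have hfd : f.natDegree = d := by rw [hf]; exact natDegree_X_pow_add_C
  have hA := itF_monic f hfm d hfd (by omega) n
  have hA1 := itF_monic f hfm d hfd (by omega) (n + 1)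
  have hxi : IsIntegral ℚ x := by
    by_contra h
    rw [minpoly.eq_zero h] at hmin
    exact hA1.1.ne_zero hmin.symm
  have hm : 1 ≤ m := by rcases Nat.eq_zero_or_pos m with h | h <;> [(subst h; omega); exact h]
  have hm' : 1 ≤ m' := by rcases Nat.eq_zero_or_pos m' with h | h <;> [(subst h; omega); exact h]
  have hM1 : 1 ≤ d ^ n := Nat.one_le_pow _ _ (by omega)
  set α := aeval x (itF f n) with hα
  have hαd : α ^ d = - (1 / (c : K)) := by
    have h := minpoly.aeval ℚ x
    rw [hmin, itF_succ, aeval_comp, ← hα] at h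
    rw [hf] at h
    simp only [map_add, map_pow, aeval_X, aeval_C] at h
    rw [e1] at h
    linear_combination h
  have hα0 : α ≠ 0 := by
    intro h
    rw [h, zero_pow (by omega)] at hαd
    have : (1 / (c : K)) ≠ 0 := one_div_ne_zero hcK
    exact this (by linear_combination hαd)
  obtain ⟨r1, r2, r3, r4⟩ := relnorm x hx hxi (itF f n) hA.1 (d ^ n) m m' hA.2 hM1 hm hm'
    (by rw [hmin, hA1.2, pow_succ, hdm]) (-(1 / (c : ℚ))) (by rw [← hα, ← hdm, hαd, map_neg, e1])
    ((c : ℚ) ^ (d ^ n * m')) (pow_ne_zero _ hcQ) _ rfl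
  rw [← hα] at r1 r2 r3 r4
  set g := algebraMap ℚ K ((c : ℚ) ^ (d ^ n * m')) * α ^ m' with hg
  have hg2 : g = (c : K) ^ (d ^ n * m') * α ^ m' := by rw [hg]; simp
  set N := Algebra.norm (IntermediateField.adjoin ℚ {g}) (S := K) with hN
  refine ⟨g, algebraMap _ K (N (b / α ^ t)), r1, ?_, SetLike.coe_mem _, ?_⟩
  · have h1 : 1 ≤ d ^ (n + 1) := Nat.one_le_pow _ _ (by omega)
    obtain ⟨k, hk⟩ : ∃ k, d ^ (n + 1) = k + 1 := ⟨d ^ (n + 1) - 1, by omega⟩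
    have e2 : d ^ n * m' * m = k + 1 := by rw [← hk, pow_succ, mul_assoc, mul_comm m' m, ← hdm]
    rw [hg2, mul_pow, ← pow_mul, ← pow_mul, e2, mul_comm m' m, ← hdm, hαd, hk, Nat.add_sub_cancel, pow_succ]
    field_simp
  · have e3 : algebraMap ℚ K (c : ℚ) * (algebraMap ℚ K (1 / (c : ℚ)) - x) = (ε : K) * (b / α ^ t) ^ l := by
      rw [div_pow, ← pow_mul, ← hdl, hαd, ← mul_div_assoc, hb, e1]
      simp only [map_intCast]
      field_simp
      ring
    have e4 := congrArg (fun z => algebraMap (IntermediateField.adjoin ℚ {g}) K (N z)) e3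
    simp only [map_mul, map_pow] at e4
    rw [r4] at e4
    have nc : ∀ q : ℤ, algebraMap (IntermediateField.adjoin ℚ {g}) K (N (q : K)) = (q : K) ^ (d ^ n * m') := by
      intro q
      have : (q : K) = algebraMap (IntermediateField.adjoin ℚ {g}) K (q : IntermediateField.adjoin ℚ {g}) := by simp
      rw [this, hN, Algebra.norm_algebraMap, r2, map_pow]
    have e5 : algebraMap ℚ K (c : ℚ) = (c : K) := by simp
    rw [e5, nc, nc] at e4
    have e6 : (ε : K) ^ (d ^ n * m') = 1 := by exact_mod_cast hε
    rw [e6, one_mul] at e4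
    rw [← e4, hg2]
    have e7 : (itF f n).eval (1 / (c : ℚ)) = (itF f (n + 1)).eval 0 := by
      rw [itF_succ', eval_comp]
      congr 1
      rw [hf]
      have : d ≠ 0 := by omega
      simp [this]
    have e8 := congrArg (algebraMap ℚ K) (aseq_eval c hc d hd f hf n)
    rw [map_intCast, map_mul, map_pow, e5, ← e7] at e8
    rw [e8, mul_pow, ← pow_mul, map_pow]
    ring

theorem D_facts (d n : ℕ) (hd : 6 ≤ d) (h6 : 6 ∣ d) :
    Odd (d ^ (n + 1) - 1) ∧ Nat.Coprime 3 (d ^ (n + 1) - 1) ∧ 5 ≤ d ^ (n + 1) - 1 ∧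
      (n ≠ 0 → 35 ≤ d ^ (n + 1) - 1) := by
  have h1 : d ≤ d ^ (n + 1) := Nat.le_self_pow (by omega) d
  have h2 : 6 ∣ d ^ (n + 1) := dvd_pow h6 (by omega)
  refine ⟨?_, ?_, by omega, ?_⟩
  · rw [Nat.odd_iff]; omega
  · rw [Nat.Prime.coprime_iff_not_dvd Nat.prime_three]; omega
  · intro hn
    have h3 : d ^ 2 ≤ d ^ (n + 1) := Nat.pow_le_pow_right (by omega) (by omega)
    have : 36 ≤ d ^ 2 := by nlinarith
    omega

theorem R_facts (c : ℤ) (hc : 2 ≤ |c|) (d n : ℕ) (hd : 6 ≤ d) (h6 : 6 ∣ d) :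
    (aseq c d n) ^ (d / 6) ≠ 0 ∧ IsCoprime ((aseq c d n) ^ (d / 6)) c ∧
    ((aseq c d n) ^ (d / 6) = 1 ∨ 35 ≤ d ^ (n + 1) - 1) := by
  have h := aseq_cop c d (by omega) n
  refine ⟨?_, h.pow_left, ?_⟩
  · apply pow_ne_zero
    intro h0
    rw [h0, isCoprime_zero_left, Int.isUnit_iff_abs_eq] at h
    omega
  · rcases Nat.eq_zero_or_pos n with h0 | h0
    · left; subst h0; simp [aseq]
    · right; exact (D_facts d n hd h6).2.2.2 (by omega)

theorem no_sq {K : Type*} [Field K] [Algebra ℚ K] (c : ℤ) (hc : 2 ≤ |c|) (d n : ℕ) (hd : 6 ≤ d) (h6 : 6 ∣ d)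
    (f : ℚ[X]) (hf : f = X ^ d + C (1 / (c : ℚ)))
    (x : K) (hx : IntermediateField.adjoin ℚ {x} = ⊤) (hmin : minpoly ℚ x = itF f (n + 1))
    (ε : ℤ) (hε : ε ^ 2 = 1) (b : K)
    (hb : (ε : K) * b ^ 2 = x - algebraMap ℚ K (1 / (c : ℚ))) : False := by
  have hc0 : c ≠ 0 := by rintro rfl; simp at hc
  obtain ⟨k, hk⟩ := h6
  obtain ⟨g, S, h1, h2, h3, h4⟩ := coreN c hc0 d 3 (2 * k) 2 (3 * k) n hd (by omega) (by omega) f hf x hx hmin ε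
    (by rw [mul_comm, mul_assoc, pow_mul, hε, one_pow]) b hb
  have hk6 : d / 6 = k := by omega
  obtain ⟨a1, a2, a3, a4⟩ := D_facts d n hd ⟨k, hk⟩
  obtain ⟨b1, b2, b3⟩ := R_facts c hc d n hd ⟨k, hk⟩
  have b4 := aseq_bound' c hc d hd ⟨k, hk⟩ n
  obtain ⟨X, y, h5, h6⟩ := field2 g c ((aseq c d n) ^ (d / 6)) _ h1 h2 S h3
    (by rw [h4, hk6]; push_cast; rw [← pow_mul, mul_comm 2 k])
  exact arith2 c _ X y _ a1 a2 a3 hc b1 b2 b4 b3 h5 h6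

theorem no_cube {K : Type*} [Field K] [Algebra ℚ K] (c : ℤ) (hc : 2 ≤ |c|) (d n : ℕ) (hd : 6 ≤ d) (h6 : 6 ∣ d)
    (f : ℚ[X]) (hf : f = X ^ d + C (1 / (c : ℚ)))
    (x : K) (hx : IntermediateField.adjoin ℚ {x} = ⊤) (hmin : minpoly ℚ x = itF f (n + 1)) (b : K)
    (hb : b ^ 3 = x - algebraMap ℚ K (1 / (c : ℚ))) : False := by
  have hc0 : c ≠ 0 := by rintro rfl; simp at hc
  obtain ⟨k, hk⟩ := h6
  obtain ⟨g, S, h1, h2, h3, h4⟩ := coreN c hc0 d 6 k 3 (2 * k) n hd (by omega) (by omega) f hf x hx hmin 1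
    (one_pow _) b (by rw [← hb]; simp)
  have hk6 : d / 6 = k := by omega
  obtain ⟨a1, a2, a3, a4⟩ := D_facts d n hd ⟨k, hk⟩
  obtain ⟨b1, b2, b3⟩ := R_facts c hc d n hd ⟨k, hk⟩
  have b4 := aseq_bound' c hc d hd ⟨k, hk⟩ n
  obtain ⟨x0, x1, x2, x3, x4, x5, X, y, h5, h6, h7, h8⟩ := field3 g c ((aseq c d n) ^ (d / 6)) _ h1 h2 S h3
    (by rw [h4, hk6]; push_cast; rfl)
  exact arith3 c _ X y _ a1 a3 hc b1 b2 b4 b3 h5 h6 (fun p hp hp3 hv =>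
    padicB p hp hp3 c _ X hc0 _ a2 hv x0 x1 x2 x3 x4 x5 h7 h8)

theorem adjoin_gen_top {F E : Type*} [Field F] [Field E] [Algebra F E] (x : E) :
    IntermediateField.adjoin F {IntermediateField.AdjoinSimple.gen F x} = ⊤ := by
  apply IntermediateField.map_injective (IntermediateField.adjoin F {x}).val
  rw [IntermediateField.adjoin_map]
  simp [← AlgHom.fieldRange_eq_map]

theorem abs_c (c : ℤ) (hc : c ≠ 0) (d : ℕ) (h6 : 6 ∣ d) (f : ℚ[X]) (hf : f = X ^ d + C (1 / (c : ℚ)))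
    (hirr : Irreducible f) : 2 ≤ |c| := by
  by_contra hlt
  have h1 : |c| = 1 := by have := abs_pos.mpr hc; omega
  have hf2 : f = X ^ d - C (-(1 / (c : ℚ))) := by rw [hf, map_neg, sub_neg_eq_add]
  rw [hf2] at hirr
  have h3 : 3 ∣ d := (by norm_num : 3 ∣ 6).trans h6
  refine pow_ne_of_irreducible_X_pow_sub_C hirr h3 (by norm_num) (-(c:ℚ)) ?_
  rcases (abs_eq (by norm_num)).mp h1 with h | h <;> subst h <;> norm_num

theorem step_irr (r s : ℕ) (d : ℕ) (hd : d = 2 ^ r * 3 ^ s)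
    (c : ℤ) (f : ℚ[X]) (hf : f = X ^ d + C (1 / (c : ℚ))) (hc2 : 2 ≤ |c|) (hd6 : 6 ≤ d) (h6 : 6 ∣ d) (n : ℕ)
    {K : Type*} [Field K] [Algebra ℚ K] (w : K) (hwt : IntermediateField.adjoin ℚ {w} = ⊤)
    (hwm : minpoly ℚ w = itF f (n + 1)) : Irreducible (f.map (algebraMap ℚ K) - C w) := by
  have e : f.map (algebraMap ℚ K) - C w = X ^ (2 ^ r * 3 ^ s) - C (w - algebraMap ℚ K (1 / (c : ℚ))) := by
    rw [hf, ← hd, Polynomial.map_add, Polynomial.map_pow, map_X, map_C, C_sub]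
    ring
  rw [e]
  apply irr_six
  · intro b hb
    exact no_sq c hc2 d n hd6 h6 f hf w hwt hwm 1 (by norm_num) b (by rw [← hb]; simp)
  · intro b hb
    exact no_sq c hc2 d n hd6 h6 f hf w hwt hwm (-1) (by norm_num) b (by rw [hb]; simp)
  · intro b hb
    exact no_cube c hc2 d n hd6 h6 f hf w hwt hwm b hb

theorem main_it (r s : ℕ) (hr : 1 ≤ r) (hs : 1 ≤ s) (d : ℕ) (hd : d = 2 ^ r * 3 ^ s)
    (c : ℤ) (hc : c ≠ 0)
    (f : ℚ[X]) (hf : f = X ^ d + C (1 / (c : ℚ))) (hirr : Irreducible f) (n : ℕ) :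
    Irreducible (itF f (n + 1)) := by
  have h6 : 6 ∣ d := by
    rw [hd]
    exact mul_dvd_mul (a := 2) (c := 3) (dvd_pow_self 2 (by omega)) (dvd_pow_self 3 (by omega))
  have hd6 : 6 ≤ d := Nat.le_of_dvd (by rw [hd]; positivity) h6
  have hc2 := abs_c c hc d h6 f hf hirr
  have hfm : f.Monic := by rw [hf]; exact monic_X_pow_add_C _ (by omega)
  have hfd : f.natDegree = d := by rw [hf]; exact natDegree_X_pow_add_C
  induction n with
  | zero => rw [itF_succ, itF_zero, comp_X]; exact hirr
  | succ n ih =>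
    rw [itF_succ']
    refine Polynomial.irreducible_comp (itF_monic f hfm d hfd (by omega) _).1 hfm ih ?_
    intro E _ _ x hx
    exact @step_irr r s d hd c f hf hc2 hd6 h6 n _ _ (IntermediateField.algebra' _) _ (adjoin_gen_top x)
      ((IntermediateField.minpoly_gen ℚ x).trans hx)
end

open Polynomial

/-- If `d = 2^r · 3^s` with `r, s ≥ 1`, `c` a nonzero integer, and `f(z) = z^d + 1/c`
is irreducible over `ℚ`, then every iterate `fⁿ` (`n ≥ 1`) is irreducible over `ℚ`. -/
theorem stmt3 (r s : ℕ) (hr : 1 ≤ r) (hs : 1 ≤ s) (d : ℕ) (hd : d = 2 ^ r * 3 ^ s)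
    (c : ℤ) (hc : c ≠ 0)
    (f : ℚ[X]) (hf : f = X ^ d + C (1 / (c : ℚ))) (hirr : Irreducible f) :
    ∀ n : ℕ, 1 ≤ n → Irreducible ((f.comp ·)^[n] X) := by
  intro n hn
  obtain ⟨k, rfl⟩ : ∃ k, n = k + 1 := ⟨n - 1, by omega⟩
  exact main_it r s hr hs d hd c hc f hf hirr k
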